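/- Let ε = (1/2)·(1 - β/n) and t_ε := ln(13·d·n/(σ·δ_ε)). Then for all t ≥ t_ε, the probability under μ that ln C(z) > t is at most ((13·d·n/σ)·e^{-t})^{(1/2)·(1 - β/n)}. -/

import Mathlib

open MeasureTheory Filter
open scoped RealInnerProductSpace ENNReal

/-- `I_m(σ) := ∫₀^σ r^{m-1} / √(1 - r²) dr`. -/
noncomputable def Ifun (m σ : ℝ) : ℝ :=
  ∫ r in (0:ℝ)..σ, r ^ (m - 1) / Real.sqrt (1 - r ^ 2)

/-- The spherical cap `{z ∈ Sⁿ : ⟨z,a⟩ > √(1-ρ²)}` in `Sⁿ ⊆ ℝ^{n+1}`. -/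
noncomputable def cap (n : ℕ) (a : EuclideanSpace ℝ (Fin (n + 1))) (ρ : ℝ) :
    Set (EuclideanSpace ℝ (Fin (n + 1))) :=
  {z | z ∈ Metric.sphere (0 : EuclideanSpace ℝ (Fin (n + 1))) 1 ∧
       Real.sqrt (1 - ρ ^ 2) < ⟪z, a⟫}

/-- `ν_{a,σ}`: the uniform probability measure on `cap(a,σ)`, i.e. the normalized
`n`-dimensional Hausdorff (surface) measure restricted to `cap(a,σ)`. -/
noncomputable def nuMeasure (n : ℕ) (a : EuclideanSpace ℝ (Fin (n + 1))) (σ : ℝ) :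
    Measure (EuclideanSpace ℝ (Fin (n + 1))) :=
  (μH[(n : ℝ)] (cap n a σ))⁻¹ • (μH[(n : ℝ)]).restrict (cap n a σ)

/-- `g(r) = C_{β,σ} · r^{-β} · h(r)` with `C_{β,σ} = I_n(σ)/I_{n-β}(σ)`. -/
noncomputable def gFun (n : ℕ) (σ β : ℝ) (h : ℝ → ℝ) (r : ℝ) : ℝ :=
  (Ifun n σ / Ifun ((n : ℝ) - β) σ) * r ^ (-β) * h r

/-- The adversarial measure: the density of `μ` with respect to `ν_{a,σ}` at `z` is
`f(z) = g(sin θ(z,a))`, where `sin θ(z,a) = √(1 - ⟨z,a⟩²)` for unit vectors `z, a`. -/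
noncomputable def advMeasure (n : ℕ) (a : EuclideanSpace ℝ (Fin (n + 1))) (σ β : ℝ)
    (h : ℝ → ℝ) : Measure (EuclideanSpace ℝ (Fin (n + 1))) :=
  (nuMeasure n a σ).withDensity
    (fun z => ENNReal.ofReal (gFun n σ β h (Real.sqrt (1 - ⟪z, a⟫ ^ 2))))

open Polynomial in
theorem mahlerMeasure_comp_C_mul_X_eq_prod (p : ℂ[X]) (κ : ℂ) :
    (p.comp (C κ * X)).mahlerMeasure =
      ‖p.leadingCoeff‖ * (p.roots.map (fun r => max ‖κ‖ ‖r‖)).prod := by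
  have hp := (IsAlgClosed.splits p).eq_prod_roots
  conv_lhs => rw [hp]
  rw [mul_comp, C_comp, mahlerMeasure_mul, mahlerMeasure_const, multiset_prod_comp,
    prod_mahlerMeasure_eq_mahlerMeasure_prod, Multiset.map_map, Multiset.map_map]
  congr 3
  funext r
  by_cases hκ : κ = 0
  · subst hκ
    simp [-map_neg]
  · simp [sub_eq_add_neg, ← map_neg, mahlerMeasure_C_mul_X_add_C hκ]

/-- Convexity of circle means of `log ‖p‖` in the logarithm of the radius, multiplicatively. -/
theorem mahlerMeasure_sq_le_comp_mul_comp_inv (p : Polynomial ℂ) {κ : ℂ} (hκ : κ ≠ 0) :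
    p.mahlerMeasure ^ 2 ≤ (p.comp (Polynomial.C κ * Polynomial.X)).mahlerMeasure *
      (p.comp (Polynomial.C κ⁻¹ * Polynomial.X)).mahlerMeasure := by
  rw [mahlerMeasure_comp_C_mul_X_eq_prod, mahlerMeasure_comp_C_mul_X_eq_prod,
    p.mahlerMeasure_eq_leadingCoeff_mul_prod_roots, mul_pow, mul_mul_mul_comm, ← pow_two,
    ← Multiset.prod_map_mul, ← Multiset.prod_map_pow]
  refine mul_le_mul_of_nonneg_left ?_ (by positivity)
  refine Multiset.prod_map_le_prod_map₀ _ _ (fun r _ => by positivity) fun r _ => ?_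
  have hk : 0 < ‖κ‖ := norm_pos_iff.2 hκ
  rw [norm_inv, pow_two]
  rcases le_total 1 ‖r‖ with h | h
  · rw [max_eq_right h]
    exact mul_le_mul (le_max_right _ _) (le_max_right _ _) (norm_nonneg _) (by positivity)
  · rw [max_eq_left h]
    calc (1 : ℝ) * 1 = ‖κ‖ * ‖κ‖⁻¹ := by field_simp
      _ ≤ _ := mul_le_mul (le_max_left _ _) (le_max_left _ _) (by positivity) (by positivity)

open Polynomial in
/-- If `Q 0 = 0`, there is a polynomial `N` with `N ω = Q c * Q (-c)` whenever
`c ^ 2 = 1 + (lam ω)²`, and whose Mahler measure beats `‖Q 1 * Q (-1)‖` by the factor `lam²`. -/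
theorem exists_mahlerMeasure_norm_polynomial (Q : ℂ[X]) (hQ : Q.eval 0 = 0) {lam : ℝ}
    (hlam : 1 ≤ lam) :
    ∃ N : ℂ[X], (∀ ω c : ℂ, c ^ 2 = 1 + (lam * ω) ^ 2 →
        N.eval ω = Q.eval c * Q.eval (-c)) ∧
      lam ^ 2 * (‖Q.eval 1‖ * ‖Q.eval (-1)‖) ≤ N.mahlerMeasure := by
  have key : ∀ s : Multiset ℂ, ∃ N : ℂ[X], (∀ ω c : ℂ, c ^ 2 = 1 + (lam * ω) ^ 2 →
        N.eval ω = ((s.map (fun r => X - C r)).prod).eval c *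
          ((s.map (fun r => X - C r)).prod).eval (-c)) ∧
      ‖((s.map (fun r => X - C r)).prod).eval 1‖ * ‖((s.map (fun r => X - C r)).prod).eval (-1)‖
        ≤ N.mahlerMeasure := by
    intro s
    induction s using Multiset.induction_on with
    | empty => exact ⟨1, by simp⟩
    | cons r s ih =>
      obtain ⟨N, hN1, hN2⟩ := ih
      obtain ⟨μ, hμ⟩ := IsAlgClosed.exists_pow_nat_eq (r ^ 2 - 1) (n := 2) (by norm_num)
      have hl : (lam : ℂ) ≠ 0 := by
        simp only [ne_eq, Complex.ofReal_eq_zero]; linarith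
      refine ⟨C (-1) * ((C (lam : ℂ) * X + C μ) * (C (lam : ℂ) * X + C (-μ))) * N, ?_, ?_⟩
      · intro ω c hc
        simp only [Multiset.map_cons, Multiset.prod_cons, eval_mul, hN1 ω c hc, eval_add,
          eval_sub, eval_X, eval_C]
        linear_combination (-(eval c (s.map (fun r => X - C r)).prod *
          eval (-c) (s.map (fun r => X - C r)).prod)) * (-hμ - hc)
      · rw [mahlerMeasure_mul, mahlerMeasure_mul, mahlerMeasure_mul,
          mahlerMeasure_C_mul_X_add_C hl, mahlerMeasure_C_mul_X_add_C hl, mahlerMeasure_const]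
        simp only [Multiset.map_cons, Multiset.prod_cons, eval_mul, norm_mul, norm_neg, norm_one,
          one_mul, eval_sub, eval_X, eval_C]
        have h1 : ‖1 - r‖ * ‖-1 - r‖ = ‖μ‖ * ‖μ‖ := by
          rw [← norm_mul, ← norm_mul, ← pow_two, hμ]; congr 1; ring
        calc _ = (‖1 - r‖ * ‖-1 - r‖) * (‖eval 1 (s.map (fun r => X - C r)).prod‖ *
              ‖eval (-1) (s.map (fun r => X - C r)).prod‖) := by ring
          _ ≤ _ := by
              rw [h1]
              exact mul_le_mul (mul_le_mul (le_max_right _ _) (le_max_right _ _) (norm_nonneg _)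
                (by positivity)) hN2 (by positivity) (by positivity)
  by_cases hQ0 : Q = 0
  · exact ⟨0, by simp [hQ0]⟩
  have hmem : (0 : ℂ) ∈ Q.roots := by simp [hQ0, hQ]
  obtain ⟨s, hs⟩ := Multiset.exists_cons_of_mem hmem
  obtain ⟨N, hN1, hN2⟩ := key s
  have hp := (IsAlgClosed.splits Q).eq_prod_roots
  rw [hs, Multiset.map_cons, Multiset.prod_cons] at hp
  set l := Q.leadingCoeff
  have hev : ∀ z, Q.eval z = l * (z * ((s.map (fun r => X - C r)).prod).eval z) := by
    intro z
    conv_lhs => rw [hp]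
    simp
  have hl : (lam : ℂ) ≠ 0 := by
    simp only [ne_eq, Complex.ofReal_eq_zero]; linarith
  have hlam' : ‖(lam : ℂ)‖ = lam := by
    rw [Complex.norm_real, Real.norm_of_nonneg (by linarith)]
  refine ⟨C (-l ^ 2) * ((C (lam : ℂ) * X + C Complex.I) * (C (lam : ℂ) * X + C (-Complex.I))) * N,
    ?_, ?_⟩
  · intro ω c hc
    rw [hev, hev]
    simp only [eval_mul, hN1 ω c hc, eval_add, eval_X, eval_C]
    have hI := Complex.I_sq
    linear_combination (l ^ 2 * (eval c (s.map (fun r => X - C r)).prod *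
          eval (-c) (s.map (fun r => X - C r)).prod)) * (hc + hI)
  · rw [mahlerMeasure_mul, mahlerMeasure_mul, mahlerMeasure_mul,
      mahlerMeasure_C_mul_X_add_C hl, mahlerMeasure_C_mul_X_add_C hl, mahlerMeasure_const,
      hev, hev, hlam']
    simp only [Complex.norm_I, max_eq_left hlam, norm_mul, norm_neg, norm_one, one_mul, norm_pow]
    calc _ = ‖l‖ ^ 2 * (lam * lam) * (‖eval 1 (s.map (fun r => X - C r)).prod‖ *
              ‖eval (-1) (s.map (fun r => X - C r)).prod‖) := by ring
      _ ≤ _ := mul_le_mul_of_nonneg_left hN2 (by positivity)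

/-- `M - log x` as an extended nonnegative real, equal to `∞` at `x = 0`. -/
noncomputable def logDefect (M x : ℝ) : ℝ≥0∞ :=
  if x = 0 then ∞ else ENNReal.ofReal (M - Real.log x)

theorem measurable_logDefect (M : ℝ) : Measurable (logDefect M) :=
  Measurable.ite (measurableSet_singleton 0) measurable_const (by fun_prop)

theorem logDefect_zero (M : ℝ) : logDefect M 0 = ∞ := by simp [logDefect]

theorem logDefect_of_pos (M : ℝ) {x : ℝ} (hx : 0 < x) :
    logDefect M x = ENNReal.ofReal (M - Real.log x) := by simp [logDefect, hx.ne']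

theorem logDefect_anti (M : ℝ) {x y : ℝ} (hx : 0 ≤ x) (hxy : x ≤ y) :
    logDefect M y ≤ logDefect M x := by
  rcases hx.eq_or_lt with rfl | hx
  · simp [logDefect_zero]
  · rw [logDefect_of_pos M hx, logDefect_of_pos M (hx.trans_le hxy)]
    exact ENNReal.ofReal_le_ofReal (by linarith [Real.log_le_log hx hxy])

theorem logDefect_mul {M N x y : ℝ} (hx : 0 ≤ x) (hy : 0 ≤ y) (hxM : x ≤ Real.exp M)
    (hyN : y ≤ Real.exp N) : logDefect M x + logDefect N y = logDefect (M + N) (x * y) := by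
  rcases hx.eq_or_lt with rfl | hx
  · simp [logDefect_zero]
  rcases hy.eq_or_lt with rfl | hy
  · simp [logDefect_zero]
  rw [logDefect_of_pos M hx, logDefect_of_pos N hy, logDefect_of_pos _ (mul_pos hx hy),
    ← ENNReal.ofReal_add, Real.log_mul hx.ne' hy.ne']
  · congr 1; ring
  · linarith [(Real.log_le_iff_le_exp hx).2 hxM]
  · linarith [(Real.log_le_iff_le_exp hy).2 hyN]

theorem logDefect_const_mul {M k x : ℝ} (hk : 1 ≤ k) (hx : 0 ≤ x) (hkx : k * x ≤ Real.exp M) :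
    logDefect M (k * x) + ENNReal.ofReal (Real.log k) = logDefect M x := by
  have hk0 : 0 < k := by linarith
  rcases hx.eq_or_lt with rfl | hx
  · simp [logDefect_zero]
  have hkx' := (Real.log_le_iff_le_exp (mul_pos hk0 hx)).2 hkx
  rw [logDefect_of_pos M hx, logDefect_of_pos _ (mul_pos hk0 hx),
    ← ENNReal.ofReal_add (by linarith) (Real.log_nonneg hk), Real.log_mul hk0.ne' hx.ne']
  congr 1; ring

/-- The integral over the unit circle of an extended nonnegative function, with respect to
arc length. -/
noncomputable def circleLIntegral (F : ℂ → ℝ≥0∞) : ℝ≥0∞ :=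
  ∫⁻ θ in Set.Ioc 0 (2 * Real.pi), F (circleMap 0 1 θ)

theorem circleLIntegral_mono {F G : ℂ → ℝ≥0∞} (h : ∀ ω : ℂ, ‖ω‖ = 1 → F ω ≤ G ω) :
    circleLIntegral F ≤ circleLIntegral G :=
  lintegral_mono fun θ => h _ (by simp [circleMap])

theorem circleLIntegral_congr {F G : ℂ → ℝ≥0∞} (h : ∀ ω : ℂ, ‖ω‖ = 1 → F ω = G ω) :
    circleLIntegral F = circleLIntegral G :=
  le_antisymm (circleLIntegral_mono fun ω hω => (h ω hω).le)
    (circleLIntegral_mono fun ω hω => (h ω hω).ge)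

theorem circleLIntegral_add {F G : ℂ → ℝ≥0∞} (hF : Measurable F) :
    circleLIntegral (fun ω => F ω + G ω) = circleLIntegral F + circleLIntegral G :=
  lintegral_add_left (hF.comp (continuous_circleMap 0 1).measurable) _

theorem circleLIntegral_const (c : ℝ≥0∞) :
    circleLIntegral (fun _ => c) = ENNReal.ofReal (2 * Real.pi) * c := by
  simp [circleLIntegral, mul_comm]

theorem circleLIntegral_neg (F : ℂ → ℝ≥0∞) :
    circleLIntegral (fun ω => F (-ω)) = circleLIntegral F := by
  have : Fact (0 < 2 * Real.pi) := ⟨Real.two_pi_pos⟩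
  have h : ∀ G : ℂ → ℝ≥0∞, circleLIntegral G =
      ∫⁻ x : AddCircle (2 * Real.pi), G (AddCircle.toCircle x) := by
    intro G
    have := AddCircle.lintegral_preimage (2 * Real.pi) 0 (fun x => G (AddCircle.toCircle x))
    rw [zero_add] at this
    rw [circleLIntegral, ← this]
    refine lintegral_congr fun θ => ?_
    congr 1
    rw [AddCircle.toCircle_apply_mk, Circle.coe_exp]
    simp [circleMap, Real.pi_ne_zero]
  rw [h, h, ← lintegral_add_right_eq_self _ ((Real.pi : ℝ) : AddCircle (2 * Real.pi))]
  refine lintegral_congr fun x => ?_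
  congr 1
  rw [AddCircle.toCircle_add, Circle.coe_mul, AddCircle.toCircle_apply_mk, Circle.coe_exp]
  simp [Real.pi_ne_zero]

theorem circleLIntegral_swap {F : ℂ → ℂ → ℝ≥0∞} (hF : Measurable (Function.uncurry F)) :
    circleLIntegral (fun ω => circleLIntegral (fun z => F ω z)) =
      circleLIntegral (fun z => circleLIntegral (fun ω => F ω z)) := by
  have hc : Measurable (circleMap 0 1) := (continuous_circleMap 0 1).measurable
  exact lintegral_lintegral_swap (hF.comp (hc.prodMap hc)).aemeasurable

theorem measurable_circleLIntegral {F : ℂ → ℂ → ℝ≥0∞} (hF : Measurable (Function.uncurry F)) :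
    Measurable (fun ω => circleLIntegral (fun z => F ω z)) := by
  unfold circleLIntegral
  refine Measurable.lintegral_prod_right' (f := fun p : ℂ × ℝ => F p.1 (circleMap 0 1 p.2)) ?_
  exact hF.comp (measurable_id.prodMap (continuous_circleMap 0 1).measurable)

theorem circleLIntegral_logDefect_eval (M : ℝ) (G : Polynomial ℂ)
    (hM : ∀ ω : ℂ, ‖ω‖ = 1 → ‖G.eval ω‖ ≤ Real.exp M) :
    circleLIntegral (fun ω => logDefect M ‖G.eval ω‖) =
      ENNReal.ofReal (2 * Real.pi) * logDefect M G.mahlerMeasure := by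
  by_cases hG : G = 0
  · simp [hG, logDefect_zero, circleLIntegral_const]
  have hint : IntervalIntegrable (fun θ => M - Real.log ‖G.eval (circleMap 0 1 θ)‖) volume
      0 (2 * Real.pi) := by
    refine intervalIntegrable_const.sub ?_
    have := ((analyticOnNhd_id.aeval_polynomial G).meromorphicOn
      (U := Metric.sphere (0 : ℂ) |1|)).circleIntegrable_log_norm
    simpa [CircleIntegrable] using this
  have hpos : ∀ θ : ℝ, G.eval (circleMap 0 1 θ) ≠ 0 →
      0 ≤ M - Real.log ‖G.eval (circleMap 0 1 θ)‖ := by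
    intro θ h
    have := (Real.log_le_iff_le_exp (norm_pos_iff.2 h)).2 (hM (circleMap 0 1 θ) (by simp [circleMap]))
    linarith
  have hne : ∀ᵐ θ ∂(volume.restrict (Set.Ioc 0 (2 * Real.pi))),
      G.eval (circleMap 0 1 θ) ≠ 0 := by
    rw [ae_restrict_iff' measurableSet_Ioc, ae_iff]
    refine Set.Finite.measure_zero ?_ _
    apply Set.Finite.of_finite_image (f := circleMap 0 1) _ <|
      (injOn_circleMap_of_abs_sub_le one_ne_zero (a := 0) (b := 2 * Real.pi)
        (by simp [abs_of_pos Real.pi_pos])).mono (fun θ h => by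
          simp only [not_forall, Set.mem_ofPred_eq] at h
          rw [Set.uIoc_of_le Real.two_pi_pos.le]; exact h.1)
    apply G.roots.toFinset.finite_toSet.subset
    rintro _ ⟨θ, hθ, rfl⟩
    simp only [not_forall, not_not, Set.mem_ofPred_eq] at hθ
    simp [hG, hθ.2]
  have hmm : Real.log G.mahlerMeasure = (2 * Real.pi)⁻¹ *
      ∫ θ in (0 : ℝ)..2 * Real.pi, Real.log ‖G.eval (circleMap 0 1 θ)‖ := by
    rw [← G.logMahlerMeasure_eq_log_MahlerMeasure, G.logMahlerMeasure_def, Real.circleAverage_def,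
      smul_eq_mul]
  have h1 : circleLIntegral (fun ω => logDefect M ‖G.eval ω‖) =
      ∫⁻ θ in Set.Ioc 0 (2 * Real.pi),
        ENNReal.ofReal (M - Real.log ‖G.eval (circleMap 0 1 θ)‖) := by
    refine lintegral_congr_ae ?_
    filter_upwards [hne] with θ hθ
    exact logDefect_of_pos M (norm_pos_iff.2 hθ)
  rw [h1, logDefect_of_pos M (Polynomial.mahlerMeasure_pos_of_ne_zero hG),
    ← ENNReal.ofReal_mul Real.two_pi_pos.le, ← ofReal_integral_eq_lintegral_ofReal]
  · congr 1
    rw [← intervalIntegral.integral_of_le Real.two_pi_pos.le, hmm, intervalIntegral.integral_sub]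
    · simp only [intervalIntegral.integral_const, sub_zero, smul_eq_mul]
      field_simp
    · exact intervalIntegrable_const
    · simpa using (intervalIntegrable_const (c := M)).sub hint
  · rwa [intervalIntegrable_iff_integrableOn_Ioc_of_le Real.two_pi_pos.le] at hint
  · filter_upwards [hne] with θ hθ using hpos θ hθ

/-- The gap in Jensen's inequality at the origin, equal to `∞` if `p` vanishes there. -/
noncomputable def jensenGap (p : Polynomial ℂ) : ℝ≥0∞ :=
  if p.eval 0 = 0 then ∞ else
    ENNReal.ofReal (Real.log p.mahlerMeasure - Real.log ‖p.eval 0‖)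

theorem logDefect_eval_zero_le (M : ℝ) (p : Polynomial ℂ) :
    logDefect M ‖p.eval 0‖ ≤ logDefect M p.mahlerMeasure + jensenGap p := by
  by_cases h : p.eval 0 = 0
  · simp [jensenGap, h]
  have hp : p ≠ 0 := by rintro rfl; simp at h
  rw [jensenGap, if_neg h, logDefect_of_pos M (norm_pos_iff.2 h),
    logDefect_of_pos M (Polynomial.mahlerMeasure_pos_of_ne_zero hp)]
  refine le_trans (ENNReal.ofReal_le_ofReal (le_of_eq ?_)) ENNReal.ofReal_add_le
  ring

theorem mahlerMeasure_le_of_forall_norm_eval_le (G : Polynomial ℂ) {M : ℝ} (hM : 0 ≤ M)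
    (hG : ∀ ω : ℂ, ‖ω‖ = 1 → ‖G.eval ω‖ ≤ Real.exp M) : G.mahlerMeasure ≤ Real.exp M := by
  by_cases h0 : G = 0
  · simp [h0, (Real.exp_pos M).le]
  rw [← Real.log_le_iff_le_exp (Polynomial.mahlerMeasure_pos_of_ne_zero h0),
    ← G.logMahlerMeasure_eq_log_MahlerMeasure, G.logMahlerMeasure_def]
  refine Real.circleAverage_mono_on_of_le_circle ?_ fun ω hω => ?_
  · exact ((analyticOnNhd_id.aeval_polynomial G).meromorphicOn
      (U := Metric.sphere (0 : ℂ) |1|)).circleIntegrable_log_norm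
  · have hω' : ‖ω‖ = 1 := by simpa using hω
    by_cases hz : G.eval ω = 0
    · simp [hz, hM]
    · exact (Real.log_le_iff_le_exp (norm_pos_iff.2 hz)).2 (hG ω hω')

theorem eval_aeval_polynomial {ι : Type*} (q : MvPolynomial ι ℂ) (l : ι → Polynomial ℂ) (z : ℂ) :
    (MvPolynomial.aeval l q).eval z = MvPolynomial.eval (fun i => (l i).eval z) q := by
  induction q using MvPolynomial.induction_on with
  | C a => simp
  | add p q hp hq => simp [hp, hq]
  | mul_X p i hp => simp [hp]

theorem exists_laurent_polynomial (q : MvPolynomial (Fin 2) ℂ) (c : ℂ) :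
    ∃ (G : Polynomial ℂ) (D : ℕ), ∀ ω : ℂ, ω ≠ 0 →
      G.eval ω = ω ^ D * MvPolynomial.eval ![c * ω, c * ω⁻¹] q := by
  induction q using MvPolynomial.induction_on with
  | C a => exact ⟨Polynomial.C a, 0, by simp⟩
  | add p q hp hq =>
    obtain ⟨G, D, hG⟩ := hp
    obtain ⟨G', D', hG'⟩ := hq
    refine ⟨Polynomial.X ^ D' * G + Polynomial.X ^ D * G', D + D', fun ω hω => ?_⟩
    simp only [Polynomial.eval_add, Polynomial.eval_mul, Polynomial.eval_pow, Polynomial.eval_X,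
      hG ω hω, hG' ω hω, map_add]
    ring
  | mul_X p i hp =>
    obtain ⟨G, D, hG⟩ := hp
    fin_cases i
    · refine ⟨G * (Polynomial.C c * Polynomial.X), D, fun ω hω => ?_⟩
      simp [hG ω hω, mul_assoc]
    · refine ⟨G * Polynomial.C c, D + 1, fun ω hω => ?_⟩
      simp [hG ω hω]
      field_simp
      ring

set_option maxHeartbeats 1000000 in
/-- **Averaged Jensen gap at a zero.** Let `q` vanish at the origin of `ℂ²`. In the isotropic
coordinates `ξ = α + iβ`, `η = α - iβ`, the lines `ξ = ω (1 + i lam z)`, `η = ω⁻¹ (1 - i lam z)`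
have, on average over `|ω| = 1`, Jensen gap at least `log lam`. -/
theorem log_le_circleLIntegral_jensenGap (q : MvPolynomial (Fin 2) ℂ)
    (hq : MvPolynomial.eval (fun _ => (0 : ℂ)) q = 0) {lam : ℝ} (hlam : 1 < lam) :
    ENNReal.ofReal (2 * Real.pi) * ENNReal.ofReal (Real.log lam) ≤
      circleLIntegral (fun ω => jensenGap (MvPolynomial.aeval
        ![Polynomial.C ω * (1 + Polynomial.C (Complex.I * lam) * Polynomial.X),
          Polynomial.C ω⁻¹ * (1 - Polynomial.C (Complex.I * lam) * Polynomial.X)] q)) := by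
  set F : ℂ → ℂ → ℂ := fun ξ η => MvPolynomial.eval ![ξ, η] q with hF
  have hFcont : Continuous (Function.uncurry F) := by
    refine (MvPolynomial.continuous_eval q).comp (continuous_pi fun i => ?_)
    fin_cases i
    · exact continuous_fst
    · exact continuous_snd
  obtain ⟨M, hM0, hM⟩ : ∃ M : ℝ, 0 ≤ M ∧ ∀ ξ η : ℂ, ‖ξ‖ ≤ 1 + lam → ‖η‖ ≤ 1 + lam →
      ‖F ξ η‖ ≤ Real.exp M := by
    obtain ⟨C, hC⟩ := ((isCompact_closedBall (0 : ℂ) (1 + lam)).prod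
      (isCompact_closedBall (0 : ℂ) (1 + lam))).exists_bound_of_continuousOn hFcont.continuousOn
    refine ⟨Real.log (max C 1), Real.log_nonneg (le_max_right _ _), fun ξ η hξ hη => ?_⟩
    rw [Real.exp_log (by positivity)]
    exact (hC (ξ, η) (by simp [hξ, hη])).trans (le_max_left _ _)
  have hFG : ∀ c : ℂ, ∃ (G : Polynomial ℂ) (D : ℕ), ∀ ω : ℂ, ω ≠ 0 →
      G.eval ω = ω ^ D * F (c * ω) (c * ω⁻¹) := exists_laurent_polynomial q
  have hFQ : ∀ ω z : ℂ, (MvPolynomial.aeval ![Polynomial.C ω * Polynomial.X,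
      Polynomial.C ω⁻¹ * Polynomial.X] q).eval z = F (ω * z) (ω⁻¹ * z) := by
    intro ω z
    rw [eval_aeval_polynomial]
    congr 2
    funext i
    fin_cases i <;> simp
  have hFp : ∀ ω z : ℂ, (MvPolynomial.aeval
        ![Polynomial.C ω * (1 + Polynomial.C (Complex.I * lam) * Polynomial.X),
          Polynomial.C ω⁻¹ * (1 - Polynomial.C (Complex.I * lam) * Polynomial.X)] q).eval z =
      F (ω * (1 + Complex.I * lam * z)) (ω⁻¹ * (1 - Complex.I * lam * z)) := by
    intro ω z
    rw [eval_aeval_polynomial]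
    congr 2
    funext i
    fin_cases i <;> simp
  have hF0 : F 0 0 = 0 := by
    have h00 : (![0, 0] : Fin 2 → ℂ) = fun _ => 0 := by
      funext i
      fin_cases i <;> simp
    simp only [hF, h00, hq]
  clear_value F
  have hlam0 : 0 < lam := by linarith
  have hnlam : ‖(lam : ℂ)‖ = lam := by rw [Complex.norm_real, Real.norm_of_nonneg hlam0.le]
  -- a measurable square root of `1 + ζ²`
  obtain ⟨c, hcmeas, hc2⟩ : ∃ c : ℂ → ℂ, Measurable c ∧ ∀ z, c z ^ 2 = 1 + (lam * z) ^ 2 := by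
    refine ⟨fun z => (1 + (lam * z) ^ 2) ^ ((2 : ℕ) : ℂ)⁻¹, ?_, fun z =>
      Complex.cpow_nat_inv_pow _ (by norm_num)⟩
    have : Measurable fun z : ℂ => 1 + ((lam : ℂ) * z) ^ 2 :=
      ((measurable_id.const_mul _).pow_const 2).const_add 1
    exact this.pow_const _
  have hcb : ∀ z : ℂ, ‖z‖ = 1 → ‖c z‖ ≤ 1 + lam := by
    intro z hz
    refine le_of_sq_le_sq ?_ (by linarith)
    rw [← norm_pow, hc2]
    refine (norm_add_le _ _).trans ?_
    rw [norm_pow, norm_mul, hz, hnlam, norm_one]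
    nlinarith
  set L : ℂ → ℂ → ℝ≥0∞ := fun ω z =>
    logDefect M ‖F (ω * (1 + Complex.I * lam * z)) (ω⁻¹ * (1 - Complex.I * lam * z))‖ with hL
  set K : ℂ → ℂ → ℝ≥0∞ := fun ω z => logDefect M ‖F (c z * ω) (c z * ω⁻¹)‖ with hK
  have hLmeas : Measurable (Function.uncurry L) := by
    have hg : Measurable (fun p : ℂ × ℂ => (p.1 * (1 + Complex.I * lam * p.2),
      p.1⁻¹ * (1 - Complex.I * lam * p.2))) := by fun_prop
    exact (measurable_logDefect M).comp (hFcont.measurable.comp hg).norm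
  have hKmeas : Measurable (Function.uncurry K) := by
    have hg : Measurable (fun p : ℂ × ℂ => (c p.2 * p.1, c p.2 * p.1⁻¹)) := by fun_prop
    exact (measurable_logDefect M).comp (hFcont.measurable.comp hg).norm
  have hAb : ∀ z : ℂ, ‖z‖ = 1 → ‖1 + Complex.I * lam * z‖ ≤ 1 + lam := by
    intro z hz
    refine (norm_add_le _ _).trans ?_
    simp [hz, abs_of_pos hlam0]
  have hBb : ∀ z : ℂ, ‖z‖ = 1 → ‖1 - Complex.I * lam * z‖ ≤ 1 + lam := by
    intro z hz
    refine (norm_sub_le _ _).trans ?_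
    simp [hz, abs_of_pos hlam0]
  -- comparison of a point of the line with the diagonal point of the same orbit
  have step1 : ∀ z : ℂ, ‖z‖ = 1 →
      circleLIntegral (fun ω => L ω z) + circleLIntegral (fun ω => L ω (-z)) ≤
        2 * circleLIntegral (fun ω => K ω z) := by
    intro z hz
    obtain ⟨G, D, hG⟩ := hFG (c z)
    have hIz : ‖Complex.I * lam * z‖ = lam := by simp [hz, abs_of_pos hlam0]
    set A : ℂ := 1 + Complex.I * lam * z with hA
    set B : ℂ := 1 - Complex.I * lam * z with hB
    have hA0 : A ≠ 0 := by
      intro h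
      have : Complex.I * lam * z = -1 := by linear_combination h
      rw [this] at hIz
      simp at hIz
      linarith
    have hB0 : B ≠ 0 := by
      intro h
      have : Complex.I * lam * z = 1 := by linear_combination -h
      rw [this] at hIz
      simp at hIz
      linarith
    have hAB : c z ^ 2 = A * B := by
      rw [hc2, hA, hB]
      linear_combination (lam * z) ^ 2 * Complex.I_sq
    have hcz : c z ≠ 0 := by
      intro h
      rw [h] at hAB
      exact mul_ne_zero hA0 hB0 (by rw [← hAB]; simp)
    set κ : ℂ := A / c z with hκ
    have hκ0 : κ ≠ 0 := div_ne_zero hA0 hcz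
    have hcκ : c z * κ = A := by rw [hκ]; field_simp
    have hcκ' : c z * κ⁻¹ = B := by
      rw [hκ]; field_simp; rw [hAB]
    set G₁ : Polynomial ℂ := Polynomial.C (κ⁻¹ ^ D) * G.comp (Polynomial.C κ * Polynomial.X)
    set G₂ : Polynomial ℂ := Polynomial.C (κ ^ D) * G.comp (Polynomial.C κ⁻¹ * Polynomial.X)
    have hn : ∀ ω : ℂ, ‖ω‖ = 1 → ω ≠ 0 := fun ω hω h => by simp [h] at hω
    have e1 : ∀ ω : ℂ, ‖ω‖ = 1 → ‖G₁.eval ω‖ = ‖F (ω * A) (ω⁻¹ * B)‖ := by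
      intro ω hω
      have h0 := hn ω hω
      have : G₁.eval ω = ω ^ D * F (ω * A) (ω⁻¹ * B) := by
        simp only [G₁, Polynomial.eval_mul, Polynomial.eval_C, Polynomial.eval_comp,
          Polynomial.eval_X, hG _ (mul_ne_zero hκ0 h0)]
        rw [← mul_assoc (c z), hcκ, mul_inv, ← mul_assoc (c z), hcκ', mul_comm A, mul_comm B,
          ← mul_assoc, ← mul_pow, inv_mul_cancel_left₀ hκ0]
      rw [this, norm_mul, norm_pow, hω, one_pow, one_mul]
    have e2 : ∀ ω : ℂ, ‖ω‖ = 1 → ‖G₂.eval ω‖ = ‖F (ω * B) (ω⁻¹ * A)‖ := by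
      intro ω hω
      have h0 := hn ω hω
      have : G₂.eval ω = ω ^ D * F (ω * B) (ω⁻¹ * A) := by
        simp only [G₂, Polynomial.eval_mul, Polynomial.eval_C, Polynomial.eval_comp,
          Polynomial.eval_X, hG _ (mul_ne_zero (inv_ne_zero hκ0) h0)]
        rw [← mul_assoc (c z), hcκ', mul_inv, inv_inv, ← mul_assoc (c z), hcκ, mul_comm A,
          mul_comm B, ← mul_assoc, ← mul_pow, mul_inv_cancel_left₀ hκ0]
      rw [this, norm_mul, norm_pow, hω, one_pow, one_mul]
    have e3 : ∀ ω : ℂ, ‖ω‖ = 1 → ‖G.eval ω‖ = ‖F (c z * ω) (c z * ω⁻¹)‖ := by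
      intro ω hω
      rw [hG ω (hn ω hω), norm_mul, norm_pow, hω, one_pow, one_mul]
    have b1 : ∀ ω : ℂ, ‖ω‖ = 1 → ‖G₁.eval ω‖ ≤ Real.exp M := fun ω hω => by
      rw [e1 ω hω]
      exact hM _ _ (by simpa [hω] using hAb z hz) (by simpa [hω] using hBb z hz)
    have b2 : ∀ ω : ℂ, ‖ω‖ = 1 → ‖G₂.eval ω‖ ≤ Real.exp M := fun ω hω => by
      rw [e2 ω hω]
      exact hM _ _ (by simpa [hω] using hBb z hz) (by simpa [hω] using hAb z hz)
    have b3 : ∀ ω : ℂ, ‖ω‖ = 1 → ‖G.eval ω‖ ≤ Real.exp M := fun ω hω => by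
      rw [e3 ω hω]
      exact hM _ _ (by simpa [hω] using hcb z hz) (by simpa [hω] using hcb z hz)
    have i1 : circleLIntegral (fun ω => L ω z) =
        circleLIntegral (fun ω => logDefect M ‖G₁.eval ω‖) :=
      circleLIntegral_congr fun ω hω => by rw [e1 ω hω]
    have i2 : circleLIntegral (fun ω => L ω (-z)) =
        circleLIntegral (fun ω => logDefect M ‖G₂.eval ω‖) :=
      circleLIntegral_congr fun ω hω => by
        rw [e2 ω hω, hL, hA, hB]
        simp only [mul_neg, sub_neg_eq_add, ← sub_eq_add_neg]
    have i3 : circleLIntegral (fun ω => K ω z) =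
        circleLIntegral (fun ω => logDefect M ‖G.eval ω‖) :=
      circleLIntegral_congr fun ω hω => by rw [e3 ω hω]
    have m1 := mahlerMeasure_le_of_forall_norm_eval_le G₁ hM0 b1
    have m2 := mahlerMeasure_le_of_forall_norm_eval_le G₂ hM0 b2
    have m3 := mahlerMeasure_le_of_forall_norm_eval_le G hM0 b3
    rw [i1, i2, i3, circleLIntegral_logDefect_eval M _ b1, circleLIntegral_logDefect_eval M _ b2,
      circleLIntegral_logDefect_eval M _ b3, ← mul_add, mul_left_comm,
      two_mul (logDefect M G.mahlerMeasure),
      logDefect_mul (Polynomial.mahlerMeasure_nonneg _) (Polynomial.mahlerMeasure_nonneg _) m1 m2,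
      logDefect_mul (Polynomial.mahlerMeasure_nonneg _) (Polynomial.mahlerMeasure_nonneg _) m3 m3]
    gcongr
    refine logDefect_anti _ (mul_self_nonneg _) ?_
    rw [← pow_two]
    refine (mahlerMeasure_sq_le_comp_mul_comp_inv G hκ0).trans (le_of_eq ?_)
    simp only [G₁, G₂, Polynomial.mahlerMeasure_mul, Polynomial.mahlerMeasure_const]
    have : ‖κ⁻¹ ^ D‖ * ‖κ ^ D‖ = 1 := by
      rw [← norm_mul, ← mul_pow, inv_mul_cancel₀ hκ0, one_pow, norm_one]
    linear_combination (-((G.comp (Polynomial.C κ * Polynomial.X)).mahlerMeasure *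
      (G.comp (Polynomial.C κ⁻¹ * Polynomial.X)).mahlerMeasure)) * this
  have step2 : ∀ ω : ℂ, ‖ω‖ = 1 →
      circleLIntegral (fun z => K ω z) + circleLIntegral (fun z => K (-ω) z) +
        ENNReal.ofReal (2 * Real.pi) * ENNReal.ofReal (Real.log (lam ^ 2)) ≤
        ENNReal.ofReal (2 * Real.pi) *
          (logDefect M ‖F ω ω⁻¹‖ + logDefect M ‖F (-ω) (-ω)⁻¹‖) := by
    intro ω hω
    set Q := MvPolynomial.aeval ![Polynomial.C ω * Polynomial.X,
      Polynomial.C ω⁻¹ * Polynomial.X] q with hQ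
    obtain ⟨N, hN1, hN2⟩ := exists_mahlerMeasure_norm_polynomial Q (by simp [hQ, hFQ, hF0]) hlam.le
    have hb1 : ∀ z : ℂ, ‖z‖ ≤ 1 + lam → ‖Q.eval z‖ ≤ Real.exp M := fun z hz => by
      rw [hQ, hFQ]; exact hM _ _ (by simpa [hω] using hz) (by simpa [hω] using hz)
    have k1 : ∀ z : ℂ, K ω z = logDefect M ‖Q.eval (c z)‖ := fun z => by
      rw [hQ, hFQ, hK, mul_comm ω, mul_comm ω⁻¹]
    have k2 : ∀ z : ℂ, K (-ω) z = logDefect M ‖Q.eval (-c z)‖ := fun z => by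
      rw [hQ, hFQ, hK, mul_comm ω, mul_comm ω⁻¹]
      simp [inv_neg]
    have k3 : ∀ z : ℂ, ‖z‖ = 1 → K ω z + K (-ω) z = logDefect (M + M) ‖N.eval z‖ := by
      intro z hz
      rw [k1, k2, logDefect_mul (norm_nonneg _) (norm_nonneg _) (hb1 _ (hcb z hz))
        (hb1 _ (by simpa using hcb z hz)), hN1 z (c z) (hc2 z), norm_mul]
    have hNb : ∀ z : ℂ, ‖z‖ = 1 → ‖N.eval z‖ ≤ Real.exp (M + M) := by
      intro z hz
      rw [hN1 z (c z) (hc2 z), norm_mul, Real.exp_add]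
      exact mul_le_mul (hb1 _ (hcb z hz)) (hb1 _ (by simpa using hcb z hz)) (norm_nonneg _)
        (Real.exp_pos M).le
    have hNm := mahlerMeasure_le_of_forall_norm_eval_le N (add_nonneg hM0 hM0) hNb
    have hK1 : Measurable (fun z => K ω z) := hKmeas.comp measurable_prodMk_left
    rw [← circleLIntegral_add hK1, circleLIntegral_congr k3,
      circleLIntegral_logDefect_eval _ _ hNb, ← mul_add]
    refine mul_le_mul_of_nonneg_left ?_ zero_le
    have q1 : F ω ω⁻¹ = Q.eval 1 := by rw [hQ, hFQ]; simp
    have q2 : F (-ω) (-ω)⁻¹ = Q.eval (-1) := by rw [hQ, hFQ]; simp [inv_neg]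
    rw [q1, q2, logDefect_mul (norm_nonneg _) (norm_nonneg _) (hb1 _ (by simp [hlam0.le]))
      (hb1 _ (by simp [hlam0.le])), ← logDefect_const_mul (k := lam ^ 2) (by nlinarith)
      (by positivity) (hN2.trans hNm)]
    gcongr
    exact logDefect_anti _ (by positivity) hN2
  set a := ENNReal.ofReal (2 * Real.pi) with ha
  have ha0 : a ≠ 0 := by simp [ha, Real.pi_pos]
  have hat : a ≠ ∞ := ENNReal.ofReal_ne_top
  set jg : ℂ → ℝ≥0∞ := fun ω => jensenGap (MvPolynomial.aeval
        ![Polynomial.C ω * (1 + Polynomial.C (Complex.I * lam) * Polynomial.X),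
          Polynomial.C ω⁻¹ * (1 - Polynomial.C (Complex.I * lam) * Polynomial.X)] q) with hjg
  have hmulconst : ∀ (b : ℝ≥0∞) (f : ℂ → ℝ≥0∞), b ≠ ∞ →
      circleLIntegral (fun ω => b * f ω) = b * circleLIntegral f :=
    fun b f hb => lintegral_const_mul' b _ hb
  have hDmeas : Measurable (fun ω : ℂ => logDefect M ‖F ω ω⁻¹‖) :=
    (measurable_logDefect M).comp
      (hFcont.measurable.comp (measurable_id.prodMk measurable_inv)).norm
  set N0 := circleLIntegral (fun ω => logDefect M ‖F ω ω⁻¹‖) with hN0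
  set LL := circleLIntegral (fun ω => circleLIntegral (fun z => L ω z)) with hLL
  set KK := circleLIntegral (fun ω => circleLIntegral (fun z => K ω z)) with hKK
  have ineq1 : a * N0 ≤ LL + a * circleLIntegral jg := by
    rw [← hmulconst _ _ hat, ← hmulconst _ _ hat, ← circleLIntegral_add
      (measurable_circleLIntegral hLmeas)]
    refine circleLIntegral_mono fun ω hω => ?_
    obtain ⟨p, hpj, hp⟩ : ∃ p : Polynomial ℂ, jg ω = jensenGap p ∧ ∀ z, p.eval z =
        F (ω * (1 + Complex.I * lam * z)) (ω⁻¹ * (1 - Complex.I * lam * z)) := ⟨_, rfl, hFp ω⟩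
    have hb : ∀ z : ℂ, ‖z‖ = 1 → ‖p.eval z‖ ≤ Real.exp M := fun z hz => by
      rw [hp]
      exact hM _ _ (by simpa [hω] using hAb z hz) (by simpa [hω] using hBb z hz)
    have h1 := logDefect_eval_zero_le M p
    have h2 := circleLIntegral_logDefect_eval M _ hb
    have hp0 : p.eval 0 = F ω ω⁻¹ := by rw [hp]; simp
    have hLp : (fun z => L ω z) = fun z => logDefect M ‖p.eval z‖ := by
      funext z
      rw [hL, hp]
    rw [hp0] at h1
    rw [hLp, h2, hpj, ← mul_add]
    exact mul_le_mul_of_nonneg_left h1 zero_le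
  have ineq2 : LL ≤ KK := by
    have hs1 : LL = circleLIntegral (fun z => circleLIntegral (fun ω => L ω z)) :=
      circleLIntegral_swap hLmeas
    have hs2 : KK = circleLIntegral (fun z => circleLIntegral (fun ω => K ω z)) :=
      circleLIntegral_swap hKmeas
    have hs3 : LL = circleLIntegral (fun z => circleLIntegral (fun ω => L ω (-z))) := by
      rw [hs1]
      exact (circleLIntegral_neg (fun z => circleLIntegral (fun ω => L ω z))).symm
    have hm : Measurable (fun z => circleLIntegral (fun ω => L ω z)) :=
      measurable_circleLIntegral (F := fun z ω => L ω z) (hLmeas.comp measurable_swap)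
    have : 2 * LL ≤ 2 * KK := by
      rw [two_mul]
      nth_rewrite 1 [hs1]
      rw [hs3, hs2, ← circleLIntegral_add hm, ← hmulconst _ _ (by simp)]
      exact circleLIntegral_mono step1
    exact (ENNReal.mul_le_mul_iff_right (by simp) (by simp)).1 this
  have ineq3 : 2 * KK + a * (a * ENNReal.ofReal (Real.log (lam ^ 2))) ≤ 2 * (a * N0) := by
    have hm : Measurable (fun ω => circleLIntegral (fun z => K ω z)) :=
      measurable_circleLIntegral hKmeas
    have hm2 : Measurable (fun ω => circleLIntegral (fun z => K ω z) +
        circleLIntegral (fun z => K (-ω) z)) := hm.add (hm.comp measurable_neg)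
    have hs : KK = circleLIntegral (fun ω => circleLIntegral (fun z => K (-ω) z)) :=
      (circleLIntegral_neg (fun ω => circleLIntegral (fun z => K ω z))).symm
    have hn : N0 = circleLIntegral (fun ω => logDefect M ‖F (-ω) (-ω)⁻¹‖) :=
      (circleLIntegral_neg (fun ω => logDefect M ‖F ω ω⁻¹‖)).symm
    rw [mul_left_comm 2 a, two_mul, two_mul]
    nth_rewrite 2 [hs]
    nth_rewrite 2 [hn]
    rw [hKK, ← circleLIntegral_add hm, ← circleLIntegral_const, ← circleLIntegral_add
      hm2, ← circleLIntegral_add hDmeas, ← hmulconst _ _ hat]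
    exact circleLIntegral_mono step2
  by_cases htop : N0 = ∞
  · obtain ⟨G, D, hG⟩ := hFG 1
    have hn : ∀ ω : ℂ, ‖ω‖ = 1 → ω ≠ 0 := fun ω hω h => by simp [h] at hω
    have e : ∀ ω : ℂ, ‖ω‖ = 1 → ‖G.eval ω‖ = ‖F ω ω⁻¹‖ := fun ω hω => by
      rw [hG ω (hn ω hω), norm_mul, norm_pow, hω, one_pow, one_mul, one_mul, one_mul]
    have hGt : a * logDefect M G.mahlerMeasure = ∞ := by
      rw [← circleLIntegral_logDefect_eval M G fun ω hω => by
        rw [e ω hω]; exact hM _ _ (by simp [hω, hlam0.le]) (by simp [hω, hlam0.le])]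
      rw [← htop, hN0]
      exact circleLIntegral_congr fun ω hω => by rw [e ω hω]
    have hG0 : G = 0 := by
      by_contra h
      rw [logDefect_of_pos M (Polynomial.mahlerMeasure_pos_of_ne_zero h)] at hGt
      exact ENNReal.mul_ne_top hat ENNReal.ofReal_ne_top hGt
    have hj : circleLIntegral jg = ∞ := by
      rw [circleLIntegral_congr (G := fun _ => ∞) fun ω hω => ?_, circleLIntegral_const,
        ENNReal.mul_top ha0]
      have h0 : F ω ω⁻¹ = 0 := by
        rw [← norm_eq_zero, ← e ω hω, hG0]; simp
      rw [hjg]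
      simp only [jensenGap, hFp]
      simp [h0]
    rw [hj]
    exact le_top
  · have hKt : 2 * KK ≠ ∞ := by
      refine ne_top_of_le_ne_top (ENNReal.mul_ne_top (by simp) (ENNReal.mul_ne_top hat htop))
        (le_trans le_self_add ineq3)
    have h1 : 2 * KK + a * (a * ENNReal.ofReal (Real.log (lam ^ 2))) ≤
        2 * KK + a * (2 * circleLIntegral jg) := by
      refine ineq3.trans ?_
      calc 2 * (a * N0) ≤ 2 * (KK + a * circleLIntegral jg) := by
            gcongr; exact ineq1.trans (by gcongr)
        _ = _ := by ring
    have h2 := (ENNReal.mul_le_mul_iff_right ha0 hat).1 ((ENNReal.add_le_add_iff_left hKt).1 h1)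
    rw [Real.log_pow, ENNReal.ofReal_mul (by positivity), mul_left_comm] at h2
    have h3 : ENNReal.ofReal ((2 : ℕ) : ℝ) = 2 := by simp
    rw [h3] at h2
    exact (ENNReal.mul_le_mul_iff_right (by simp) (by simp)).1 h2

/-- The restriction of a real polynomial to the complex line `z ↦ y + z b`. -/
noncomputable def linePolynomial {m : ℕ} (P : MvPolynomial (Fin m) ℝ)
    (y b : EuclideanSpace ℝ (Fin m)) : Polynomial ℂ :=
  MvPolynomial.aeval
    (fun i => Polynomial.C (y i : ℂ) + Polynomial.C (b i : ℂ) * Polynomial.X) P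

theorem eval_linePolynomial {m : ℕ} (P : MvPolynomial (Fin m) ℝ)
    (y b : EuclideanSpace ℝ (Fin m)) (z : ℂ) :
    (linePolynomial P y b).eval z = MvPolynomial.aeval (fun i => (y i : ℂ) + b i * z) P := by
  have := MvPolynomial.comp_aeval_apply (R := ℝ)
    (f := fun i => Polynomial.C (y i : ℂ) + Polynomial.C (b i : ℂ) * Polynomial.X)
    ((Polynomial.aeval z : Polynomial ℂ →ₐ[ℂ] ℂ).restrictScalars ℝ) P
  rw [linePolynomial]
  simpa [Polynomial.aeval_def, Polynomial.eval₂_eq_eval_map] using this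

theorem eval_linePolynomial_ofReal {m : ℕ} (P : MvPolynomial (Fin m) ℝ)
    (y b : EuclideanSpace ℝ (Fin m)) (t : ℝ) :
    (linePolynomial P y b).eval (t : ℂ) =
      (MvPolynomial.eval (fun i => (y + t • b) i) P : ℝ) := by
  rw [eval_linePolynomial]
  have := MvPolynomial.comp_aeval_apply (R := ℝ) (f := fun i => (y + t • b) i)
    Complex.ofRealAm P
  rw [MvPolynomial.aeval_eq_eval] at this
  simp only [Complex.ofRealAm_coe] at this
  rw [this]
  congr 2
  funext i
  simp [mul_comm]

theorem natDegree_linePolynomial_le {m : ℕ} (P : MvPolynomial (Fin m) ℝ)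
    (y b : EuclideanSpace ℝ (Fin m)) : (linePolynomial P y b).natDegree ≤ P.totalDegree := by
  rw [linePolynomial, MvPolynomial.aeval_def, MvPolynomial.eval₂_eq']
  refine Polynomial.natDegree_sum_le_of_forall_le _ _ fun s hs => ?_
  refine Polynomial.natDegree_mul_le.trans ?_
  have h1 : (algebraMap ℝ (Polynomial ℂ) (P.coeff s)).natDegree = 0 := by
    rw [Polynomial.algebraMap_apply]
    exact Polynomial.natDegree_C _
  rw [h1, zero_add]
  refine (Polynomial.natDegree_prod_le _ _).trans ?_
  refine le_trans (Finset.sum_le_sum (g := s) fun i _ => ?_) ?_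
  · refine Polynomial.natDegree_pow_le.trans ?_
    have : (Polynomial.C (y i : ℂ) + Polynomial.C (b i : ℂ) * Polynomial.X).natDegree ≤ 1 := by
      compute_degree
    nlinarith
  · have := MvPolynomial.le_totalDegree hs
    rwa [Finsupp.sum_fintype _ _ (by simp)] at this

/-- The Jensen gap of `P` along the complex line through `y` in the direction `b`. -/
noncomputable def lineGap {m : ℕ} (P : MvPolynomial (Fin m) ℝ)
    (y b : EuclideanSpace ℝ (Fin m)) : ℝ≥0∞ :=
  jensenGap (linePolynomial P y b)

theorem continuous_eval_linePolynomial {m : ℕ} (P : MvPolynomial (Fin m) ℝ) :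
    Continuous (fun q : (EuclideanSpace ℝ (Fin m) × EuclideanSpace ℝ (Fin m)) × ℂ =>
      (linePolynomial P q.1.1 q.1.2).eval q.2) := by
  simp only [eval_linePolynomial]
  have h : ∀ v : Fin m → ℂ, MvPolynomial.aeval v P =
      MvPolynomial.eval v (MvPolynomial.map (algebraMap ℝ ℂ) P) := fun v => by
    rw [MvPolynomial.eval_map, MvPolynomial.aeval_def]
  simp only [h]
  refine (MvPolynomial.continuous_eval _).comp (continuous_pi fun i => ?_)
  fun_prop

theorem measurable_lineGap {m : ℕ} (P : MvPolynomial (Fin m) ℝ) :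
    Measurable (fun q : EuclideanSpace ℝ (Fin m) × EuclideanSpace ℝ (Fin m) =>
      lineGap P q.1 q.2) := by
  have hc := continuous_eval_linePolynomial P
  have h0 : Measurable (fun q : EuclideanSpace ℝ (Fin m) × EuclideanSpace ℝ (Fin m) =>
      (linePolynomial P q.1 q.2).eval 0) :=
    (hc.comp (continuous_id.prodMk continuous_const)).measurable
  have h1 : Measurable (fun q : EuclideanSpace ℝ (Fin m) × EuclideanSpace ℝ (Fin m) =>
      (linePolynomial P q.1 q.2).logMahlerMeasure) := by
    simp only [Polynomial.logMahlerMeasure, Real.circleAverage, intervalIntegral.integral_of_le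
      Real.two_pi_pos.le, smul_eq_mul]
    refine Measurable.const_mul ?_ _
    refine StronglyMeasurable.measurable ?_
    refine StronglyMeasurable.integral_prod_right' (f := fun r :
      (EuclideanSpace ℝ (Fin m) × EuclideanSpace ℝ (Fin m)) × ℝ =>
        Real.log ‖(linePolynomial P r.1.1 r.1.2).eval (circleMap 0 1 r.2)‖) ?_
    refine Measurable.stronglyMeasurable (Real.measurable_log.comp ?_)
    exact (hc.comp (continuous_fst.prodMk
      ((continuous_circleMap 0 1).comp continuous_snd))).norm.measurable
  have h2 : Measurable (fun q : EuclideanSpace ℝ (Fin m) × EuclideanSpace ℝ (Fin m) =>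
      if (linePolynomial P q.1 q.2).eval 0 = 0 then ∞ else
        ENNReal.ofReal ((linePolynomial P q.1 q.2).logMahlerMeasure -
          Real.log ‖(linePolynomial P q.1 q.2).eval 0‖)) :=
    Measurable.ite (measurableSet_eq_fun h0 measurable_const) measurable_const
      (ENNReal.measurable_ofReal.comp (h1.sub (Real.measurable_log.comp h0.norm)))
  convert h2 using 2 with q
  rw [lineGap, jensenGap]
  split_ifs with h
  · rfl
  · rw [Polynomial.logMahlerMeasure_eq_log_MahlerMeasure]

/-- The rotation by the angle `φ` mixing the two factors of `E × E`. -/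
noncomputable def mixing {E : Type*} [AddCommGroup E] [Module ℝ E] (φ : ℝ) : E × E →ₗ[ℝ] E × E :=
  (Real.cos φ • LinearMap.fst ℝ E E + Real.sin φ • LinearMap.snd ℝ E E).prod
    (-Real.sin φ • LinearMap.fst ℝ E E + Real.cos φ • LinearMap.snd ℝ E E)

theorem mixing_apply {E : Type*} [AddCommGroup E] [Module ℝ E] (φ : ℝ) (p : E × E) :
    mixing φ p = (Real.cos φ • p.1 + Real.sin φ • p.2, -Real.sin φ • p.1 + Real.cos φ • p.2) := rfl

theorem abs_det_mixing {E : Type*} [AddCommGroup E] [Module ℝ E] (φ : ℝ) :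
    |LinearMap.det (mixing φ : E × E →ₗ[ℝ] E × E)| = 1 := by
  set S : E × E →ₗ[ℝ] E × E := (LinearMap.snd ℝ E E).prod (LinearMap.fst ℝ E E) with hS
  have hSS : S * S = 1 := by
    ext p <;> simp [hS]
  have h1 : mixing φ * (S * mixing φ * S) = (1 : E × E →ₗ[ℝ] E × E) := by
    have hcs := Real.cos_sq_add_sin_sq φ
    apply LinearMap.ext
    rintro ⟨u, v⟩
    simp only [hS, Module.End.mul_apply, mixing_apply, LinearMap.prod_apply, Function.prod,
      LinearMap.fst_apply, LinearMap.snd_apply, Module.End.one_apply, Prod.mk.injEq]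
    constructor
    · have : u = (Real.cos φ ^ 2 + Real.sin φ ^ 2) • u := by rw [hcs, one_smul]
      conv_rhs => rw [this]
      module
    · have : v = (Real.cos φ ^ 2 + Real.sin φ ^ 2) • v := by rw [hcs, one_smul]
      conv_rhs => rw [this]
      module
  have h2 := congrArg LinearMap.det h1
  have h3 := congrArg LinearMap.det hSS
  simp only [map_mul, map_one] at h2 h3
  have h4 : LinearMap.det (mixing φ : E × E →ₗ[ℝ] E × E) ^ 2 = 1 := by
    linear_combination h2 - (LinearMap.det (mixing φ : E × E →ₗ[ℝ] E × E)) ^ 2 * h3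
  rw [← abs_one, ← sq_eq_sq_iff_abs_eq_abs, h4, one_pow]

theorem measurePreserving_mixing {E : Type*} [NormedAddCommGroup E] [NormedSpace ℝ E]
    [MeasurableSpace E] [BorelSpace E] [FiniteDimensional ℝ E] (μ : Measure E)
    [μ.IsAddHaarMeasure] (φ : ℝ) :
    MeasurePreserving (mixing φ : E × E →ₗ[ℝ] E × E) (μ.prod μ) (μ.prod μ) := by
  have hd := abs_det_mixing (E := E) φ
  have hd0 : LinearMap.det (mixing φ : E × E →ₗ[ℝ] E × E) ≠ 0 := by
    intro h
    simp [h] at hd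
  have : ProperSpace E := FiniteDimensional.proper_real E
  refine ⟨(LinearMap.continuous_of_finiteDimensional _).measurable, ?_⟩
  rw [Measure.map_linearMap_addHaar_eq_smul_addHaar _ hd0, abs_inv, hd]
  simp

theorem lintegral_mul_mixing {E : Type*} [NormedAddCommGroup E] [NormedSpace ℝ E]
    [MeasurableSpace E] [BorelSpace E] [FiniteDimensional ℝ E] (μ : Measure E)
    [μ.IsAddHaarMeasure] (φ : ℝ) {W G : E × E → ℝ≥0∞} (hW : Measurable W) (hG : Measurable G)
    (hWφ : ∀ p, W (mixing φ p) = W p) :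
    ∫⁻ p, W p * G (mixing φ p) ∂(μ.prod μ) = ∫⁻ p, W p * G p ∂(μ.prod μ) := by
  have h := (measurePreserving_mixing μ φ).lintegral_comp (hW.mul hG)
  simp only [Pi.mul_apply, hWφ] at h
  exact h

/-- The average Jensen gap along the rotated lines through a zero of `P`. -/
theorem log_le_lintegral_lineGap_mixing {m : ℕ} (P : MvPolynomial (Fin m) ℝ)
    {x : EuclideanSpace ℝ (Fin m)} (hx : MvPolynomial.eval (fun i => x i) P = 0)
    {lam : ℝ} (hlam : 1 < lam) (p : EuclideanSpace ℝ (Fin m) × EuclideanSpace ℝ (Fin m)) :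
    ENNReal.ofReal (2 * Real.pi) * ENNReal.ofReal (Real.log lam) ≤
      ∫⁻ φ in Set.Ioc 0 (2 * Real.pi),
        lineGap P (x + (mixing φ p).1) (lam • (mixing φ p).2) := by
  set q : MvPolynomial (Fin 2) ℂ := MvPolynomial.aeval (fun i =>
    MvPolynomial.C (x i : ℂ) + MvPolynomial.C (((p.1 i : ℂ) - Complex.I * p.2 i) / 2) *
      MvPolynomial.X 0 + MvPolynomial.C (((p.1 i : ℂ) + Complex.I * p.2 i) / 2) *
      MvPolynomial.X 1) P with hq
  have hq0 : MvPolynomial.eval (fun _ => (0 : ℂ)) q = 0 := by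
    have h1 := MvPolynomial.comp_aeval_apply (R := ℝ) (f := fun i =>
        MvPolynomial.C (x i : ℂ) + MvPolynomial.C (((p.1 i : ℂ) - Complex.I * p.2 i) / 2) *
        MvPolynomial.X (0 : Fin 2) + MvPolynomial.C (((p.1 i : ℂ) + Complex.I * p.2 i) / 2) *
        MvPolynomial.X 1)
      ((MvPolynomial.aeval (fun _ => (0 : ℂ)) : MvPolynomial (Fin 2) ℂ →ₐ[ℂ] ℂ).restrictScalars ℝ)
      P
    have h2 := eval_linePolynomial_ofReal P x 0 0
    rw [eval_linePolynomial] at h2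
    simp only [AlgHom.restrictScalars_apply, MvPolynomial.aeval_eq_eval] at h1
    rw [hq, h1]
    simpa [hx] using h2
  have h := log_le_circleLIntegral_jensenGap q hq0 hlam
  refine h.trans (le_of_eq (lintegral_congr fun φ => ?_))
  rw [lineGap]
  refine congrArg jensenGap ?_
  set ω := circleMap 0 1 φ with hω
  have hω1 : ω = Complex.cos φ + Complex.sin φ * Complex.I := by
    rw [hω, circleMap]; simp [Complex.exp_mul_I]
  have hω2 : ω⁻¹ = Complex.cos φ - Complex.sin φ * Complex.I := by
    rw [hω, circleMap]
    simp only [Complex.ofReal_one, one_mul, zero_add]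
    rw [← Complex.exp_neg, ← neg_mul, Complex.exp_mul_I, Complex.cos_neg, Complex.sin_neg]
    ring
  have h1 := MvPolynomial.comp_aeval_apply (R := ℝ) (f := fun i =>
        MvPolynomial.C (x i : ℂ) + MvPolynomial.C (((p.1 i : ℂ) - Complex.I * p.2 i) / 2) *
        MvPolynomial.X (0 : Fin 2) + MvPolynomial.C (((p.1 i : ℂ) + Complex.I * p.2 i) / 2) *
        MvPolynomial.X 1)
      ((MvPolynomial.aeval ![Polynomial.C ω * (1 + Polynomial.C (Complex.I * lam) * Polynomial.X),
        Polynomial.C ω⁻¹ * (1 - Polynomial.C (Complex.I * lam) * Polynomial.X)] :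
        MvPolynomial (Fin 2) ℂ →ₐ[ℂ] Polynomial ℂ).restrictScalars ℝ) P
  rw [AlgHom.restrictScalars_apply] at h1
  rw [hq, h1, linePolynomial]
  congr 2
  funext i
  apply Polynomial.funext
  intro z
  simp only [AlgHom.restrictScalars_apply, map_add, map_mul, MvPolynomial.aeval_C,
    MvPolynomial.aeval_X, Polynomial.algebraMap_apply, Algebra.algebraMap_self_apply,
    Matrix.cons_val_zero, Matrix.cons_val_one, Polynomial.eval_add, Polynomial.eval_mul,
    Polynomial.eval_sub, Polynomial.eval_C, Polynomial.eval_X, Polynomial.eval_one,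
    mixing_apply, PiLp.add_apply, PiLp.smul_apply, smul_eq_mul, Complex.ofReal_add,
    Complex.ofReal_mul, Complex.ofReal_neg, Complex.ofReal_cos, Complex.ofReal_sin, hω2]
  rw [hω1]
  ring_nf
  simp only [Complex.I_sq]
  ring

/-- A lower bound for the rotation averages of `G` is a lower bound for its average against a
weight invariant under rotations. -/
theorem const_mul_lintegral_le_lintegral_of_mixing {E : Type*} [NormedAddCommGroup E]
    [NormedSpace ℝ E] [MeasurableSpace E] [BorelSpace E] [FiniteDimensional ℝ E] (μ : Measure E)
    [μ.IsAddHaarMeasure] {W G : E × E → ℝ≥0∞} (hW : Measurable W) (hG : Measurable G)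
    (hWφ : ∀ φ p, W (mixing φ p) = W p) {c : ℝ≥0∞}
    (hc : ∀ p, ENNReal.ofReal (2 * Real.pi) * c ≤
      ∫⁻ φ in Set.Ioc 0 (2 * Real.pi), G (mixing φ p)) :
    c * ∫⁻ p, W p ∂(μ.prod μ) ≤ ∫⁻ p, W p * G p ∂(μ.prod μ) := by
  have : ProperSpace E := FiniteDimensional.proper_real E
  have hmix : Continuous (fun r : (E × E) × ℝ => mixing r.2 r.1) := by
    simp only [mixing_apply]
    fun_prop
  have hGm : Measurable (fun r : (E × E) × ℝ => W r.1 * G (mixing r.2 r.1)) :=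
    (hW.comp measurable_fst).mul (hG.comp hmix.measurable)
  have hGm' : ∀ p : E × E, Measurable (fun φ : ℝ => G (mixing φ p)) := fun p =>
    hG.comp (hmix.comp (continuous_const.prodMk continuous_id)).measurable
  have hav : ENNReal.ofReal (2 * Real.pi) * ∫⁻ p, W p * G p ∂(μ.prod μ) =
      ∫⁻ p, W p * (∫⁻ φ in Set.Ioc 0 (2 * Real.pi), G (mixing φ p)) ∂(μ.prod μ) := by
    calc _ = ∫⁻ φ in Set.Ioc 0 (2 * Real.pi), (∫⁻ p, W p * G (mixing φ p) ∂(μ.prod μ)) := by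
          rw [lintegral_congr fun φ => lintegral_mul_mixing μ φ hW hG (hWφ φ),
            setLIntegral_const, Real.volume_Ioc, sub_zero, mul_comm]
      _ = ∫⁻ p, (∫⁻ φ in Set.Ioc 0 (2 * Real.pi), W p * G (mixing φ p)) ∂(μ.prod μ) :=
          lintegral_lintegral_swap (hGm.comp measurable_swap).aemeasurable
      _ = _ := lintegral_congr fun p => lintegral_const_mul _ (hGm' p)
  have h2 : ENNReal.ofReal (2 * Real.pi) * (c * ∫⁻ p, W p ∂(μ.prod μ)) ≤
      ENNReal.ofReal (2 * Real.pi) * ∫⁻ p, W p * G p ∂(μ.prod μ) := by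
    rw [hav, ← mul_assoc, ← lintegral_const_mul _ hW]
    refine lintegral_mono fun p => ?_
    rw [mul_comm]
    exact mul_le_mul_of_nonneg_left (hc p) zero_le
  have h0 : ENNReal.ofReal (2 * Real.pi) ≠ 0 := by simp [Real.pi_pos]
  exact (ENNReal.mul_le_mul_iff_right h0 ENNReal.ofReal_ne_top).1 h2

/-- **Averaged Jensen gap at a zero of `P`.** -/
theorem log_mul_lintegral_le_lintegral_lineGap {m : ℕ} (P : MvPolynomial (Fin m) ℝ)
    {x : EuclideanSpace ℝ (Fin m)} (hx : MvPolynomial.eval (fun i => x i) P = 0)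
    {lam : ℝ} (hlam : 1 < lam)
    {W : EuclideanSpace ℝ (Fin m) × EuclideanSpace ℝ (Fin m) → ℝ≥0∞} (hW : Measurable W)
    (hWφ : ∀ φ p, W (mixing φ p) = W p) :
    ENNReal.ofReal (Real.log lam) * ∫⁻ p, W p ≤ ∫⁻ p, W p * lineGap P (x + p.1) (lam • p.2) := by
  have hshift : Continuous (fun p : EuclideanSpace ℝ (Fin m) × EuclideanSpace ℝ (Fin m) =>
      (x + p.1, lam • p.2)) := by fun_prop
  exact const_mul_lintegral_le_lintegral_of_mixing volume hW
    ((measurable_lineGap P).comp hshift.measurable) hWφ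
    (log_le_lintegral_lineGap_mixing P hx hlam)

theorem lintegral_ofReal_log_sub_log_abs_le {lam : ℝ} (hlam : 0 < lam) (x : ℝ) :
    ∫⁻ t : ℝ, ENNReal.ofReal (Real.log lam - Real.log |t - x|) ≤ ENNReal.ofReal (2 * lam) := by
  rw [lintegral_sub_right_eq_self (fun t => ENNReal.ofReal (Real.log lam - Real.log |t|)) x]
  simp only [Real.log_abs]
  have hint : IntervalIntegrable (fun t => Real.log lam - Real.log t) volume (-lam) lam :=
    intervalIntegrable_const.sub intervalIntegral.intervalIntegrable_log'
  have hle : -lam ≤ lam := by linarith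
  have hint' := (intervalIntegrable_iff_integrableOn_Ioc_of_le hle).1 hint
  have hval : ∫ t in (-lam)..lam, (Real.log lam - Real.log t) = 2 * lam := by
    rw [intervalIntegral.integral_sub intervalIntegrable_const
      intervalIntegral.intervalIntegrable_log', integral_log, intervalIntegral.integral_const,
      Real.log_neg_eq_log, smul_eq_mul]
    ring
  have hnn : ∀ t ∈ Set.Ioc (-lam) lam, t ≠ 0 → 0 ≤ Real.log lam - Real.log t := by
    intro t ht h0
    rw [← Real.log_abs t, sub_nonneg]
    exact Real.log_le_log (abs_pos.2 h0) (abs_le.2 ⟨ht.1.le, ht.2⟩)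
  have hae : 0 ≤ᵐ[volume.restrict (Set.Ioc (-lam) lam)] fun t => Real.log lam - Real.log t := by
    have h0 : ∀ᵐ t : ℝ, t ≠ 0 := by simp [ae_iff]
    filter_upwards [ae_restrict_mem measurableSet_Ioc, ae_restrict_of_ae h0] with t ht h0
    exact hnn t ht h0
  rw [← hval, intervalIntegral.integral_of_le hle, ofReal_integral_eq_lintegral_ofReal hint' hae,
    ← lintegral_indicator measurableSet_Ioc]
  refine lintegral_mono fun t => ?_
  by_cases ht : t ∈ Set.Ioc (-lam) lam
  · simp only [Set.indicator_of_mem ht, le_refl]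
  · rw [Set.indicator_of_notMem ht, nonpos_iff_eq_zero, ENNReal.ofReal_eq_zero, sub_nonpos,
      ← Real.log_abs t]
    refine Real.log_le_log hlam ?_
    by_contra h
    exact ht ⟨(abs_lt.1 (not_le.1 h)).1, (abs_lt.1 (not_le.1 h)).2.le⟩

theorem jensenGap_C {a : ℂ} (ha : a ≠ 0) : jensenGap (Polynomial.C a) = 0 := by
  simp [jensenGap, ha]

theorem jensenGap_mul_le {p q : Polynomial ℂ} (hp : p ≠ 0) (hq : q ≠ 0) :
    jensenGap (p * q) ≤ jensenGap p + jensenGap q := by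
  by_cases hp0 : p.eval 0 = 0
  · simp [jensenGap, hp0]
  by_cases hq0 : q.eval 0 = 0
  · simp [jensenGap, hq0]
  have hp' := Polynomial.mahlerMeasure_pos_of_ne_zero hp
  have hq' := Polynomial.mahlerMeasure_pos_of_ne_zero hq
  simp only [jensenGap, Polynomial.eval_mul, mul_eq_zero, hp0, hq0, or_self, if_false,
    Polynomial.mahlerMeasure_mul, norm_mul]
  rw [Real.log_mul hp'.ne' hq'.ne', Real.log_mul (norm_ne_zero_iff.2 hp0) (norm_ne_zero_iff.2 hq0)]
  refine le_trans (ENNReal.ofReal_le_ofReal (le_of_eq ?_)) ENNReal.ofReal_add_le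
  ring

theorem jensenGap_linear_le {lam : ℝ} (hlam : 0 < lam) (c : ℂ) {t : ℝ} (ht : t ≠ c.re) :
    jensenGap ((Polynomial.X - Polynomial.C c).comp
      (Polynomial.C (t : ℂ) + Polynomial.C (lam : ℂ) * Polynomial.X)) ≤
      ENNReal.ofReal (Real.log lam - Real.log |t - c.re|) := by
  have h1 : (Polynomial.X - Polynomial.C c).comp
      (Polynomial.C (t : ℂ) + Polynomial.C (lam : ℂ) * Polynomial.X) =
      Polynomial.C (lam : ℂ) * Polynomial.X + Polynomial.C ((t : ℂ) - c) := by
    simp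
    ring
  have hpos : 0 < |t - c.re| := abs_pos.2 (sub_ne_zero.2 ht)
  have hle : |t - c.re| ≤ ‖(t : ℂ) - c‖ := by simpa using Complex.abs_re_le_norm ((t : ℂ) - c)
  have hv : 0 < ‖(t : ℂ) - c‖ := hpos.trans_le hle
  have hl : (lam : ℂ) ≠ 0 := by exact_mod_cast hlam.ne'
  rw [h1, jensenGap, Polynomial.mahlerMeasure_C_mul_X_add_C hl]
  simp only [Polynomial.eval_add, Polynomial.eval_mul, Polynomial.eval_C, Polynomial.eval_X,
    mul_zero, zero_add]
  rw [if_neg (norm_pos_iff.1 hv), Complex.norm_real, Real.norm_of_nonneg hlam.le]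
  rcases le_total lam ‖(t : ℂ) - c‖ with h | h
  · simp [max_eq_right h]
  · rw [max_eq_left h]
    exact ENNReal.ofReal_le_ofReal (sub_le_sub_left (Real.log_le_log hpos hle) _)

theorem lintegral_jensenGap_comp_le {R : Polynomial ℂ} (hR : R ≠ 0) {lam : ℝ} (hlam : 0 < lam) :
    ∫⁻ t : ℝ, jensenGap (R.comp (Polynomial.C (t : ℂ) + Polynomial.C (lam : ℂ) * Polynomial.X)) ≤
      R.natDegree * ENNReal.ofReal (2 * lam) := by
  have hcomp : ∀ {Q : Polynomial ℂ}, Q ≠ 0 → ∀ t : ℝ,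
      Q.comp (Polynomial.C (t : ℂ) + Polynomial.C (lam : ℂ) * Polynomial.X) ≠ 0 := by
    intro Q hQ t h
    have hl : (lam : ℂ) ≠ 0 := by exact_mod_cast hlam.ne'
    rcases Polynomial.comp_eq_zero_iff.1 h with h | ⟨-, h⟩
    · exact hQ h
    · have := congrArg (fun p => Polynomial.coeff p 1) h
      simp at this
      exact hlam.ne' this
  have key : ∀ s : Multiset ℂ, ∫⁻ t : ℝ, jensenGap ((Polynomial.C R.leadingCoeff *
      (s.map (fun x => Polynomial.X - Polynomial.C x)).prod).comp
        (Polynomial.C (t : ℂ) + Polynomial.C (lam : ℂ) * Polynomial.X)) ≤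
      s.card * ENNReal.ofReal (2 * lam) := by
    intro s
    have ha : R.leadingCoeff ≠ 0 := Polynomial.leadingCoeff_ne_zero.2 hR
    induction s using Multiset.induction_on with
    | empty => simp [jensenGap_C ha]
    | cons c s ih =>
      have hQ : Polynomial.C R.leadingCoeff *
          (s.map (fun x => Polynomial.X - Polynomial.C x)).prod ≠ 0 := by
        refine mul_ne_zero (Polynomial.C_ne_zero.2 ha) ?_
        exact (Polynomial.monic_multiset_prod_of_monic _ _
          fun x _ => Polynomial.monic_X_sub_C x).ne_zero
      have hc : ∀ᵐ t : ℝ, t ≠ c.re := by simp [ae_iff]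
      have hm : Measurable fun t : ℝ =>
          ENNReal.ofReal (Real.log lam - Real.log |t - c.re|) := by fun_prop
      refine le_trans (lintegral_mono_ae (g := fun t : ℝ =>
        ENNReal.ofReal (Real.log lam - Real.log |t - c.re|) +
          jensenGap ((Polynomial.C R.leadingCoeff *
            (s.map (fun x => Polynomial.X - Polynomial.C x)).prod).comp
            (Polynomial.C (t : ℂ) + Polynomial.C (lam : ℂ) * Polynomial.X))) ?_) ?_
      · filter_upwards [hc] with t ht
        rw [Multiset.map_cons, Multiset.prod_cons, mul_left_comm, Polynomial.mul_comp]
        exact (jensenGap_mul_le (hcomp (Polynomial.X_sub_C_ne_zero c) t) (hcomp hQ t)).trans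
          (add_le_add_left (jensenGap_linear_le hlam c ht) _)
      · rw [lintegral_add_left hm, Multiset.card_cons, Nat.cast_add, add_mul, add_comm,
          Nat.cast_one, one_mul]
        exact add_le_add ih (lintegral_ofReal_log_sub_log_abs_le hlam c.re)
  have h := key R.roots
  rw [← (IsAlgClosed.splits R).eq_prod_roots] at h
  refine h.trans ?_
  gcongr
  exact R.card_roots'

theorem two_mul_le_lintegral_abs_deriv {w : ℝ → ℝ} {K : NNReal} (hw : LipschitzWith K w)
    (hc : HasCompactSupport w) (t : ℝ) :
    2 * ENNReal.ofReal (w t) ≤ ∫⁻ s, ENNReal.ofReal |deriv w s| := by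
  obtain ⟨r, hr⟩ := hc.isCompact.isBounded.subset_closedBall t
  set ρ : ℝ := max r 0 + 1 with hρ
  have hρ0 : 0 < ρ := by positivity
  have hz : ∀ s, |s - t| = ρ → w s = 0 := by
    intro s hs
    by_contra h
    have := hr (subset_tsupport w h)
    rw [Metric.mem_closedBall, Real.dist_eq, hs] at this
    linarith [le_max_left r 0]
  have ha := hz (t - ρ) (by simp [abs_of_pos hρ0])
  have hb := hz (t + ρ) (by simp [abs_of_pos hρ0])
  have hac : ∀ a b, AbsolutelyContinuousOnInterval w a b := fun a b =>
    (hw.lipschitzOnWith (s := Set.uIcc a b)).absolutelyContinuousOnInterval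
  have h1 := (hac (t - ρ) t).integral_deriv_eq_sub
  have h2 := (hac t (t + ρ)).integral_deriv_eq_sub
  have i1 := (hac (t - ρ) t).intervalIntegrable_deriv
  have i2 := (hac t (t + ρ)).intervalIntegrable_deriv
  have h3 : 2 * w t ≤ ∫ s in (t - ρ)..(t + ρ), |deriv w s| := by
    rw [← intervalIntegral.integral_add_adjacent_intervals i1.abs i2.abs]
    have e1 := intervalIntegral.abs_integral_le_integral_abs (f := deriv w) (μ := volume)
      (show t - ρ ≤ t by linarith)
    have e2 := intervalIntegral.abs_integral_le_integral_abs (f := deriv w) (μ := volume)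
      (show t ≤ t + ρ by linarith)
    rw [h1, ha] at e1
    rw [h2, hb] at e2
    linarith [le_abs_self (w t - 0), neg_abs_le (0 - w t)]
  have hle : t - ρ ≤ t + ρ := by linarith
  have h4 := (intervalIntegrable_iff_integrableOn_Ioc_of_le hle).1 (i1.trans i2).abs
  calc 2 * ENNReal.ofReal (w t) = ENNReal.ofReal (2 * w t) := by
        rw [ENNReal.ofReal_mul (by norm_num)]; simp
    _ ≤ ENNReal.ofReal (∫ s in (t - ρ)..(t + ρ), |deriv w s|) := ENNReal.ofReal_le_ofReal h3
    _ = ∫⁻ s in Set.Ioc (t - ρ) (t + ρ), ENNReal.ofReal |deriv w s| := by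
        rw [intervalIntegral.integral_of_le hle,
          ofReal_integral_eq_lintegral_ofReal h4 (ae_of_all _ fun s => abs_nonneg _)]
    _ ≤ _ := setLIntegral_le_lintegral _ _

theorem lintegral_mul_jensenGap_comp_le {w : ℝ → ℝ} {K : NNReal} (hw : LipschitzWith K w)
    (hc : HasCompactSupport w) {R : Polynomial ℂ} (hR : R ≠ 0) {lam : ℝ} (hlam : 0 < lam) :
    ∫⁻ t : ℝ, ENNReal.ofReal (w t) *
        jensenGap (R.comp (Polynomial.C (t : ℂ) + Polynomial.C (lam : ℂ) * Polynomial.X)) ≤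
      R.natDegree * ENNReal.ofReal lam * ∫⁻ s, ENNReal.ofReal |deriv w s| := by
  obtain ⟨t₀, ht₀⟩ := hw.continuous.exists_forall_ge_of_hasCompactSupport hc
  have h2 := two_mul_le_lintegral_abs_deriv hw hc t₀
  refine (ENNReal.mul_le_mul_iff_right (a := 2) (by simp) (by simp)).1 ?_
  calc _ ≤ 2 * ∫⁻ t : ℝ, ENNReal.ofReal (w t₀) *
        jensenGap (R.comp (Polynomial.C (t : ℂ) + Polynomial.C (lam : ℂ) * Polynomial.X)) := by
        refine mul_le_mul_of_nonneg_left (lintegral_mono fun t => ?_) zero_le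
        exact mul_le_mul_of_nonneg_right (ENNReal.ofReal_le_ofReal (ht₀ t)) zero_le
    _ = 2 * ENNReal.ofReal (w t₀) * ∫⁻ t : ℝ,
        jensenGap (R.comp (Polynomial.C (t : ℂ) + Polynomial.C (lam : ℂ) * Polynomial.X)) := by
        rw [lintegral_const_mul' _ _ ENNReal.ofReal_ne_top, mul_assoc]
    _ ≤ (∫⁻ s, ENNReal.ofReal |deriv w s|) * (R.natDegree * ENNReal.ofReal (2 * lam)) :=
        mul_le_mul' h2 (lintegral_jensenGap_comp_le hR hlam)
    _ = _ := by
        rw [ENNReal.ofReal_mul (by norm_num), ENNReal.ofReal_ofNat]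
        ring

theorem lintegral_eq_lintegral_slab {E : Type*} [NormedAddCommGroup E] [InnerProductSpace ℝ E]
    [FiniteDimensional ℝ E] [MeasurableSpace E] [BorelSpace E] {b : E} (hb : b ≠ 0)
    {Φ : E → ℝ≥0∞} (hΦ : Measurable Φ) :
    ∫⁻ z, Φ z = ∫⁻ z in {z : E | ⟪z, b⟫ / ‖b‖ ^ 2 ∈ Set.Ico (0 : ℝ) 1},
      ∫⁻ t : ℝ, Φ (z + t • b) := by
  have hb2 : ‖b‖ ^ 2 ≠ 0 := by positivity
  have hA : MeasurableSet {z : E | ⟪z, b⟫ / ‖b‖ ^ 2 ∈ Set.Ico (0 : ℝ) 1} :=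
    measurableSet_Ico.preimage (f := fun z : E => ⟪z, b⟫ / ‖b‖ ^ 2) (by fun_prop)
  have hψ : Measurable (Set.indicator {z : E | ⟪z, b⟫ / ‖b‖ ^ 2 ∈ Set.Ico (0 : ℝ) 1}
      (1 : E → ℝ≥0∞)) := measurable_one.indicator hA
  have h1 : ∀ z : E, ∫⁻ t : ℝ, Set.indicator {z : E | ⟪z, b⟫ / ‖b‖ ^ 2 ∈ Set.Ico (0 : ℝ) 1}
      (1 : E → ℝ≥0∞) (z - t • b) = 1 := by
    intro z
    have : ∀ t : ℝ, Set.indicator {z : E | ⟪z, b⟫ / ‖b‖ ^ 2 ∈ Set.Ico (0 : ℝ) 1}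
        (1 : E → ℝ≥0∞) (z - t • b) =
        Set.indicator (Set.Ioc (⟪z, b⟫ / ‖b‖ ^ 2 - 1) (⟪z, b⟫ / ‖b‖ ^ 2)) 1 t := by
      intro t
      have e : ⟪z - t • b, b⟫ / ‖b‖ ^ 2 = ⟪z, b⟫ / ‖b‖ ^ 2 - t := by
        rw [inner_sub_left, real_inner_smul_left, real_inner_self_eq_norm_sq]
        field_simp
      refine Set.indicator_eq_indicator ?_ rfl
      rw [Set.mem_ofPred_eq, e]
      constructor <;> rintro ⟨h1, h2⟩ <;> constructor <;> linarith
    simp only [this]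
    rw [lintegral_indicator_one measurableSet_Ioc]
    simp
  have hm1 : Measurable fun q : ℝ × E => Φ (q.2 + q.1 • b) := by fun_prop
  have hm2 : Measurable fun q : E × ℝ => Φ (q.1 + q.2 • b) := by fun_prop
  symm
  calc _ = ∫⁻ z, ∫⁻ t : ℝ, Set.indicator {z : E | ⟪z, b⟫ / ‖b‖ ^ 2 ∈ Set.Ico (0 : ℝ) 1}
        (1 : E → ℝ≥0∞) z * Φ (z + t • b) := by
        rw [← lintegral_indicator hA]
        refine lintegral_congr fun z => ?_
        simp only [Set.indicator_apply]
        split_ifs <;> simp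
    _ = ∫⁻ t : ℝ, ∫⁻ z, Set.indicator {z : E | ⟪z, b⟫ / ‖b‖ ^ 2 ∈ Set.Ico (0 : ℝ) 1}
        (1 : E → ℝ≥0∞) z * Φ (z + t • b) :=
        lintegral_lintegral_swap ((hψ.comp measurable_fst).mul hm2).aemeasurable
    _ = ∫⁻ t : ℝ, ∫⁻ z, Set.indicator {z : E | ⟪z, b⟫ / ‖b‖ ^ 2 ∈ Set.Ico (0 : ℝ) 1}
        (1 : E → ℝ≥0∞) (z - t • b) * Φ z := by
        refine lintegral_congr fun t => ?_
        conv_rhs => rw [← lintegral_add_right_eq_self _ (t • b)]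
        simp only [add_sub_cancel_right]
    _ = ∫⁻ z, ∫⁻ t : ℝ, Set.indicator {z : E | ⟪z, b⟫ / ‖b‖ ^ 2 ∈ Set.Ico (0 : ℝ) 1}
        (1 : E → ℝ≥0∞) (z - t • b) * Φ z := by
        refine lintegral_lintegral_swap (Measurable.aemeasurable ?_)
        have : Measurable fun q : ℝ × E => q.2 - q.1 • b := by fun_prop
        exact (hψ.comp this).mul (hΦ.comp measurable_snd)
    _ = _ := by
        refine lintegral_congr fun z => ?_
        have h2 : Measurable fun t : ℝ => z - t • b := by fun_prop
        have h3 := lintegral_mul_const (μ := volume) (Φ z) (hψ.comp h2)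
        simp only [Function.comp_def] at h3
        rw [h3, h1, one_mul]

theorem linePolynomial_add_smul {m : ℕ} (P : MvPolynomial (Fin m) ℝ)
    (y b : EuclideanSpace ℝ (Fin m)) (t lam : ℝ) :
    linePolynomial P (y + t • b) (lam • b) = (linePolynomial P y b).comp
      (Polynomial.C (t : ℂ) + Polynomial.C (lam : ℂ) * Polynomial.X) := by
  refine Polynomial.funext fun z => ?_
  rw [Polynomial.eval_comp, eval_linePolynomial, eval_linePolynomial]
  congr 2
  funext i
  simp
  ring

theorem volume_zeros_eq_zero {m : ℕ} {P : MvPolynomial (Fin m) ℝ} (hP : P ≠ 0) {k : ℕ}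
    (hhom : P.IsHomogeneous k) :
    volume {z : EuclideanSpace ℝ (Fin m) | MvPolynomial.eval (fun i => z i) P = 0} = 0 := by
  obtain ⟨v, hv⟩ : ∃ v : EuclideanSpace ℝ (Fin m), MvPolynomial.eval (fun i => v i) P ≠ 0 := by
    by_contra! hcon
    refine hP (MvPolynomial.funext fun x => ?_)
    simpa using hcon (WithLp.toLp 2 x)
  have hcont : ∀ Q : MvPolynomial (Fin m) ℝ,
      Continuous fun z : EuclideanSpace ℝ (Fin m) => MvPolynomial.eval (fun i => z i) Q :=
    fun Q => (MvPolynomial.continuous_eval Q).comp (by fun_prop)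
  have hscale : ∀ (z : EuclideanSpace ℝ (Fin m)) (r : ℝ),
      MvPolynomial.eval (fun i => (r • z) i) P = r ^ k * MvPolynomial.eval (fun i => z i) P := by
    intro z r
    rw [MvPolynomial.eval_eq, MvPolynomial.eval_eq, Finset.mul_sum]
    refine Finset.sum_congr rfl fun d hd => ?_
    have hdk : d.degree = k := by
      rw [Finsupp.degree_eq_weight_one]
      exact hhom (MvPolynomial.mem_support_iff.1 hd)
    simp only [PiLp.smul_apply, smul_eq_mul, mul_pow, Finset.prod_mul_distrib,
      Finset.prod_pow_eq_pow_sum]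
    rw [← hdk, Finsupp.degree_apply]
    ring
  by_cases hv0 : v = 0
  · have h0 : ∀ z : EuclideanSpace ℝ (Fin m), MvPolynomial.eval (fun i => z i) P ≠ 0 := by
      intro z hz
      have := hscale z 0
      rw [hz, mul_zero, zero_smul, ← hv0] at this
      exact hv this
    simp [h0]
  have hms : MeasurableSet {z : EuclideanSpace ℝ (Fin m) | MvPolynomial.eval (fun i => z i) P = 0} :=
    (isClosed_singleton.preimage (hcont P)).measurableSet
  have hnull : ∀ z : EuclideanSpace ℝ (Fin m), ∫⁻ t : ℝ, Set.indicator
      {z : EuclideanSpace ℝ (Fin m) | MvPolynomial.eval (fun i => z i) P = 0}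
      (1 : EuclideanSpace ℝ (Fin m) → ℝ≥0∞) (z + t • v) = 0 := by
    intro z
    have hne : linePolynomial P z v ≠ 0 := by
      intro h0
      have hz : ∀ t : ℝ, MvPolynomial.eval (fun i => (z + t • v) i) P = 0 := by
        intro t
        have := eval_linePolynomial_ofReal P z v t
        rw [h0, Polynomial.eval_zero] at this
        exact_mod_cast this.symm
      have hz' : ∀ r : ℝ, r ≠ 0 → MvPolynomial.eval (fun i => (v + r • z) i) P = 0 := by
        intro r hr
        have := hscale (z + r⁻¹ • v) r
        rw [hz, mul_zero, smul_add, smul_inv_smul₀ hr, add_comm] at this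
        exact this
      have ht : Tendsto (fun r : ℝ => MvPolynomial.eval (fun i => (v + r • z) i) P)
          (nhdsWithin 0 {0}ᶜ) (nhds (MvPolynomial.eval (fun i => (v + (0 : ℝ) • z) i) P)) :=
        (((hcont P).comp (by fun_prop : Continuous fun r : ℝ => v + r • z)).tendsto 0).mono_left
          nhdsWithin_le_nhds
      rw [zero_smul, add_zero] at ht
      refine hv (tendsto_nhds_unique ht (tendsto_const_nhds.congr' ?_))
      filter_upwards [self_mem_nhdsWithin] with r hr
      exact (hz' r hr).symm
    have hfin : {t : ℝ | MvPolynomial.eval (fun i => (z + t • v) i) P = 0}.Finite := by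
      refine Set.Finite.of_finite_image (f := ((↑) : ℝ → ℂ)) ?_ Complex.ofReal_injective.injOn
      refine ((linePolynomial P z v).rootSet_finite ℂ).subset ?_
      rintro _ ⟨t, ht, rfl⟩
      rw [Polynomial.mem_rootSet]
      refine ⟨hne, ?_⟩
      rw [Polynomial.coe_aeval_eq_eval, eval_linePolynomial_ofReal, ht, Complex.ofReal_zero]
    have hms2 : MeasurableSet {t : ℝ | MvPolynomial.eval (fun i => (z + t • v) i) P = 0} :=
      hfin.measurableSet
    calc _ = ∫⁻ t : ℝ, Set.indicator {t : ℝ | MvPolynomial.eval (fun i => (z + t • v) i) P = 0}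
          (1 : ℝ → ℝ≥0∞) t := by
          refine lintegral_congr fun t => ?_
          exact Set.indicator_eq_indicator Iff.rfl rfl
      _ = 0 := by rw [lintegral_indicator_one hms2]; exact hfin.measure_zero _
  rw [← lintegral_indicator_one hms, lintegral_eq_lintegral_slab hv0 (measurable_one.indicator hms)]
  simp only [hnull, lintegral_zero]

theorem lintegral_mul_lineGap_le {m : ℕ} {P : MvPolynomial (Fin m) ℝ} (hP : P ≠ 0) {k : ℕ}
    (hhom : P.IsHomogeneous k) {p : EuclideanSpace ℝ (Fin m) → ℝ} {K : NNReal}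
    (hp : LipschitzWith K p) (hc : HasCompactSupport p) {lam : ℝ} (hlam : 0 < lam)
    (Y : EuclideanSpace ℝ (Fin m)) {b : EuclideanSpace ℝ (Fin m)} (hb : b ≠ 0) :
    ∫⁻ z, ENNReal.ofReal (p z) * lineGap P (z + Y) (lam • b) ≤
      P.totalDegree * ENNReal.ofReal lam * ∫⁻ z, ENNReal.ofReal |lineDeriv ℝ p z b| := by
  have hm1 : Measurable fun z => ENNReal.ofReal (p z) * lineGap P (z + Y) (lam • b) := by
    refine (ENNReal.measurable_ofReal.comp hp.continuous.measurable).mul ?_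
    exact (measurable_lineGap P).comp (f := fun z : EuclideanSpace ℝ (Fin m) =>
      (z + Y, lam • b)) (by fun_prop)
  have hm2 : Measurable fun z => ENNReal.ofReal |lineDeriv ℝ p z b| :=
    ENNReal.measurable_ofReal.comp (measurable_lineDeriv hp.continuous).abs
  rw [lintegral_eq_lintegral_slab hb hm1, lintegral_eq_lintegral_slab hb hm2]
  have hcost : ∀ z : EuclideanSpace ℝ (Fin m), MvPolynomial.eval (fun i => (z + Y) i) P ≠ 0 →
      ∫⁻ t : ℝ, ENNReal.ofReal (p (z + t • b)) * lineGap P (z + t • b + Y) (lam • b) ≤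
      P.totalDegree * ENNReal.ofReal lam * ∫⁻ t : ℝ, ENNReal.ofReal |lineDeriv ℝ p (z + t • b) b| := by
    intro z hz
    have hR : linePolynomial P (z + Y) b ≠ 0 := by
      intro h0
      have := eval_linePolynomial_ofReal P (z + Y) b 0
      rw [h0, Polynomial.eval_zero, zero_smul, add_zero] at this
      exact hz (by exact_mod_cast this.symm)
    have hemb : Isometry fun t : ℝ => z + (t * ‖b‖⁻¹) • b := by
      refine Isometry.of_dist_eq fun s t => ?_
      rw [dist_add_left, dist_eq_norm, ← sub_smul, norm_smul, Real.dist_eq, ← sub_mul, norm_mul,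
        norm_inv, norm_norm, mul_assoc, inv_mul_cancel₀ (norm_ne_zero_iff.2 hb), mul_one,
        Real.norm_eq_abs]
    have hw : LipschitzWith (K * ‖b‖₊) fun t : ℝ => p (z + t • b) := by
      refine hp.comp (LipschitzWith.of_dist_le_mul fun s t => ?_)
      rw [dist_add_left, dist_eq_norm, ← sub_smul, norm_smul, Real.dist_eq, mul_comm, coe_nnnorm,
        Real.norm_eq_abs]
    have hwc : HasCompactSupport fun t : ℝ => p (z + t • b) := by
      have h1 := hc.comp_isClosedEmbedding hemb.isClosedEmbedding
      have h2 := h1.comp_isClosedEmbedding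
        (Homeomorph.mulRight₀ ‖b‖ (norm_ne_zero_iff.2 hb)).isClosedEmbedding
      convert h2 using 1
      funext t
      simp [mul_assoc, mul_inv_cancel₀ (norm_ne_zero_iff.2 hb)]
    have hderiv : ∀ t : ℝ, deriv (fun t : ℝ => p (z + t • b)) t = lineDeriv ℝ p (z + t • b) b := by
      intro t
      rw [lineDeriv]
      have : (fun s : ℝ => p (z + t • b + s • b)) = fun s => (fun t : ℝ => p (z + t • b)) (t + s) := by
        funext s
        simp only [add_smul, add_assoc]
      rw [this, deriv_comp_const_add (fun t : ℝ => p (z + t • b)) t 0, add_zero]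
    have h1 := lintegral_mul_jensenGap_comp_le hw hwc hR hlam
    simp only [hderiv] at h1
    calc _ = _ := by
          refine lintegral_congr fun t => ?_
          rw [lineGap, add_right_comm, linePolynomial_add_smul]
      _ ≤ _ := h1
      _ ≤ _ := by
          refine mul_le_mul_of_nonneg_right (mul_le_mul_of_nonneg_right ?_ zero_le) zero_le
          exact_mod_cast natDegree_linePolynomial_le P (z + Y) b
  have hnull : ∀ᵐ z : EuclideanSpace ℝ (Fin m), MvPolynomial.eval (fun i => (z + Y) i) P ≠ 0 := by
    rw [ae_iff]
    simp only [not_not]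
    have := measure_preimage_add_right volume Y
      {z : EuclideanSpace ℝ (Fin m) | MvPolynomial.eval (fun i => z i) P = 0}
    rw [volume_zeros_eq_zero hP hhom] at this
    exact this
  calc _ ≤ ∫⁻ z in {z | ⟪z, b⟫ / ‖b‖ ^ 2 ∈ Set.Ico (0 : ℝ) 1}, P.totalDegree * ENNReal.ofReal lam *
        ∫⁻ t : ℝ, ENNReal.ofReal |lineDeriv ℝ p (z + t • b) b| :=
        lintegral_mono_ae ((ae_restrict_of_ae hnull).mono hcost)
    _ = _ := lintegral_const_mul' _ _ (by finiteness)

open scoped Pointwise in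
theorem exists_lipschitz_bump {m : ℕ} {A : Set (EuclideanSpace ℝ (Fin m))} (hA : Convex ℝ A)
    (hAo : IsOpen A) (hAb : Bornology.IsBounded A) {r : ℝ} (hr : 0 < r)
    (hball : Metric.ball 0 r ⊆ A) {η : ℝ} (hη : 0 < η) :
    ∃ (p : EuclideanSpace ℝ (Fin m) → ℝ) (L : NNReal), LipschitzWith L p ∧ HasCompactSupport p ∧
      (∀ z ∈ A, p z = 1) ∧
      ∀ᵐ z, ∃ u : EuclideanSpace ℝ (Fin m), (∀ b, lineDeriv ℝ p z b = ⟪u, b⟫) ∧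
        ‖u‖ ≤ Set.indicator ((1 + η) • A \ A) (fun _ => (η * r)⁻¹) z := by
  have h0 : (0 : EuclideanSpace ℝ (Fin m)) ∈ A := hball (Metric.mem_ball_self hr)
  have hgA := setOfPred_gauge_lt_one_eq_self_of_isOpen hA h0 hAo
  have hη1 : (0 : ℝ) < 1 + η := by linarith
  have hmem : ∀ z, gauge A z < 1 + η → z ∈ (1 + η) • A := by
    intro z hz
    rw [Set.mem_smul_set_iff_inv_smul_mem₀ hη1.ne', ← hgA, Set.mem_ofPred_eq,
      gauge_smul_of_nonneg (by positivity), smul_eq_mul, inv_mul_lt_one₀ hη1]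
    exact hz
  lift r to NNReal using hr.le
  lift η to NNReal using hη.le
  have hG : LipschitzWith r⁻¹ (gauge A) := hA.lipschitzWith_gauge (by exact_mod_cast hr) hball
  set p : EuclideanSpace ℝ (Fin m) → ℝ := fun z => max 0 (min 1 (1 - (η : ℝ)⁻¹ * (gauge A z - 1))) with hp
  have hL : LipschitzWith (η⁻¹ * r⁻¹) p := by
    refine LipschitzWith.const_max (LipschitzWith.const_min ?_ _) _
    refine LipschitzWith.of_dist_le_mul fun y z => ?_
    have := hG.dist_le_mul y z
    rw [Real.dist_eq] at this ⊢
    have e : (1 - (η : ℝ)⁻¹ * (gauge A y - 1)) - (1 - (η : ℝ)⁻¹ * (gauge A z - 1)) =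
      (η : ℝ)⁻¹ * -(gauge A y - gauge A z) := by ring
    rw [e, abs_mul, abs_neg, abs_of_pos (inv_pos.2 hη), NNReal.coe_mul, mul_assoc,
      NNReal.coe_inv η]
    exact mul_le_mul_of_nonneg_left this (inv_pos.2 hη).le
  have hp01 : ∀ z, p z ≤ 1 := fun z => max_le zero_le_one (min_le_left _ _)
  have hp0 : ∀ z, 0 ≤ p z := fun z => le_max_left _ _
  have hpA : ∀ z ∈ A, p z = 1 := by
    intro z hz
    have h1 : gauge A z ≤ 1 := gauge_le_one_of_mem hz
    have h2 : (η : ℝ)⁻¹ * (gauge A z - 1) ≤ 0 :=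
      mul_nonpos_of_nonneg_of_nonpos (inv_pos.2 hη).le (by linarith)
    simp only [hp]
    rw [min_eq_left (by linarith)]
    simp
  have hpout : ∀ z, z ∉ (1 + (η : ℝ)) • A → p z = 0 := by
    intro z hz
    have h1 : 1 + η ≤ gauge A z := not_lt.1 fun h => hz (hmem z h)
    have h2 : 1 ≤ (η : ℝ)⁻¹ * (gauge A z - 1) := by
      rw [← div_eq_inv_mul, le_div_iff₀ hη]; linarith
    simp only [hp]
    rw [max_eq_left]
    exact (min_le_right _ _).trans (by linarith)
  refine ⟨p, _, hL, ?_, hpA, ?_⟩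
  · refine HasCompactSupport.of_support_subset_isCompact
      (hAb.smul₀ (1 + (η : ℝ))).isCompact_closure fun z hz => subset_closure ?_
    by_contra h
    exact hz (hpout z h)
  · filter_upwards [hL.ae_differentiableAt] with z hz
    refine ⟨(InnerProductSpace.toDual ℝ _).symm (fderiv ℝ p z), fun b => ?_, ?_⟩
    · rw [hz.lineDeriv_eq_fderiv, InnerProductSpace.toDual_symm_apply]
    rw [LinearIsometryEquiv.norm_map]
    by_cases h1 : z ∈ A
    · have : IsLocalMax p z := Eventually.of_forall fun y => by rw [hpA z h1]; exact hp01 y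
      rw [this.fderiv_eq_zero, norm_zero]
      exact Set.indicator_nonneg (fun _ _ => by positivity) _
    by_cases h2 : z ∈ (1 + (η : ℝ)) • A
    · rw [Set.indicator_of_mem (show z ∈ (1 + (η : ℝ)) • A \ A from ⟨h2, h1⟩), mul_inv]
      exact norm_fderiv_le_of_lipschitz ℝ hL
    · have : IsLocalMin p z := Eventually.of_forall fun y => by rw [hpout z h2]; exact hp0 y
      rw [this.fderiv_eq_zero, norm_zero]
      exact Set.indicator_nonneg (fun _ _ => by positivity) _

open scoped Pointwise in
theorem volume_smul_sdiff_le {m : ℕ} {A : Set (EuclideanSpace ℝ (Fin m))} (hA : Convex ℝ A)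
    (hAo : IsOpen A) (hAb : Bornology.IsBounded A) (h0 : 0 ∈ A) {η : ℝ} (hη : 0 < η) :
    volume ((1 + η) • A \ A) ≤ ENNReal.ofReal ((1 + η) ^ m - 1) * volume A := by
  have hsub : A ⊆ (1 + η) • A := by
    intro z hz
    rw [Set.mem_smul_set_iff_inv_smul_mem₀ (by positivity)]
    refine hA.smul_mem_of_zero_mem h0 hz ⟨by positivity, inv_le_one_of_one_le₀ (by linarith)⟩
  rw [measure_sdiff hsub hAo.measurableSet.nullMeasurableSet hAb.measure_lt_top.ne,
    Measure.addHaar_smul, finrank_euclideanSpace_fin, abs_of_pos (by positivity),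
    ENNReal.ofReal_sub _ zero_le_one, ENNReal.sub_mul (by intros; exact hAb.measure_lt_top.ne)]
  simp

theorem lintegral_exp_neg_mul_sq {c : ℝ} (hc : 0 < c) :
    ∫⁻ t : ℝ, ENNReal.ofReal (Real.exp (-c * t ^ 2)) = ENNReal.ofReal (Real.sqrt (Real.pi / c)) := by
  rw [← integral_gaussian, ofReal_integral_eq_lintegral_ofReal (integrable_exp_neg_mul_sq hc)
    (ae_of_all _ fun t => (Real.exp_pos _).le)]

theorem integral_Ioi_mul_exp_neg_mul_sq {c : ℝ} (hc : 0 < c) :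
    ∫ t in Set.Ioi (0 : ℝ), t * Real.exp (-c * t ^ 2) = (2 * c)⁻¹ := by
  have h := integral_mul_cexp_neg_mul_sq (b := (c : ℂ)) (by simpa using hc)
  have h2 : (∫ t in Set.Ioi (0 : ℝ), (t : ℂ) * Complex.exp (-(c : ℂ) * (t : ℂ) ^ 2)) =
      ((∫ t in Set.Ioi (0 : ℝ), t * Real.exp (-c * t ^ 2) : ℝ) : ℂ) := by
    rw [← integral_complex_ofReal]
    refine integral_congr_ae (ae_of_all _ fun t => ?_)
    push_cast
    rfl
  rw [h2] at h
  exact_mod_cast h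

theorem lintegral_abs_mul_exp_neg_mul_sq {c : ℝ} (hc : 0 < c) :
    ∫⁻ t : ℝ, ENNReal.ofReal (|t| * Real.exp (-c * t ^ 2)) = ENNReal.ofReal c⁻¹ := by
  have hi : Integrable (fun t : ℝ => |t| * Real.exp (-c * t ^ 2)) := by
    refine (integrable_mul_exp_neg_mul_sq hc).abs.congr (ae_of_all _ fun t => ?_)
    simp [abs_mul]
  have h := integral_comp_abs (f := fun t : ℝ => t * Real.exp (-c * t ^ 2))
  simp only [sq_abs] at h
  rw [integral_Ioi_mul_exp_neg_mul_sq hc] at h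
  rw [← ofReal_integral_eq_lintegral_ofReal hi (ae_of_all _ fun t => by positivity), h]
  congr 1
  field_simp

theorem lintegral_abs_inner_mul_gaussian {E : Type*} [NormedAddCommGroup E]
    [InnerProductSpace ℝ E] [FiniteDimensional ℝ E] [MeasurableSpace E] [BorelSpace E]
    {c : ℝ} (hc : 0 < c) (u : E) :
    ∫⁻ b : E, ENNReal.ofReal |⟪u, b⟫| * ENNReal.ofReal (Real.exp (-c * ‖b‖ ^ 2)) =
      ENNReal.ofReal ‖u‖ * ENNReal.ofReal (Real.sqrt (Real.pi * c))⁻¹ *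
        ∫⁻ b : E, ENNReal.ofReal (Real.exp (-c * ‖b‖ ^ 2)) := by
  by_cases hu : u = 0
  · simp [hu]
  have hu0 : 0 < ‖u‖ := norm_pos_iff.2 hu
  rw [lintegral_eq_lintegral_slab hu (by fun_prop), lintegral_eq_lintegral_slab hu (by fun_prop),
    ← lintegral_const_mul' _ _ (by finiteness)]
  refine lintegral_congr fun z => ?_
  have hnorm : ∀ t : ℝ, -c * ‖z + t • u‖ ^ 2 = -c * (‖z‖ ^ 2 - ⟪u, z⟫ ^ 2 / ‖u‖ ^ 2) +
      -(c * ‖u‖ ^ 2) * (t + ⟪u, z⟫ / ‖u‖ ^ 2) ^ 2 := by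
    intro t
    rw [norm_add_sq_real, norm_smul, real_inner_smul_right, real_inner_comm z u, mul_pow,
      Real.norm_eq_abs, sq_abs]
    field_simp
    ring
  have hin : ∀ t : ℝ, ⟪u, z + t • u⟫ = ‖u‖ ^ 2 * (t + ⟪u, z⟫ / ‖u‖ ^ 2) := by
    intro t
    rw [inner_add_right, real_inner_smul_right, real_inner_self_eq_norm_sq]
    field_simp
    ring
  have h1 : ∀ t : ℝ, ENNReal.ofReal |⟪u, z + t • u⟫| *
      ENNReal.ofReal (Real.exp (-c * ‖z + t • u‖ ^ 2)) =
      ENNReal.ofReal (Real.exp (-c * (‖z‖ ^ 2 - ⟪u, z⟫ ^ 2 / ‖u‖ ^ 2)) * ‖u‖ ^ 2) *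
      (fun s : ℝ => ENNReal.ofReal (|s| * Real.exp (-(c * ‖u‖ ^ 2) * s ^ 2)))
        (t + ⟪u, z⟫ / ‖u‖ ^ 2) := by
    intro t
    rw [hnorm, hin, ← ENNReal.ofReal_mul (by positivity), ← ENNReal.ofReal_mul (by positivity),
      Real.exp_add, abs_mul, abs_of_pos (by positivity : 0 < ‖u‖ ^ 2)]
    congr 1
    ring
  have h2 : ∀ t : ℝ, ENNReal.ofReal (Real.exp (-c * ‖z + t • u‖ ^ 2)) =
      ENNReal.ofReal (Real.exp (-c * (‖z‖ ^ 2 - ⟪u, z⟫ ^ 2 / ‖u‖ ^ 2))) *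
      (fun s : ℝ => ENNReal.ofReal (Real.exp (-(c * ‖u‖ ^ 2) * s ^ 2)))
        (t + ⟪u, z⟫ / ‖u‖ ^ 2) := by
    intro t
    rw [hnorm, ← ENNReal.ofReal_mul (by positivity), Real.exp_add]
  have hcu : 0 < c * ‖u‖ ^ 2 := by positivity
  rw [lintegral_congr h1, lintegral_congr h2, lintegral_const_mul' _ _ ENNReal.ofReal_ne_top,
    lintegral_const_mul' _ _ ENNReal.ofReal_ne_top,
    lintegral_add_right_eq_self (fun s : ℝ => ENNReal.ofReal (|s| * Real.exp (-(c * ‖u‖ ^ 2) * s ^ 2))),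
    lintegral_add_right_eq_self (fun s : ℝ => ENNReal.ofReal (Real.exp (-(c * ‖u‖ ^ 2) * s ^ 2))),
    lintegral_abs_mul_exp_neg_mul_sq hcu, lintegral_exp_neg_mul_sq hcu]
  have hpc : 0 < Real.sqrt (Real.pi * c) := Real.sqrt_pos.2 (by positivity)
  rw [← ENNReal.ofReal_mul (by positivity), ← ENNReal.ofReal_mul (by positivity),
    ← ENNReal.ofReal_mul (by positivity), ← ENNReal.ofReal_mul (by positivity)]
  congr 1
  have e : Real.sqrt (Real.pi / (c * ‖u‖ ^ 2)) = Real.sqrt (Real.pi * c) / (c * ‖u‖) := by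
    rw [show Real.pi / (c * ‖u‖ ^ 2) = Real.pi * c / (c * ‖u‖) ^ 2 by field_simp,
      Real.sqrt_div (by positivity), Real.sqrt_sq (by positivity)]
  rw [e]
  field_simp

open scoped Pointwise in
theorem exists_lipschitz_bump_of_ball_subset {m : ℕ} {A : Set (EuclideanSpace ℝ (Fin m))}
    (hA : Convex ℝ A) (hAo : IsOpen A) (hAb : Bornology.IsBounded A)
    {q : EuclideanSpace ℝ (Fin m)} {r : ℝ} (hr : 0 < r)
    (hball : Metric.ball q r ⊆ A) {η : ℝ} (hη : 0 < η) :
    ∃ (p : EuclideanSpace ℝ (Fin m) → ℝ) (L : NNReal) (N : EuclideanSpace ℝ (Fin m) → ℝ≥0∞),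
      LipschitzWith L p ∧ HasCompactSupport p ∧ (∀ z ∈ A, p z = 1) ∧
      (∀ᵐ z, ∃ u : EuclideanSpace ℝ (Fin m), (∀ b, lineDeriv ℝ p z b = ⟪u, b⟫) ∧
        ENNReal.ofReal ‖u‖ ≤ N z) ∧
      ∫⁻ z, N z ≤ ENNReal.ofReal ((η * r)⁻¹ * ((1 + η) ^ m - 1)) * volume A := by
  set B : Set (EuclideanSpace ℝ (Fin m)) := (fun y => y + q) ⁻¹' A with hB
  have hBc : Convex ℝ B := hA.translate_preimage_left q
  have hBo : IsOpen B := hAo.preimage (by fun_prop)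
  have hBb : Bornology.IsBounded B := by
    have : B = (IsometryEquiv.addRight q) ⁻¹' A := rfl
    rw [this]
    exact (IsometryEquiv.addRight q).isometry.antilipschitz.isBounded_preimage hAb
  have hballB : Metric.ball 0 r ⊆ B := by
    intro y hy
    refine hball ?_
    simpa using hy
  have hvol : volume B = volume A := measure_preimage_add_right volume q A
  obtain ⟨p, L, hL, hc, h1, h2⟩ := exists_lipschitz_bump hBc hBo hBb hr hballB hη
  refine ⟨fun z => p (z - q), L, fun z => ENNReal.ofReal
    (Set.indicator ((1 + η) • B \ B) (fun _ => (η * r)⁻¹) (z - q)), ?_, ?_, ?_, ?_, ?_⟩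
  · have h3 := hL.comp (IsometryEquiv.subRight q).isometry.lipschitz
    rw [mul_one] at h3
    exact h3
  · exact hc.comp_homeomorph (Homeomorph.subRight q)
  · intro z hz
    exact h1 _ (by simpa [hB] using hz)
  · have h3 := (measurePreserving_sub_right volume q).quasiMeasurePreserving.ae h2
    filter_upwards [h3] with z ⟨u, hu, hun⟩
    refine ⟨u, fun b => ?_, ENNReal.ofReal_le_ofReal hun⟩
    rw [← hu b, lineDeriv, lineDeriv]
    simp only [add_sub_right_comm]
  · have hms : MeasurableSet ((1 + η) • B \ B) :=
      MeasurableSet.diff (hBo.smul₀ (by positivity : (1 + η : ℝ) ≠ 0)).measurableSet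
        hBo.measurableSet
    rw [lintegral_sub_right_eq_self (fun z => ENNReal.ofReal
      (Set.indicator ((1 + η) • B \ B) (fun _ => (η * r)⁻¹) z))]
    have : ∀ z, ENNReal.ofReal (Set.indicator ((1 + η) • B \ B) (fun _ => (η * r)⁻¹) z) =
        Set.indicator ((1 + η) • B \ B) (fun _ => ENNReal.ofReal (η * r)⁻¹) z := by
      intro z
      by_cases hz : z ∈ (1 + η) • B \ B
      · rw [Set.indicator_of_mem hz, Set.indicator_of_mem hz]
      · rw [Set.indicator_of_notMem hz, Set.indicator_of_notMem hz, ENNReal.ofReal_zero]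
    rw [lintegral_congr this, lintegral_indicator_const hms, ENNReal.ofReal_mul (by positivity), mul_assoc, ← hvol]
    exact mul_le_mul_of_nonneg_left
      (volume_smul_sdiff_le hBc hBo hBb (hballB (Metric.mem_ball_self hr)) hη) zero_le

theorem sq_lintegral_gaussian_le_lintegral_lineGap {m : ℕ} (P : MvPolynomial (Fin m) ℝ)
    {z x : EuclideanSpace ℝ (Fin m)} (hx : MvPolynomial.eval (fun i => x i) P = 0) {s c : ℝ}
    (hzx : dist z x < s) {G : EuclideanSpace ℝ (Fin m) → ℝ≥0∞} 
    (hG : ∀ Y δ : EuclideanSpace ℝ (Fin m), ‖δ‖ < s →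
      ENNReal.ofReal (Real.exp (-c * ‖Y - δ‖ ^ 2)) ≤ G Y) :
    (∫⁻ y : EuclideanSpace ℝ (Fin m), ENNReal.ofReal (Real.exp (-c * ‖y‖ ^ 2))) *
      (∫⁻ y : EuclideanSpace ℝ (Fin m), ENNReal.ofReal (Real.exp (-c * ‖y‖ ^ 2))) ≤
    ∫⁻ Y, ∫⁻ b : EuclideanSpace ℝ (Fin m), G Y * (ENNReal.ofReal (Real.exp (-c * ‖b‖ ^ 2)) *
      lineGap P (z + Y) (Real.exp 1 • b)) := by
  have hW := log_mul_lintegral_le_lintegral_lineGap P hx (lam := Real.exp 1)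
    (Real.one_lt_exp_iff.2 one_pos)
    (W := fun p : EuclideanSpace ℝ (Fin m) × EuclideanSpace ℝ (Fin m) =>
      ENNReal.ofReal (Real.exp (-c * ‖p.1‖ ^ 2)) * ENNReal.ofReal (Real.exp (-c * ‖p.2‖ ^ 2)))
    (by fun_prop) (by
      intro φ p
      rw [← ENNReal.ofReal_mul (Real.exp_pos _).le, ← ENNReal.ofReal_mul (Real.exp_pos _).le,
        ← Real.exp_add, ← Real.exp_add, mixing_apply]
      congr 2
      rw [norm_add_sq_real, norm_add_sq_real]
      simp only [norm_smul, norm_neg, real_inner_smul_left, real_inner_smul_right, inner_neg_left,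
        mul_pow, Real.norm_eq_abs, sq_abs, neg_smul]
      have := Real.sin_sq_add_cos_sq φ
      linear_combination (-c * (‖p.1‖ ^ 2 + ‖p.2‖ ^ 2)) * this)
  rw [Real.log_exp, ENNReal.ofReal_one, one_mul, Measure.volume_eq_prod,
    lintegral_prod_mul (f := fun y : EuclideanSpace ℝ (Fin m) =>
      ENNReal.ofReal (Real.exp (-c * ‖y‖ ^ 2))) (g := fun y : EuclideanSpace ℝ (Fin m) =>
      ENNReal.ofReal (Real.exp (-c * ‖y‖ ^ 2))) (by fun_prop) (by fun_prop)] at hW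
  refine hW.trans ?_
  have hL := measurable_lineGap P
  have hm : Measurable fun p : EuclideanSpace ℝ (Fin m) × EuclideanSpace ℝ (Fin m) =>
      lineGap P (x + p.1) (Real.exp 1 • p.2) :=
    hL.comp (f := fun p : EuclideanSpace ℝ (Fin m) × EuclideanSpace ℝ (Fin m) =>
      (x + p.1, Real.exp 1 • p.2)) (by fun_prop)
  rw [lintegral_prod _ (Measurable.aemeasurable (by fun_prop)),
    ← lintegral_sub_right_eq_self _ (x - z)]
  refine lintegral_mono fun Y => lintegral_mono fun b => ?_
  have e : x + (Y - (x - z)) = z + Y := by abel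
  rw [e, mul_assoc]
  refine mul_le_mul_of_nonneg_right (hG _ _ ?_) zero_le
  rwa [← dist_eq_norm, dist_comm]

theorem measure_mul_lintegral_gaussian_le {m : ℕ} [NeZero m]
    {J : EuclideanSpace ℝ (Fin m) → EuclideanSpace ℝ (Fin m) → ℝ≥0∞}
    (hJ : Measurable fun t : EuclideanSpace ℝ (Fin m) × EuclideanSpace ℝ (Fin m) => J t.1 t.2)
    {G : EuclideanSpace ℝ (Fin m) → ℝ≥0∞} (hGm : Measurable G) {c : ℝ} (hc : 0 < c)
    {A T : Set (EuclideanSpace ℝ (Fin m))} (hTm : MeasurableSet T) (hTA : T ⊆ A)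
    (hlow : ∀ z ∈ T,
      (∫⁻ y : EuclideanSpace ℝ (Fin m), ENNReal.ofReal (Real.exp (-c * ‖y‖ ^ 2))) *
        (∫⁻ y : EuclideanSpace ℝ (Fin m), ENNReal.ofReal (Real.exp (-c * ‖y‖ ^ 2))) ≤
      ∫⁻ Y, ∫⁻ b : EuclideanSpace ℝ (Fin m), G Y *
        (ENNReal.ofReal (Real.exp (-c * ‖b‖ ^ 2)) * J (z + Y) b))
    {D : ℝ≥0∞} (hcst : ∀ (p : EuclideanSpace ℝ (Fin m) → ℝ) (L : NNReal), LipschitzWith L p →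
      HasCompactSupport p → ∀ Y b : EuclideanSpace ℝ (Fin m), b ≠ 0 →
      ∫⁻ z, ENNReal.ofReal (p z) * J (z + Y) b ≤ D * ∫⁻ z, ENNReal.ofReal |lineDeriv ℝ p z b|)
    (hA : Convex ℝ A) (hAo : IsOpen A)
    (hAb : Bornology.IsBounded A) {q : EuclideanSpace ℝ (Fin m)} {r : ℝ} (hr : 0 < r)
    (hball : Metric.ball q r ⊆ A) {η : ℝ} (hη : 0 < η) :
    volume T * ∫⁻ y : EuclideanSpace ℝ (Fin m), ENNReal.ofReal (Real.exp (-c * ‖y‖ ^ 2)) ≤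
    (∫⁻ y, G y) * (D * (ENNReal.ofReal (Real.sqrt (Real.pi * c))⁻¹ *
        (ENNReal.ofReal ((η * r)⁻¹ * ((1 + η) ^ m - 1)) * volume A))) := by
  obtain ⟨p, L, N, hL, hpc, hp1, hpd, hN⟩ :=
    exists_lipschitz_bump_of_ball_subset hA hAo hAb hr hball hη
  set M := ∫⁻ y : EuclideanSpace ℝ (Fin m), ENNReal.ofReal (Real.exp (-c * ‖y‖ ^ 2)) with hM
  have hγm : Measurable fun y : EuclideanSpace ℝ (Fin m) =>
      ENNReal.ofReal (Real.exp (-c * ‖y‖ ^ 2)) := by fun_prop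
  have hint : ∫ v : EuclideanSpace ℝ (Fin m), Real.exp (-c * ‖v‖ ^ 2) =
      (Real.pi / c) ^ ((Module.finrank ℝ (EuclideanSpace ℝ (Fin m)) : ℝ) / 2) :=
    GaussianFourier.integral_rexp_neg_mul_sq_norm hc
  have hpos : 0 < ∫ v : EuclideanSpace ℝ (Fin m), Real.exp (-c * ‖v‖ ^ 2) := by
    rw [hint]; exact Real.rpow_pos_of_pos (by positivity) _
  have hMr : M = ENNReal.ofReal (∫ v : EuclideanSpace ℝ (Fin m), Real.exp (-c * ‖v‖ ^ 2)) := by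
    rw [ofReal_integral_eq_lintegral_ofReal (Integrable.of_integral_ne_zero hpos.ne')
      (ae_of_all _ fun t => (Real.exp_pos _).le)]
  have hM0 : M ≠ 0 := by rw [hMr]; simpa using hpos
  have hMt : M ≠ ∞ := by rw [hMr]; exact ENNReal.ofReal_ne_top
  have hLm : Measurable fun t : EuclideanSpace ℝ (Fin m) × EuclideanSpace ℝ (Fin m) ×
      EuclideanSpace ℝ (Fin m) => J (t.1 + t.2.1) t.2.2 :=
    hJ.comp (f := fun t : EuclideanSpace ℝ (Fin m) ×
      EuclideanSpace ℝ (Fin m) × EuclideanSpace ℝ (Fin m) => (t.1 + t.2.1, t.2.2)) (by fun_prop)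
  have hpm : Measurable fun z => ENNReal.ofReal (p z) :=
    ENNReal.measurable_ofReal.comp hL.continuous.measurable
  have hz1 : ∀ z, Set.indicator T (fun _ => M * M) z ≤
      ∫⁻ Y, ∫⁻ b : EuclideanSpace ℝ (Fin m), ENNReal.ofReal (p z) * (G Y *
        (ENNReal.ofReal (Real.exp (-c * ‖b‖ ^ 2)) * J (z + Y) b)) := by
    intro z
    by_cases hz : z ∈ T
    · rw [Set.indicator_of_mem hz]
      rw [hp1 z (hTA hz)]
      simp only [ENNReal.ofReal_one, one_mul]
      exact hlow z hz
    · rw [Set.indicator_of_notMem hz]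
      exact zero_le
  have hcost : ∀ Y, ∀ᵐ b : EuclideanSpace ℝ (Fin m), ∫⁻ z, ENNReal.ofReal (p z) * (G Y *
        (ENNReal.ofReal (Real.exp (-c * ‖b‖ ^ 2)) * J (z + Y) b)) ≤
      G Y * (D * (ENNReal.ofReal (Real.exp (-c * ‖b‖ ^ 2)) *
        ∫⁻ z, ENNReal.ofReal |lineDeriv ℝ p z b|)) := by
    intro Y
    filter_upwards [Measure.ae_ne volume (0 : EuclideanSpace ℝ (Fin m))] with b hb
    have hm1 : Measurable fun z => ENNReal.ofReal (p z) * J (z + Y) b :=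
      hpm.mul (hLm.comp (by fun_prop : Measurable fun z : EuclideanSpace ℝ (Fin m) => (z, Y, b)))
    calc _ = ∫⁻ z, (G Y * ENNReal.ofReal (Real.exp (-c * ‖b‖ ^ 2))) *
          (ENNReal.ofReal (p z) * J (z + Y) b) :=
          lintegral_congr fun z => by ring
      _ = (G Y * ENNReal.ofReal (Real.exp (-c * ‖b‖ ^ 2))) *
          ∫⁻ z, ENNReal.ofReal (p z) * J (z + Y) b :=
          lintegral_const_mul _ hm1
      _ ≤ (G Y * ENNReal.ofReal (Real.exp (-c * ‖b‖ ^ 2))) * _ :=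
          mul_le_mul_of_nonneg_left
            (hcst p L hL hpc Y b hb) zero_le
      _ = _ := by ring
  have hgrad : ∫⁻ b : EuclideanSpace ℝ (Fin m), ENNReal.ofReal (Real.exp (-c * ‖b‖ ^ 2)) *
      ∫⁻ z, ENNReal.ofReal |lineDeriv ℝ p z b| ≤
      (ENNReal.ofReal (Real.sqrt (Real.pi * c))⁻¹ *
        (ENNReal.ofReal ((η * r)⁻¹ * ((1 + η) ^ m - 1)) * volume A)) * M := by
    have hD : Measurable fun t : EuclideanSpace ℝ (Fin m) × EuclideanSpace ℝ (Fin m) =>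
        ENNReal.ofReal |lineDeriv ℝ p t.1 t.2| :=
      ENNReal.measurable_ofReal.comp (measurable_lineDeriv_uncurry hL.continuous).abs
    calc _ = ∫⁻ b : EuclideanSpace ℝ (Fin m), ∫⁻ z, ENNReal.ofReal (Real.exp (-c * ‖b‖ ^ 2)) *
          ENNReal.ofReal |lineDeriv ℝ p z b| :=
          lintegral_congr fun b => (lintegral_const_mul' _ _ ENNReal.ofReal_ne_top).symm
      _ = ∫⁻ z, ∫⁻ b : EuclideanSpace ℝ (Fin m), ENNReal.ofReal (Real.exp (-c * ‖b‖ ^ 2)) *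
          ENNReal.ofReal |lineDeriv ℝ p z b| :=
          lintegral_lintegral_swap ((hγm.comp measurable_fst).mul
            (hD.comp measurable_swap)).aemeasurable
      _ ≤ ∫⁻ z, N z * (ENNReal.ofReal (Real.sqrt (Real.pi * c))⁻¹ * M) := by
          refine lintegral_mono_ae ?_
          filter_upwards [hpd] with z ⟨u, hu, hun⟩
          have e := lintegral_abs_inner_mul_gaussian hc u
          rw [← hM] at e
          calc _ = ∫⁻ b : EuclideanSpace ℝ (Fin m), ENNReal.ofReal |⟪u, b⟫| *
                ENNReal.ofReal (Real.exp (-c * ‖b‖ ^ 2)) :=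
                lintegral_congr fun b => by rw [hu, mul_comm]
            _ = ENNReal.ofReal ‖u‖ * (ENNReal.ofReal (Real.sqrt (Real.pi * c))⁻¹ * M) := by
                rw [e, mul_assoc]
            _ ≤ _ := mul_le_mul_of_nonneg_right hun zero_le
      _ = (∫⁻ z, N z) * (ENNReal.ofReal (Real.sqrt (Real.pi * c))⁻¹ * M) :=
          lintegral_mul_const' _ _ (ENNReal.mul_ne_top ENNReal.ofReal_ne_top hMt)
      _ ≤ (ENNReal.ofReal ((η * r)⁻¹ * ((1 + η) ^ m - 1)) * volume A) *
          (ENNReal.ofReal (Real.sqrt (Real.pi * c))⁻¹ * M) :=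
          mul_le_mul_of_nonneg_right hN zero_le
      _ = _ := by ring
  refine (ENNReal.mul_le_mul_iff_left hM0 hMt).1 ?_
  have hK : Measurable fun t : EuclideanSpace ℝ (Fin m) × EuclideanSpace ℝ (Fin m) ×
      EuclideanSpace ℝ (Fin m) => ENNReal.ofReal (p t.1) * (G t.2.1 *
        (ENNReal.ofReal (Real.exp (-c * ‖t.2.2‖ ^ 2)) *
          J (t.1 + t.2.1) t.2.2)) :=
    (hpm.comp measurable_fst).mul ((hGm.comp (measurable_fst.comp measurable_snd)).mul
      ((hγm.comp (measurable_snd.comp measurable_snd)).mul hLm))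
  calc _ = ∫⁻ z, Set.indicator T (fun _ => M * M) z := by
        rw [lintegral_indicator_const hTm]
        ring
    _ ≤ ∫⁻ z, ∫⁻ Y, ∫⁻ b : EuclideanSpace ℝ (Fin m), ENNReal.ofReal (p z) * (G Y *
        (ENNReal.ofReal (Real.exp (-c * ‖b‖ ^ 2)) * J (z + Y) b)) :=
        lintegral_mono hz1
    _ = ∫⁻ Y, ∫⁻ z, ∫⁻ b : EuclideanSpace ℝ (Fin m), ENNReal.ofReal (p z) * (G Y *
        (ENNReal.ofReal (Real.exp (-c * ‖b‖ ^ 2)) * J (z + Y) b)) :=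
        lintegral_lintegral_swap (Measurable.lintegral_prod_right' (f := fun t :
          (EuclideanSpace ℝ (Fin m) × EuclideanSpace ℝ (Fin m)) × EuclideanSpace ℝ (Fin m) =>
          ENNReal.ofReal (p t.1.1) * (G t.1.2 * (ENNReal.ofReal (Real.exp (-c * ‖t.2‖ ^ 2)) *
            J (t.1.1 + t.1.2) t.2)))
          (hK.comp MeasurableEquiv.prodAssoc.measurable)).aemeasurable
    _ = ∫⁻ Y, ∫⁻ b : EuclideanSpace ℝ (Fin m), ∫⁻ z, ENNReal.ofReal (p z) * (G Y *
        (ENNReal.ofReal (Real.exp (-c * ‖b‖ ^ 2)) * J (z + Y) b)) :=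
        lintegral_congr fun Y => lintegral_lintegral_swap (hK.comp (by fun_prop : Measurable fun t :
          EuclideanSpace ℝ (Fin m) × EuclideanSpace ℝ (Fin m) => (t.1, Y, t.2))).aemeasurable
    _ ≤ ∫⁻ Y, ∫⁻ b : EuclideanSpace ℝ (Fin m), G Y * (D *
        (ENNReal.ofReal (Real.exp (-c * ‖b‖ ^ 2)) * ∫⁻ z, ENNReal.ofReal |lineDeriv ℝ p z b|)) :=
        lintegral_mono fun Y => lintegral_mono_ae (hcost Y)
    _ = ∫⁻ Y, G Y * (D *
        ∫⁻ b : EuclideanSpace ℝ (Fin m), ENNReal.ofReal (Real.exp (-c * ‖b‖ ^ 2)) *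
          ∫⁻ z, ENNReal.ofReal |lineDeriv ℝ p z b|) := by
        have hD : Measurable fun b : EuclideanSpace ℝ (Fin m) =>
            ENNReal.ofReal (Real.exp (-c * ‖b‖ ^ 2)) * ∫⁻ z, ENNReal.ofReal |lineDeriv ℝ p z b| :=
          hγm.mul (Measurable.lintegral_prod_left' (f := fun t : EuclideanSpace ℝ (Fin m) ×
            EuclideanSpace ℝ (Fin m) => ENNReal.ofReal |lineDeriv ℝ p t.1 t.2|)
            (ENNReal.measurable_ofReal.comp (measurable_lineDeriv_uncurry hL.continuous).abs))
        refine lintegral_congr fun Y => ?_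
        rw [lintegral_const_mul _ (hD.const_mul _), lintegral_const_mul _ hD]
    _ = (∫⁻ Y, G Y) * (D *
        ∫⁻ b : EuclideanSpace ℝ (Fin m), ENNReal.ofReal (Real.exp (-c * ‖b‖ ^ 2)) *
          ∫⁻ z, ENNReal.ofReal |lineDeriv ℝ p z b|) := lintegral_mul_const _ hGm
    _ ≤ (∫⁻ Y, G Y) * (D * _) :=
        mul_le_mul_of_nonneg_left (mul_le_mul_of_nonneg_left hgrad zero_le) zero_le
    _ = _ := by ring

theorem volume_tube_mul_le {m : ℕ} [NeZero m] {P : MvPolynomial (Fin m) ℝ} (hP : P ≠ 0) {k : ℕ}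
    (hhom : P.IsHomogeneous k) {S : Set (EuclideanSpace ℝ (Fin m))}
    (hSP : ∀ x ∈ S, MvPolynomial.eval (fun i => x i) P = 0) {s c : ℝ} (hc : 0 < c)
    {G : EuclideanSpace ℝ (Fin m) → ℝ≥0∞} (hGm : Measurable G)
    (hG : ∀ Y δ : EuclideanSpace ℝ (Fin m), ‖δ‖ < s →
      ENNReal.ofReal (Real.exp (-c * ‖Y - δ‖ ^ 2)) ≤ G Y)
    {A : Set (EuclideanSpace ℝ (Fin m))} (hA : Convex ℝ A) (hAo : IsOpen A)
    (hAb : Bornology.IsBounded A) {q : EuclideanSpace ℝ (Fin m)} {r : ℝ} (hr : 0 < r)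
    (hball : Metric.ball q r ⊆ A) {η : ℝ} (hη : 0 < η) :
    volume {z ∈ A | ∃ x ∈ S, dist z x < s} *
      ∫⁻ y : EuclideanSpace ℝ (Fin m), ENNReal.ofReal (Real.exp (-c * ‖y‖ ^ 2)) ≤
    (∫⁻ y, G y) * (P.totalDegree * ENNReal.ofReal (Real.exp 1) *
      (ENNReal.ofReal (Real.sqrt (Real.pi * c))⁻¹ *
        (ENNReal.ofReal ((η * r)⁻¹ * ((1 + η) ^ m - 1)) * volume A))) := by
  have hTm : MeasurableSet {z ∈ A | ∃ x ∈ S, dist z x < s} := by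
    have : {z ∈ A | ∃ x ∈ S, dist z x < s} = A ∩ ⋃ x ∈ S, Metric.ball x s := by
      ext z; simp
    rw [this]
    exact (hAo.inter (isOpen_biUnion fun x _ => Metric.isOpen_ball)).measurableSet
  refine measure_mul_lintegral_gaussian_le (J := fun y b => lineGap P y (Real.exp 1 • b))
    ((measurable_lineGap P).comp (f := fun t : EuclideanSpace ℝ (Fin m) × EuclideanSpace ℝ (Fin m) =>
      (t.1, Real.exp 1 • t.2)) (by fun_prop)) hGm hc hTm (Set.sep_subset _ _) ?_ ?_ hA hAo hAb hr
      hball hη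
  · rintro z ⟨-, x, hxS, hzx⟩
    exact sq_lintegral_gaussian_le_lintegral_lineGap P (hSP x hxS) hzx hG
  · intro p L hL hpc Y b hb
    exact lintegral_mul_lineGap_le hP hhom hL hpc (Real.exp_pos 1) Y hb

theorem tendsto_inv_mul_one_add_pow_sub_one (m : ℕ) (r : ℝ) :
    Tendsto (fun η : ℝ => (η * r)⁻¹ * ((1 + η) ^ m - 1)) (nhdsWithin 0 (Set.Ioi 0))
      (nhds (m / r)) := by
  have h1 : HasDerivAt (fun η : ℝ => (1 + η) ^ m) (m : ℝ) 0 := by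
    have := ((hasDerivAt_id (0 : ℝ)).const_add 1).fun_pow m
    simpa using this
  have h2 := h1.tendsto_slope_zero_right.mul_const r⁻¹
  refine h2.congr fun η => ?_
  simp only [zero_add, smul_eq_mul, add_zero, one_pow, mul_inv]
  ring

theorem volume_tube_mul_le_of_majorant {m : ℕ} [NeZero m] {P : MvPolynomial (Fin m) ℝ} (hP : P ≠ 0)
    {k : ℕ} (hhom : P.IsHomogeneous k) {S : Set (EuclideanSpace ℝ (Fin m))}
    (hSP : ∀ x ∈ S, MvPolynomial.eval (fun i => x i) P = 0) {s c : ℝ} (hc : 0 < c)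
    {G : EuclideanSpace ℝ (Fin m) → ℝ≥0∞} (hGm : Measurable G) (hGi : ∫⁻ y, G y ≠ ∞)
    (hG : ∀ Y δ : EuclideanSpace ℝ (Fin m), ‖δ‖ < s →
      ENNReal.ofReal (Real.exp (-c * ‖Y - δ‖ ^ 2)) ≤ G Y)
    {A : Set (EuclideanSpace ℝ (Fin m))} (hA : Convex ℝ A) (hAo : IsOpen A)
    (hAb : Bornology.IsBounded A) {q : EuclideanSpace ℝ (Fin m)} {r : ℝ} (hr : 0 < r)
    (hball : Metric.ball q r ⊆ A) :
    volume {z ∈ A | ∃ x ∈ S, dist z x < s} *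
      ∫⁻ y : EuclideanSpace ℝ (Fin m), ENNReal.ofReal (Real.exp (-c * ‖y‖ ^ 2)) ≤
    (∫⁻ y, G y) * (P.totalDegree * ENNReal.ofReal (Real.exp 1) *
      (ENNReal.ofReal (Real.sqrt (Real.pi * c))⁻¹ *
        (ENNReal.ofReal (m / r) * volume A))) := by
  have hAt : volume A ≠ ∞ := hAb.measure_lt_top.ne
  have ht : Tendsto (fun η : ℝ => (∫⁻ y, G y) * (P.totalDegree * ENNReal.ofReal (Real.exp 1) *
      (ENNReal.ofReal (Real.sqrt (Real.pi * c))⁻¹ *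
        (ENNReal.ofReal ((η * r)⁻¹ * ((1 + η) ^ m - 1)) * volume A)))) (nhdsWithin 0 (Set.Ioi 0))
      (nhds ((∫⁻ y, G y) * (P.totalDegree * ENNReal.ofReal (Real.exp 1) *
      (ENNReal.ofReal (Real.sqrt (Real.pi * c))⁻¹ *
        (ENNReal.ofReal (m / r) * volume A))))) := by
    refine ENNReal.Tendsto.const_mul (ENNReal.Tendsto.const_mul (ENNReal.Tendsto.const_mul
      (ENNReal.Tendsto.mul_const (ENNReal.tendsto_ofReal (tendsto_inv_mul_one_add_pow_sub_one m r))
        (Or.inr hAt)) (Or.inr ENNReal.ofReal_ne_top)) (Or.inr ?_)) (Or.inr hGi)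
    finiteness
  refine ge_of_tendsto ht ?_
  filter_upwards [self_mem_nhdsWithin] with η hη
  exact volume_tube_mul_le hP hhom hSP hc hGm hG hA hAo hAb hr hball hη

theorem lintegral_gaussian {m : ℕ} {c : ℝ} (hc : 0 < c) :
    ∫⁻ y : EuclideanSpace ℝ (Fin m), ENNReal.ofReal (Real.exp (-c * ‖y‖ ^ 2)) =
      ENNReal.ofReal ((Real.pi / c) ^ ((m : ℝ) / 2)) := by
  have hint : ∫ v : EuclideanSpace ℝ (Fin m), Real.exp (-c * ‖v‖ ^ 2) =
      (Real.pi / c) ^ ((m : ℝ) / 2) := by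
    have := GaussianFourier.integral_rexp_neg_mul_sq_norm (V := EuclideanSpace ℝ (Fin m)) hc
    rwa [finrank_euclideanSpace_fin] at this
  have hpos : 0 < ∫ v : EuclideanSpace ℝ (Fin m), Real.exp (-c * ‖v‖ ^ 2) := by
    rw [hint]; exact Real.rpow_pos_of_pos (by positivity) _
  rw [← hint, ofReal_integral_eq_lintegral_ofReal (Integrable.of_integral_ne_zero hpos.ne')
      (ae_of_all _ fun t => (Real.exp_pos _).le)]

/-- Tube bound obtained from a majorant of mass `ρ` times the Gaussian mass. -/
theorem volume_tube_le_of_majorant {m : ℕ} [NeZero m] {P : MvPolynomial (Fin m) ℝ} (hP : P ≠ 0)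
    {k d : ℕ} (hhom : P.IsHomogeneous k) (hk : k ≤ d) {S : Set (EuclideanSpace ℝ (Fin m))}
    (hSP : ∀ x ∈ S, MvPolynomial.eval (fun i => x i) P = 0) {s c : ℝ} (hc : 0 < c)
    {G : EuclideanSpace ℝ (Fin m) → ℝ≥0∞} (hGm : Measurable G) {ρ : ℝ} (hρ : 0 ≤ ρ)
    (hGi : ∫⁻ y, G y ≤ ENNReal.ofReal (ρ * (Real.pi / c) ^ ((m : ℝ) / 2)))
    (hG : ∀ Y δ : EuclideanSpace ℝ (Fin m), ‖δ‖ < s →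
      ENNReal.ofReal (Real.exp (-c * ‖Y - δ‖ ^ 2)) ≤ G Y)
    {A : Set (EuclideanSpace ℝ (Fin m))} (hA : Convex ℝ A) (hAo : IsOpen A)
    (hAb : Bornology.IsBounded A) {q : EuclideanSpace ℝ (Fin m)} {r : ℝ} (hr : 0 < r)
    (hball : Metric.ball q r ⊆ A) :
    volume {z ∈ A | ∃ x ∈ S, dist z x < s} ≤
      ENNReal.ofReal (ρ * (d * Real.exp 1 * ((Real.sqrt (Real.pi * c))⁻¹ * (m / r)))) * volume A := by
  have hpos : 0 < (Real.pi / c) ^ ((m : ℝ) / 2) := Real.rpow_pos_of_pos (by positivity) _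
  have h := volume_tube_mul_le_of_majorant hP hhom hSP hc hGm (hGi.trans_lt ENNReal.ofReal_lt_top).ne
    hG hA hAo hAb hr hball
  rw [lintegral_gaussian hc] at h
  have hd : P.totalDegree ≤ d := hhom.totalDegree_le.trans hk
  have hne : ENNReal.ofReal ((Real.pi / c) ^ ((m : ℝ) / 2)) ≠ 0 := by simpa using hpos
  rw [← ENNReal.mul_le_mul_iff_left hne ENNReal.ofReal_ne_top]
  refine h.trans ?_
  calc _ ≤ ENNReal.ofReal (ρ * (Real.pi / c) ^ ((m : ℝ) / 2)) * (d * ENNReal.ofReal (Real.exp 1) *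
      (ENNReal.ofReal (Real.sqrt (Real.pi * c))⁻¹ * (ENNReal.ofReal (m / r) * volume A))) := by
        refine mul_le_mul' hGi (mul_le_mul_of_nonneg_right (mul_le_mul_of_nonneg_right ?_ zero_le)
          zero_le)
        exact_mod_cast hd
    _ = _ := by
        rw [ENNReal.ofReal_mul hρ, ENNReal.ofReal_mul hρ, ENNReal.ofReal_mul (by positivity),
          ENNReal.ofReal_mul (by positivity), ENNReal.ofReal_mul (by positivity),
          ENNReal.ofReal_natCast]
        ring

theorem volume_tube_le {n : ℕ} (hn : 1 ≤ n) {P : MvPolynomial (Fin (n + 1)) ℝ} (hP : P ≠ 0)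
    {k d : ℕ} (hhom : P.IsHomogeneous k) (hk : k ≤ d) {S : Set (EuclideanSpace ℝ (Fin (n + 1)))}
    (hSP : ∀ x ∈ S, MvPolynomial.eval (fun i => x i) P = 0) {s : ℝ} (hs : 0 < s)
    {A : Set (EuclideanSpace ℝ (Fin (n + 1)))} (hA : Convex ℝ A) (hAo : IsOpen A)
    (hAb : Bornology.IsBounded A) {q : EuclideanSpace ℝ (Fin (n + 1))} {r : ℝ} (hr : 0 < r)
    (hball : Metric.ball q r ⊆ A) :
    volume {z ∈ A | ∃ x ∈ S, dist z x < s} ≤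
      ENNReal.ofReal (Real.exp (1 / 2) * (1 + 1 / n) ^ (((n : ℝ) + 1) / 2) * Real.exp 1 *
        Real.sqrt (2 * n / Real.pi) * (n + 1) * (d * s / r)) * volume A := by
  have hn0 : (0 : ℝ) < n := by exact_mod_cast hn
  have hc : 0 < 1 / (2 * n * s ^ 2) := by positivity
  have h := volume_tube_le_of_majorant hP hhom hk hSP (s := s) hc
    (G := fun y => ENNReal.ofReal (Real.exp (1 / 2)) *
      ENNReal.ofReal (Real.exp (-(1 / (2 * (n + 1) * s ^ 2)) * ‖y‖ ^ 2)))
    (by fun_prop) (ρ := Real.exp (1 / 2) * (1 + 1 / n) ^ (((n : ℝ) + 1) / 2)) (by positivity) ?_ ?_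
    hA hAo hAb hr hball
  · refine h.trans_eq ?_
    congr 2
    have e : Real.sqrt (Real.pi * (1 / (2 * n * s ^ 2))) = (Real.sqrt (2 * n / Real.pi))⁻¹ / s := by
      rw [← Real.sqrt_inv, ← Real.sqrt_sq hs.le, ← Real.sqrt_div (by positivity), Real.sqrt_sq hs.le]
      congr 1
      field_simp
    rw [e]
    push_cast
    field_simp
  · rw [lintegral_const_mul' _ _ ENNReal.ofReal_ne_top, lintegral_gaussian (by positivity),
      ← ENNReal.ofReal_mul (by positivity)]
    refine ENNReal.ofReal_le_ofReal (le_of_eq ?_)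
    push_cast
    rw [mul_assoc (Real.exp (1 / 2)), ← Real.mul_rpow (by positivity) (by positivity)]
    congr 2
    field_simp
  · intro Y δ hδ
    rw [← ENNReal.ofReal_mul (by positivity), ← Real.exp_add]
    refine ENNReal.ofReal_le_ofReal (Real.exp_le_exp.2 ?_)
    have h1 : ‖Y‖ ≤ ‖Y - δ‖ + s := by
      have := norm_add_le (Y - δ) δ
      rw [sub_add_cancel] at this
      linarith
    have h2 := norm_nonneg Y
    have h3 := norm_nonneg (Y - δ)
    have h4 : ‖Y‖ ^ 2 ≤ (‖Y - δ‖ + s) ^ 2 := by gcongr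
    have h5 : (n : ℝ) * ‖Y‖ ^ 2 ≤ (n + 1) * ‖Y - δ‖ ^ 2 + n * (n + 1) * s ^ 2 := by
      nlinarith [sq_nonneg (‖Y - δ‖ - n * s)]
    have e : (1 : ℝ) / 2 + -(1 / (2 * (n + 1) * s ^ 2)) * ‖Y‖ ^ 2 -
        -(1 / (2 * n * s ^ 2)) * ‖Y - δ‖ ^ 2 =
        ((n + 1) * ‖Y - δ‖ ^ 2 + n * (n + 1) * s ^ 2 - n * ‖Y‖ ^ 2) / (2 * n * (n + 1) * s ^ 2) := by
      field_simp
      ring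
    have : 0 ≤ ((n + 1) * ‖Y - δ‖ ^ 2 + n * (n + 1) * s ^ 2 - n * ‖Y‖ ^ 2) /
      (2 * n * (n + 1) * s ^ 2) := div_nonneg (by linarith) (by positivity)
    linarith

theorem integrableOn_pow_mul_exp_neg_mul_sq {c : ℝ} (hc : 0 < c) (j : ℕ) :
    IntegrableOn (fun x : ℝ => x ^ j * Real.exp (-c * x ^ 2)) (Set.Ioi 0) := by
  have := integrableOn_rpow_mul_exp_neg_mul_sq hc (s := (j : ℝ))
    (by linarith [(Nat.cast_nonneg j : (0 : ℝ) ≤ j)])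
  simpa only [Real.rpow_natCast] using this

theorem integral_Ioi_sq_mul_exp_neg_mul_sq {c : ℝ} (hc : 0 < c) :
    ∫ x in Set.Ioi (0 : ℝ), x ^ 2 * Real.exp (-c * x ^ 2) = Real.sqrt (Real.pi / c) / (4 * c) := by
  have h := integral_rpow_mul_exp_neg_mul_rpow (p := 2) (q := 2) (b := c) two_pos (by norm_num) hc
  simp only [Real.rpow_two] at h
  rw [h]
  have e1 : (2 + 1 : ℝ) / 2 = 1 / 2 + 1 := by norm_num
  rw [e1, Real.Gamma_add_one (by norm_num), Real.Gamma_one_half_eq]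
  have e2 : (-(2 + 1) / 2 : ℝ) = -1 + -(1 / 2) := by norm_num
  rw [e2, Real.rpow_add hc, Real.rpow_neg_one, Real.rpow_neg hc.le, ← Real.sqrt_eq_rpow,
    Real.sqrt_div Real.pi_pos.le]
  field_simp
  norm_num

/-- Moments of the Gaussian flattened on `[0, s]`, in terms of Gaussian moments. -/
theorem integral_Ioi_pow_mul_flat_gaussian {c s : ℝ} (hs : 0 ≤ s) (j : ℕ)
    (hi : IntegrableOn (fun x : ℝ => (x + s) ^ j * Real.exp (-c * x ^ 2)) (Set.Ioi 0)) :
    IntegrableOn (fun y : ℝ => y ^ j * Real.exp (-c * max (y - s) 0 ^ 2)) (Set.Ioi 0) ∧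
    ∫ y in Set.Ioi (0 : ℝ), y ^ j * Real.exp (-c * max (y - s) 0 ^ 2) =
      s ^ (j + 1) / (j + 1) + ∫ x in Set.Ioi (0 : ℝ), (x + s) ^ j * Real.exp (-c * x ^ 2) := by
  have hmp := measurePreserving_add_right (volume : Measure ℝ) s
  have hemb : MeasurableEmbedding (fun x : ℝ => x + s) := measurableEmbedding_addRight s
  have hpre : (fun x : ℝ => x + s) ⁻¹' Set.Ioi s = Set.Ioi 0 := by ext x; simp
  have hcongr : Set.EqOn (fun x : ℝ => (x + s) ^ j * Real.exp (-c * x ^ 2))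
      ((fun y : ℝ => y ^ j * Real.exp (-c * max (y - s) 0 ^ 2)) ∘ (fun x => x + s))
      (Set.Ioi 0) := by
    intro x hx
    simp only [Function.comp_apply, add_sub_cancel_right, max_eq_left (Set.mem_Ioi.1 hx).le]
  have i2 : IntegrableOn (fun y : ℝ => y ^ j * Real.exp (-c * max (y - s) 0 ^ 2)) (Set.Ioi s) := by
    rw [← hmp.integrableOn_comp_preimage hemb, hpre]
    exact hi.congr_fun hcongr measurableSet_Ioi
  have hcont : Continuous (fun y : ℝ => y ^ j * Real.exp (-c * max (y - s) 0 ^ 2)) := by fun_prop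
  have i1 : IntegrableOn (fun y : ℝ => y ^ j * Real.exp (-c * max (y - s) 0 ^ 2)) (Set.Ioc 0 s) :=
    (hcont.integrableOn_Icc (a := 0) (b := s)).mono_set Set.Ioc_subset_Icc_self
  rw [← Set.Ioc_union_Ioi_eq_Ioi hs]
  refine ⟨i1.union i2, ?_⟩
  rw [setIntegral_union (by
    rw [Set.disjoint_left]; intro x hx hx'; exact absurd hx.2 (not_le.2 hx')) measurableSet_Ioi i1 i2]
  congr 1
  · have : Set.EqOn (fun y : ℝ => y ^ j * Real.exp (-c * max (y - s) 0 ^ 2)) (fun y => y ^ j)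
        (Set.Ioc 0 s) := by
      intro y hy
      simp only [max_eq_right (sub_nonpos.2 hy.2)]
      simp
    rw [setIntegral_congr_fun measurableSet_Ioc this, ← intervalIntegral.integral_of_le hs,
      integral_pow]
    simp
  · rw [Set.Ioc_union_Ioi_eq_Ioi hs, ← hmp.setIntegral_preimage_emb hemb, hpre]
    exact (setIntegral_congr_fun measurableSet_Ioi hcongr).symm

theorem lintegral_flat_gaussian {m : ℕ} [NeZero m] {c s ρ J : ℝ} (hc : 0 < c)
    (hJ0 : ∫ y in Set.Ioi (0 : ℝ), y ^ (m - 1) * Real.exp (-c * y ^ 2) = J)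
    (hi : IntegrableOn (fun y : ℝ => y ^ (m - 1) * Real.exp (-c * max (y - s) 0 ^ 2)) (Set.Ioi 0))
    (hJ : ∫ y in Set.Ioi (0 : ℝ), y ^ (m - 1) * Real.exp (-c * max (y - s) 0 ^ 2) = ρ * J) :
    ∫⁻ y : EuclideanSpace ℝ (Fin m), ENNReal.ofReal (Real.exp (-c * max (‖y‖ - s) 0 ^ 2)) =
      ENNReal.ofReal (ρ * (Real.pi / c) ^ ((m : ℝ) / 2)) := by
  have hnt : Nontrivial (EuclideanSpace ℝ (Fin m)) := by
    rw [← Module.finrank_pos_iff (R := ℝ), finrank_euclideanSpace_fin]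
    exact Nat.pos_of_ne_zero (NeZero.ne m)
  have hI : Integrable (fun y : EuclideanSpace ℝ (Fin m) => Real.exp (-c * max (‖y‖ - s) 0 ^ 2)) := by
    refine (integrable_fun_norm_addHaar (volume : Measure (EuclideanSpace ℝ (Fin m)))
      (f := fun r : ℝ => Real.exp (-c * max (r - s) 0 ^ 2))).2 ?_
    simpa only [finrank_euclideanSpace_fin, smul_eq_mul] using hi
  rw [← ofReal_integral_eq_lintegral_ofReal hI (ae_of_all _ fun t => (Real.exp_pos _).le)]
  congr 1
  have h1 := integral_fun_norm_addHaar (volume : Measure (EuclideanSpace ℝ (Fin m)))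
    (fun r : ℝ => Real.exp (-c * max (r - s) 0 ^ 2))
  have h2 := integral_fun_norm_addHaar (volume : Measure (EuclideanSpace ℝ (Fin m)))
    (fun r : ℝ => Real.exp (-c * r ^ 2))
  have h3 := GaussianFourier.integral_rexp_neg_mul_sq_norm (V := EuclideanSpace ℝ (Fin m)) hc
  simp only [finrank_euclideanSpace_fin, smul_eq_mul] at h1 h2 h3
  rw [h1, hJ, ← h3, h2, hJ0]
  simp only [nsmul_eq_mul]
  ring

/-- Tube bound with the flattened Gaussian as majorant. -/
theorem volume_tube_le_of_moments {m : ℕ} [NeZero m] {P : MvPolynomial (Fin m) ℝ} (hP : P ≠ 0)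
    {k d : ℕ} (hhom : P.IsHomogeneous k) (hk : k ≤ d) {S : Set (EuclideanSpace ℝ (Fin m))}
    (hSP : ∀ x ∈ S, MvPolynomial.eval (fun i => x i) P = 0) {s c ρ J : ℝ} (hc : 0 < c)
    (hρ : 0 ≤ ρ) (hJ0 : ∫ y in Set.Ioi (0 : ℝ), y ^ (m - 1) * Real.exp (-c * y ^ 2) = J)
    (hi : IntegrableOn (fun y : ℝ => y ^ (m - 1) * Real.exp (-c * max (y - s) 0 ^ 2)) (Set.Ioi 0))
    (hJ : ∫ y in Set.Ioi (0 : ℝ), y ^ (m - 1) * Real.exp (-c * max (y - s) 0 ^ 2) = ρ * J)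
    {A : Set (EuclideanSpace ℝ (Fin m))} (hA : Convex ℝ A) (hAo : IsOpen A)
    (hAb : Bornology.IsBounded A) {q : EuclideanSpace ℝ (Fin m)} {r : ℝ} (hr : 0 < r)
    (hball : Metric.ball q r ⊆ A) :
    volume {z ∈ A | ∃ x ∈ S, dist z x < s} ≤
      ENNReal.ofReal (ρ * (d * Real.exp 1 * ((Real.sqrt (Real.pi * c))⁻¹ * (m / r)))) *
        volume A := by
  refine volume_tube_le_of_majorant hP hhom hk hSP hc
    (G := fun y => ENNReal.ofReal (Real.exp (-c * max (‖y‖ - s) 0 ^ 2))) (by fun_prop) hρ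
    (lintegral_flat_gaussian hc hJ0 hi hJ).le ?_ hA hAo hAb hr hball
  intro Y δ hδ
  refine ENNReal.ofReal_le_ofReal (Real.exp_le_exp.2 ?_)
  have h1 : max (‖Y‖ - s) 0 ≤ ‖Y - δ‖ := by
    refine max_le ?_ (norm_nonneg _)
    have := norm_add_le (Y - δ) δ
    rw [sub_add_cancel] at this
    linarith
  have h2 : max (‖Y‖ - s) 0 ^ 2 ≤ ‖Y - δ‖ ^ 2 := by gcongr
  nlinarith

theorem volume_tube_le_two {P : MvPolynomial (Fin 2) ℝ} (hP : P ≠ 0)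
    {k d : ℕ} (hhom : P.IsHomogeneous k) (hk : k ≤ d) {S : Set (EuclideanSpace ℝ (Fin 2))}
    (hSP : ∀ x ∈ S, MvPolynomial.eval (fun i => x i) P = 0) {s : ℝ} (hs : 0 < s)
    {A : Set (EuclideanSpace ℝ (Fin 2))} (hA : Convex ℝ A) (hAo : IsOpen A)
    (hAb : Bornology.IsBounded A) {q : EuclideanSpace ℝ (Fin 2)} {r : ℝ} (hr : 0 < r)
    (hball : Metric.ball q r ⊆ A) :
    volume {z ∈ A | ∃ x ∈ S, dist z x < s} ≤
      ENNReal.ofReal ((3 / 2 + Real.sqrt (Real.pi / 2)) * Real.exp 1 * Real.sqrt (2 / Real.pi) * 2 *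
        (d * s / r)) * volume A := by
  have hc : 0 < 1 / (2 * s ^ 2) := by positivity
  have hg : ∫ x in Set.Ioi (0 : ℝ), Real.exp (-(1 / (2 * s ^ 2)) * x ^ 2) =
      s * Real.sqrt (Real.pi / 2) := by
    rw [integral_gaussian_Ioi]
    have : Real.pi / (1 / (2 * s ^ 2)) = (2 * s) ^ 2 * (Real.pi / 2) := by field_simp
    rw [this, Real.sqrt_mul (by positivity), Real.sqrt_sq (by positivity)]
    ring
  have hg1 : ∫ x in Set.Ioi (0 : ℝ), x * Real.exp (-(1 / (2 * s ^ 2)) * x ^ 2) = s ^ 2 := by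
    rw [integral_Ioi_mul_exp_neg_mul_sq hc]
    field_simp
  have i0 := integrableOn_pow_mul_exp_neg_mul_sq hc 0
  have i1 := integrableOn_pow_mul_exp_neg_mul_sq hc 1
  simp only [pow_zero, one_mul, pow_one] at i0 i1
  have hi : IntegrableOn (fun x : ℝ => (x + s) ^ (2 - 1) * Real.exp (-(1 / (2 * s ^ 2)) * x ^ 2))
      (Set.Ioi 0) := by
    simp only [Nat.add_one_sub_one, pow_one, add_mul]
    exact i1.add (i0.const_mul s)
  obtain ⟨hi', hI⟩ := integral_Ioi_pow_mul_flat_gaussian hs.le (2 - 1) hi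
  have h := volume_tube_le_of_moments hP hhom hk hSP hc
    (ρ := 3 / 2 + Real.sqrt (Real.pi / 2)) (by positivity) (J := s ^ 2)
    (by simpa using hg1) hi' ?_ hA hAo hAb hr hball
  · refine h.trans_eq ?_
    congr 2
    have e : Real.sqrt (Real.pi * (1 / (2 * s ^ 2))) = (Real.sqrt (2 / Real.pi))⁻¹ / s := by
      rw [← Real.sqrt_inv, ← Real.sqrt_sq hs.le, ← Real.sqrt_div (by positivity), Real.sqrt_sq hs.le]
      congr 1
      field_simp
    rw [e]
    push_cast
    field_simp
  · rw [hI]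
    simp only [Nat.add_one_sub_one, pow_one, add_mul]
    rw [integral_add i1 (i0.const_mul s), integral_const_mul, hg, hg1]
    push_cast
    ring

theorem volume_tube_le_three {P : MvPolynomial (Fin 3) ℝ} (hP : P ≠ 0)
    {k d : ℕ} (hhom : P.IsHomogeneous k) (hk : k ≤ d) {S : Set (EuclideanSpace ℝ (Fin 3))}
    (hSP : ∀ x ∈ S, MvPolynomial.eval (fun i => x i) P = 0) {s : ℝ} (hs : 0 < s)
    {A : Set (EuclideanSpace ℝ (Fin 3))} (hA : Convex ℝ A) (hAo : IsOpen A)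
    (hAb : Bornology.IsBounded A) {q : EuclideanSpace ℝ (Fin 3)} {r : ℝ} (hr : 0 < r)
    (hball : Metric.ball q r ⊆ A) :
    volume {z ∈ A | ∃ x ∈ S, dist z x < s} ≤
      ENNReal.ofReal ((2 + 7 / 3 * Real.sqrt (2 / Real.pi)) * Real.exp 1 * Real.sqrt (2 / Real.pi) *
        3 * (d * s / r)) * volume A := by
  have hc : 0 < 1 / (2 * s ^ 2) := by positivity
  have hsq : Real.sqrt (Real.pi / (1 / (2 * s ^ 2))) = 2 * s * Real.sqrt (Real.pi / 2) := by
    have : Real.pi / (1 / (2 * s ^ 2)) = (2 * s) ^ 2 * (Real.pi / 2) := by field_simp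
    rw [this, Real.sqrt_mul (by positivity), Real.sqrt_sq (by positivity)]
  have hg : ∫ x in Set.Ioi (0 : ℝ), Real.exp (-(1 / (2 * s ^ 2)) * x ^ 2) =
      s * Real.sqrt (Real.pi / 2) := by
    rw [integral_gaussian_Ioi, hsq]
    ring
  have hg1 : ∫ x in Set.Ioi (0 : ℝ), x * Real.exp (-(1 / (2 * s ^ 2)) * x ^ 2) = s ^ 2 := by
    rw [integral_Ioi_mul_exp_neg_mul_sq hc]
    field_simp
  have hg2 : ∫ x in Set.Ioi (0 : ℝ), x ^ 2 * Real.exp (-(1 / (2 * s ^ 2)) * x ^ 2) =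
      s ^ 3 * Real.sqrt (Real.pi / 2) := by
    rw [integral_Ioi_sq_mul_exp_neg_mul_sq hc, hsq]
    field_simp
    norm_num
  have i0 := integrableOn_pow_mul_exp_neg_mul_sq hc 0
  have i1 := integrableOn_pow_mul_exp_neg_mul_sq hc 1
  have i2 := integrableOn_pow_mul_exp_neg_mul_sq hc 2
  simp only [pow_zero, one_mul, pow_one] at i0 i1
  have e : ∀ x : ℝ, (x + s) ^ (3 - 1) * Real.exp (-(1 / (2 * s ^ 2)) * x ^ 2) =
      (x ^ 2 * Real.exp (-(1 / (2 * s ^ 2)) * x ^ 2) +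
        2 * s * (x * Real.exp (-(1 / (2 * s ^ 2)) * x ^ 2))) +
        s ^ 2 * Real.exp (-(1 / (2 * s ^ 2)) * x ^ 2) := by
    intro x
    simp only [Nat.add_one_sub_one]
    ring
  have hi : IntegrableOn (fun x : ℝ => (x + s) ^ (3 - 1) * Real.exp (-(1 / (2 * s ^ 2)) * x ^ 2))
      (Set.Ioi 0) := by
    simp only [e]
    exact (i2.add (i1.const_mul (2 * s))).add (i0.const_mul (s ^ 2))
  obtain ⟨hi', hI⟩ := integral_Ioi_pow_mul_flat_gaussian hs.le (3 - 1) hi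
  have h := volume_tube_le_of_moments hP hhom hk hSP hc
    (ρ := 2 + 7 / 3 * Real.sqrt (2 / Real.pi)) (by positivity) (J := s ^ 3 * Real.sqrt (Real.pi / 2))
    (by simpa using hg2) hi' ?_ hA hAo hAb hr hball
  · refine h.trans_eq ?_
    congr 2
    have e : Real.sqrt (Real.pi * (1 / (2 * s ^ 2))) = (Real.sqrt (2 / Real.pi))⁻¹ / s := by
      rw [← Real.sqrt_inv, ← Real.sqrt_sq hs.le, ← Real.sqrt_div (by positivity), Real.sqrt_sq hs.le]
      congr 1
      field_simp
    rw [e]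
    push_cast
    field_simp
  · have i21 : IntegrableOn (fun x : ℝ => x ^ 2 * Real.exp (-(1 / (2 * s ^ 2)) * x ^ 2) +
        2 * s * (x * Real.exp (-(1 / (2 * s ^ 2)) * x ^ 2))) (Set.Ioi 0) :=
      i2.add (i1.const_mul (2 * s))
    have hinv : Real.sqrt (2 / Real.pi) = (Real.sqrt (Real.pi / 2))⁻¹ := by
      rw [← Real.sqrt_inv, inv_div]
    have hne : Real.sqrt (Real.pi / 2) ≠ 0 := by positivity
    rw [hI]
    simp only [e]
    rw [integral_add i21 (i0.const_mul (s ^ 2)), integral_add i2 (i1.const_mul (2 * s)),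
      integral_const_mul, integral_const_mul, hg, hg1, hg2, hinv]
    push_cast
    field_simp
    ring

section BallHomogeneous

variable {X : Type*} [PseudoMetricSpace X] [SecondCountableTopology X] [MeasurableSpace X]
  [BorelSpace X] {μ κ : Measure X} [IsFiniteMeasure μ] [IsFiniteMeasure κ] {T : Set X}

theorem measure_ball_mul_le_thickening (hμT : ∀ᵐ x ∂μ, x ∈ T) (hκT : ∀ᵐ x ∂κ, x ∈ T)
    (hμ : ∀ x ∈ T, ∀ y ∈ T, ∀ r, μ (Metric.ball x r) = μ (Metric.ball y r))
    (hκ : ∀ x ∈ T, ∀ y ∈ T, ∀ r, κ (Metric.ball x r) = κ (Metric.ball y r))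
    {x₀ : X} (hx₀ : x₀ ∈ T) (r : ℝ) (F : Set X) :
    κ (Metric.ball x₀ r) * μ F ≤ μ (Metric.ball x₀ r) * κ (Metric.thickening r F) := by
  have hD : MeasurableSet {p : X × X | dist p.1 p.2 < r} :=
    (isOpen_lt continuous_dist continuous_const).measurableSet
  have h1 : κ (Metric.ball x₀ r) * μ F = ((μ.restrict F).prod κ) {p : X × X | dist p.1 p.2 < r} := by
    rw [Measure.prod_apply hD]
    have : ∀ᵐ x ∂(μ.restrict F), κ (Prod.mk x ⁻¹' {p : X × X | dist p.1 p.2 < r}) =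
        κ (Metric.ball x₀ r) := by
      filter_upwards [ae_restrict_of_ae hμT] with x hx
      rw [← hκ x hx x₀ hx₀ r]
      congr 1
      ext y
      simp [dist_comm]
    rw [lintegral_congr_ae this, lintegral_const, Measure.restrict_apply_univ]
  rw [h1, Measure.prod_apply_symm hD]
  have h2 : ∀ᵐ y ∂κ, (μ.restrict F) ((fun x => (x, y)) ⁻¹' {p : X × X | dist p.1 p.2 < r}) ≤
      (Metric.thickening r F).indicator (fun _ => μ (Metric.ball x₀ r)) y := by
    filter_upwards [hκT] with y hy
    have e : (fun x => (x, y)) ⁻¹' {p : X × X | dist p.1 p.2 < r} = Metric.ball y r := by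
      ext x; simp
    rw [e]
    by_cases hyF : y ∈ Metric.thickening r F
    · rw [Set.indicator_of_mem hyF, ← hμ y hy x₀ hx₀ r]
      exact Measure.restrict_apply_le _ _
    · rw [Set.indicator_of_notMem hyF, Measure.restrict_apply Metric.isOpen_ball.measurableSet]
      refine le_of_eq ?_
      convert measure_empty (μ := μ)
      rw [Set.eq_empty_iff_forall_notMem]
      rintro x ⟨hx, hxF⟩
      exact hyF (Metric.mem_thickening_iff.2 ⟨x, hxF, by rwa [dist_comm]⟩)
  refine (lintegral_mono_ae h2).trans ?_
  rw [lintegral_indicator_const Metric.isOpen_thickening.measurableSet]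

theorem measure_univ_smul_eq_of_measure_ball_eq (hμT : ∀ᵐ x ∂μ, x ∈ T) (hκT : ∀ᵐ x ∂κ, x ∈ T)
    (hμ : ∀ x ∈ T, ∀ y ∈ T, ∀ r, μ (Metric.ball x r) = μ (Metric.ball y r))
    (hκ : ∀ x ∈ T, ∀ y ∈ T, ∀ r, κ (Metric.ball x r) = κ (Metric.ball y r))
    {x₀ : X} (hx₀ : x₀ ∈ T) :
    κ Set.univ • μ = μ Set.univ • κ := by
  have key : ∀ (μ κ : Measure X) [IsFiniteMeasure μ] [IsFiniteMeasure κ],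
      (∀ᵐ x ∂μ, x ∈ T) → (∀ᵐ x ∂κ, x ∈ T) →
      (∀ x ∈ T, ∀ y ∈ T, ∀ r, μ (Metric.ball x r) = μ (Metric.ball y r)) →
      (∀ x ∈ T, ∀ y ∈ T, ∀ r, κ (Metric.ball x r) = κ (Metric.ball y r)) →
      ∀ F, IsClosed F → κ Set.univ * μ F ≤ μ Set.univ * κ F := by
    intro μ κ _ _ hμT hκT hμ hκ F hF
    by_cases hκ0 : κ Set.univ = 0
    · simp [hκ0]
    have hk : ∀ r, 0 < r → κ (Metric.ball x₀ r) ≠ 0 := by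
      intro r hr h0
      refine hκ0 ?_
      have h1 : κ T = 0 := measure_null_of_locally_null T fun x hx =>
        ⟨Metric.ball x r, mem_nhdsWithin_of_mem_nhds (Metric.ball_mem_nhds x hr),
          by rw [hκ x hx x₀ hx₀, h0]⟩
      have h2 : κ Tᶜ = 0 := hκT
      rw [← nonpos_iff_eq_zero, ← Set.union_compl_self T]
      exact (measure_union_le _ _).trans (by simp [h1, h2])
    have hle : ∀ r, 0 < r → κ Set.univ * μ F ≤ μ Set.univ * κ (Metric.thickening r F) := by
      intro r hr
      have hF' := measure_ball_mul_le_thickening hμT hκT hμ hκ hx₀ r F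
      have hu := measure_ball_mul_le_thickening hκT hμT hκ hμ hx₀ r Set.univ
      have hu' := hu.trans (mul_le_mul_of_nonneg_left (measure_mono (Set.subset_univ _)) zero_le)
      have hfin : κ (Metric.ball x₀ r) ≠ ∞ := measure_ne_top _ _
      rw [← ENNReal.mul_le_mul_iff_left (hk r hr) hfin]
      calc κ Set.univ * μ F * κ (Metric.ball x₀ r)
          = κ Set.univ * (κ (Metric.ball x₀ r) * μ F) := by ring
        _ ≤ κ Set.univ * (μ (Metric.ball x₀ r) * κ (Metric.thickening r F)) := by gcongr
        _ = μ (Metric.ball x₀ r) * κ Set.univ * κ (Metric.thickening r F) := by ring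
        _ ≤ κ (Metric.ball x₀ r) * μ Set.univ * κ (Metric.thickening r F) := by gcongr
        _ = _ := by ring
    have ht : Tendsto (fun r => μ Set.univ * κ (Metric.thickening r F))
        (nhdsWithin 0 (Set.Ioi 0)) (nhds (μ Set.univ * κ F)) :=
      ENNReal.Tendsto.const_mul (tendsto_measure_thickening_of_isClosed
        ⟨1, one_pos, measure_ne_top _ _⟩ hF) (Or.inr (measure_ne_top _ _))
    refine ge_of_tendsto ht ?_
    filter_upwards [self_mem_nhdsWithin] with r hr using hle r hr
  have hfin : IsFiniteMeasure (κ Set.univ • μ) := μ.smul_finite (measure_ne_top κ _)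
  refine ext_of_generate_finite {F | IsClosed F} ?_ isPiSystem_isClosed ?_ ?_
  · rw [← borel_eq_generateFrom_isClosed]
    exact BorelSpace.measurable_eq
  · intro F hF
    exact le_antisymm (key μ κ hμT hκT hμ hκ F hF) (key κ μ hκT hμT hκ hμ F hF)
  · simp [mul_comm]

end BallHomogeneous

/-- The image of the Lebesgue measure of the unit ball under the radial projection to the sphere. -/
noncomputable def coneMeasure (n : ℕ) : Measure (EuclideanSpace ℝ (Fin (n + 1))) :=
  (volume.restrict (Metric.ball 0 1)).map fun x => ‖x‖⁻¹ • x

theorem measurable_norm_inv_smul {E : Type*} [NormedAddCommGroup E] [NormedSpace ℝ E]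
    [MeasurableSpace E] [BorelSpace E] [SecondCountableTopology E] :
    Measurable fun x : E => ‖x‖⁻¹ • x :=
  measurable_norm.inv.smul measurable_id

instance (n : ℕ) : IsFiniteMeasure (coneMeasure n) := by
  have : IsFiniteMeasure ((volume : Measure (EuclideanSpace ℝ (Fin (n + 1)))).restrict
      (Metric.ball 0 1)) := ⟨by
    rw [Measure.restrict_apply_univ]; exact measure_ball_lt_top⟩
  unfold coneMeasure
  infer_instance

theorem coneMeasure_apply {n : ℕ} {B : Set (EuclideanSpace ℝ (Fin (n + 1)))}
    (hB : MeasurableSet B) :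
    coneMeasure n B = volume {x : EuclideanSpace ℝ (Fin (n + 1)) | ‖x‖⁻¹ • x ∈ B ∧ ‖x‖ < 1} := by
  rw [coneMeasure, Measure.map_apply measurable_norm_inv_smul hB,
    Measure.restrict_apply (measurable_norm_inv_smul hB)]
  congr 1
  ext x
  simp

theorem ae_coneMeasure_mem_sphere (n : ℕ) :
    ∀ᵐ x ∂coneMeasure n, x ∈ Metric.sphere (0 : EuclideanSpace ℝ (Fin (n + 1))) 1 := by
  refine (ae_map_iff (p := fun x => x ∈ Metric.sphere (0 : EuclideanSpace ℝ (Fin (n + 1))) 1)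
    measurable_norm_inv_smul.aemeasurable Metric.isClosed_sphere.measurableSet).2
    (ae_restrict_of_ae ?_)
  filter_upwards [Measure.ae_ne volume (0 : EuclideanSpace ℝ (Fin (n + 1)))] with x hx
  simp [norm_smul, hx]

theorem coneMeasure_map {n : ℕ}
    (L : EuclideanSpace ℝ (Fin (n + 1)) ≃ₗᵢ[ℝ] EuclideanSpace ℝ (Fin (n + 1))) :
    (coneMeasure n).map L = coneMeasure n := by
  have hpre : L ⁻¹' Metric.ball 0 1 = Metric.ball 0 1 := by
    ext x; simp
  have h1 := (L.measurePreserving.restrict_preimage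
    (Metric.isOpen_ball (x := (0 : EuclideanSpace ℝ (Fin (n + 1)))) (ε := 1)).measurableSet).map_eq
  rw [hpre] at h1
  rw [coneMeasure, Measure.map_map L.continuous.measurable measurable_norm_inv_smul]
  conv_rhs => rw [← h1, Measure.map_map measurable_norm_inv_smul L.continuous.measurable]
  congr 1
  ext1 x
  simp

theorem measure_ball_eq_of_map_eq {E : Type*} [NormedAddCommGroup E] [InnerProductSpace ℝ E]
    [MeasurableSpace E] [BorelSpace E] {μ : Measure E} (hμ : ∀ L : E ≃ₗᵢ[ℝ] E, μ.map L = μ)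
    {x y : E} (hxy : ‖x‖ = ‖y‖) (r : ℝ) : μ (Metric.ball x r) = μ (Metric.ball y r) := by
  let L := (Submodule.span ℝ {x - y})ᗮ.reflection
  have hL : L x = y := Submodule.reflection_sub hxy
  conv_rhs => rw [← hμ L, Measure.map_apply L.continuous.measurable measurableSet_ball]
  congr 1
  ext z
  simp [← hL]

theorem hausdorffMeasure_restrict_sphere_map {n : ℕ} (s : ℝ)
    (L : EuclideanSpace ℝ (Fin (n + 1)) ≃ₗᵢ[ℝ] EuclideanSpace ℝ (Fin (n + 1))) :
    ((μH[s]).restrict (Metric.sphere (0 : EuclideanSpace ℝ (Fin (n + 1))) 1)).map L =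
      (μH[s]).restrict (Metric.sphere 0 1) := by
  have hpre : L ⁻¹' Metric.sphere 0 1 = Metric.sphere 0 1 := by
    ext x; simp
  have h1 := (L.toIsometryEquiv.measurePreserving_hausdorffMeasure s).restrict_preimage
    (Metric.isClosed_sphere (x := (0 : EuclideanSpace ℝ (Fin (n + 1)))) (ε := 1)).measurableSet
  have h2 := h1.map_eq
  simp only [LinearIsometryEquiv.coe_toIsometryEquiv] at h2
  rwa [hpre] at h2

theorem isOpen_setOf_lt_inner {n : ℕ} (a : EuclideanSpace ℝ (Fin (n + 1))) (c : ℝ) :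
    IsOpen {z : EuclideanSpace ℝ (Fin (n + 1)) | c < ⟪z, a⟫} :=
  isOpen_lt continuous_const (by fun_prop)

theorem measurableSet_cap (n : ℕ) (a : EuclideanSpace ℝ (Fin (n + 1))) (ρ : ℝ) :
    MeasurableSet (cap n a ρ) :=
  Metric.isClosed_sphere.measurableSet.inter (isOpen_setOf_lt_inner a _).measurableSet

theorem cap_subset_sphere (n : ℕ) (a : EuclideanSpace ℝ (Fin (n + 1))) (ρ : ℝ) :
    cap n a ρ ⊆ Metric.sphere 0 1 := fun _ hz => hz.1

theorem mem_cap_self {n : ℕ} {a : EuclideanSpace ℝ (Fin (n + 1))} (ha : ‖a‖ = 1) {ρ : ℝ}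
    (hρ : 0 < ρ) : a ∈ cap n a ρ := by
  refine ⟨by simpa using ha, ?_⟩
  rw [real_inner_self_eq_norm_sq, ha, one_pow, Real.sqrt_lt' one_pos]
  nlinarith

theorem hausdorffMeasure_sphere_lt_top {n : ℕ} {a : EuclideanSpace ℝ (Fin (n + 1))}
    (ha : ‖a‖ = 1) {ρ s : ℝ} (hρ : 0 < ρ) (h : μH[s] (cap n a ρ) ≠ ∞) :
    μH[s] (Metric.sphere (0 : EuclideanSpace ℝ (Fin (n + 1))) 1) < ∞ := by
  refine (isCompact_sphere _ _).measure_lt_top_of_nhdsWithin fun x hx => ?_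
  have hx1 : ‖x‖ = 1 := by simpa using hx
  let L := (Submodule.span ℝ {x - a})ᗮ.reflection
  have hL : L x = a := Submodule.reflection_sub (hx1.trans ha.symm)
  refine ⟨L ⁻¹' cap n a ρ, ?_, ?_⟩
  · have h1 : L ⁻¹' {z | Real.sqrt (1 - ρ ^ 2) < ⟪z, a⟫} ∈ nhds x :=
      ((isOpen_setOf_lt_inner a _).preimage L.continuous).mem_nhds (by
        rw [Set.mem_preimage, hL]; exact (mem_cap_self ha hρ).2)
    filter_upwards [mem_nhdsWithin_of_mem_nhds h1, self_mem_nhdsWithin] with z hz hz1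
    exact ⟨by simpa using hz1, hz⟩
  · have h2 := (L.toIsometryEquiv.measurePreserving_hausdorffMeasure s).measure_preimage
      (measurableSet_cap n a ρ).nullMeasurableSet
    simp only [LinearIsometryEquiv.coe_toIsometryEquiv] at h2
    rw [h2]
    exact h.lt_top

/-- The normalised Hausdorff measure on a cap is the normalised cone measure, except in the
degenerate cases in which it vanishes. -/
theorem nuMeasure_eq_zero_or {n : ℕ} {a : EuclideanSpace ℝ (Fin (n + 1))} (ha : ‖a‖ = 1) {ρ : ℝ}
    (hρ : 0 < ρ) :
    nuMeasure n a ρ = 0 ∨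
      nuMeasure n a ρ = (coneMeasure n (cap n a ρ))⁻¹ • (coneMeasure n).restrict (cap n a ρ) := by
  by_cases h0 : μH[(n : ℝ)] (cap n a ρ) = 0
  · left
    rw [nuMeasure, Measure.restrict_eq_zero.2 h0, smul_zero]
  by_cases ht : μH[(n : ℝ)] (cap n a ρ) = ∞
  · left
    rw [nuMeasure, ht, ENNReal.inv_top, zero_smul]
  right
  let μ := (μH[(n : ℝ)]).restrict (Metric.sphere (0 : EuclideanSpace ℝ (Fin (n + 1))) 1)
  have hfin : IsFiniteMeasure μ := ⟨by
    rw [Measure.restrict_apply_univ]; exact hausdorffMeasure_sphere_lt_top ha hρ ht⟩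
  have hsph : ∀ x ∈ Metric.sphere (0 : EuclideanSpace ℝ (Fin (n + 1))) 1, ‖x‖ = 1 := by simp
  have key : coneMeasure n Set.univ • μ = μ Set.univ • coneMeasure n :=
    measure_univ_smul_eq_of_measure_ball_eq (T := Metric.sphere 0 1)
      (ae_restrict_mem Metric.isClosed_sphere.measurableSet) (ae_coneMeasure_mem_sphere n)
      (fun x hx y hy r => measure_ball_eq_of_map_eq
        (fun L => hausdorffMeasure_restrict_sphere_map _ L) ((hsph x hx).trans (hsph y hy).symm) r)
      (fun x hx y hy r => measure_ball_eq_of_map_eq coneMeasure_map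
        ((hsph x hx).trans (hsph y hy).symm) r) (x₀ := a) (by simpa using ha)
  have hcone : coneMeasure n Set.univ ≠ 0 := by
    rw [coneMeasure_apply MeasurableSet.univ]
    have e : {x : EuclideanSpace ℝ (Fin (n + 1)) | ‖x‖⁻¹ • x ∈ Set.univ ∧ ‖x‖ < 1} =
        Metric.ball 0 1 := by
      ext x; simp
    rw [e]
    exact (Metric.measure_ball_pos volume _ one_pos).ne'
  have hconet : coneMeasure n Set.univ ≠ ∞ := measure_ne_top _ _
  have hμcap : ∀ B ⊆ cap n a ρ, μ B = μH[(n : ℝ)] B := fun B hB =>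
    Measure.restrict_eq_self _ (hB.trans (cap_subset_sphere n a ρ))
  have hμ0 : μ Set.univ ≠ 0 := by
    intro h
    refine h0 ?_
    rw [← hμcap _ subset_rfl]
    exact measure_mono_null (Set.subset_univ _) h
  have hμt : μ Set.univ ≠ ∞ := measure_ne_top _ _
  have hμe : μ = (μ Set.univ / coneMeasure n Set.univ) • coneMeasure n := by
    have := congrArg ((coneMeasure n Set.univ)⁻¹ • ·) key
    simp only [smul_smul, ENNReal.inv_mul_cancel hcone hconet, one_smul] at this
    rw [div_eq_mul_inv, mul_comm]
    exact this
  have hc0 : μ Set.univ / coneMeasure n Set.univ ≠ 0 := ENNReal.div_ne_zero.2 ⟨hμ0, hconet⟩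
  have hct : μ Set.univ / coneMeasure n Set.univ ≠ ∞ := ENNReal.div_ne_top hμt hcone
  have hr : (μH[(n : ℝ)]).restrict (cap n a ρ) = μ.restrict (cap n a ρ) := by
    rw [Measure.restrict_restrict (measurableSet_cap n a ρ),
      Set.inter_eq_left.2 (cap_subset_sphere n a ρ)]
  rw [nuMeasure, hr, ← hμcap _ subset_rfl, hμe, Measure.restrict_smul, Measure.smul_apply,
    smul_eq_mul, smul_smul, ENNReal.mul_inv (Or.inl hc0) (Or.inl hct)]
  congr 1
  rw [mul_comm, ← mul_assoc, ENNReal.mul_inv_cancel hc0 hct, one_mul]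

theorem lintegral_fun_norm {V : Type*} [NormedAddCommGroup V] [NormedSpace ℝ V]
    [MeasurableSpace V] [BorelSpace V] [FiniteDimensional ℝ V] [Nontrivial V] (μ : Measure V)
    [μ.IsAddHaarMeasure] {f : ℝ → ℝ≥0∞} (hf : Measurable f) :
    ∫⁻ x, f ‖x‖ ∂μ = μ.toSphere Set.univ *
      ∫⁻ r in Set.Ioi (0 : ℝ), ENNReal.ofReal (r ^ (Module.finrank ℝ V - 1)) * f r := by
  calc ∫⁻ x, f ‖x‖ ∂μ = ∫⁻ x : ({(0)}ᶜ : Set V), f ‖x.1‖ ∂(μ.comap (↑)) := by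
        rw [lintegral_subtype_comap (measurableSet_singleton _).compl fun x => f ‖x‖,
          restrict_compl_singleton]
    _ = ∫⁻ x, f x.2 ∂μ.toSphere.prod (.volumeIoiPow (Module.finrank ℝ V - 1)) := by
        simpa using μ.measurePreserving_homeomorphUnitSphereProd.lintegral_comp_emb
          (Homeomorph.measurableEmbedding _) (f ∘ Subtype.val ∘ Prod.snd)
    _ = μ.toSphere Set.univ * ∫⁻ x : Set.Ioi (0 : ℝ), f x ∂.volumeIoiPow (Module.finrank ℝ V - 1) := by
        have := lintegral_prod_mul (μ := μ.toSphere)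
          (ν := .volumeIoiPow (Module.finrank ℝ V - 1)) (f := fun _ => 1)
          (g := fun x : Set.Ioi (0 : ℝ) => f x) (by fun_prop) (by fun_prop)
        simpa using this
    _ = _ := by
        rw [Measure.volumeIoiPow, lintegral_withDensity_eq_lintegral_mul _ (by fun_prop) (by fun_prop)]
        exact congrArg _ (lintegral_subtype_comap measurableSet_Ioi
          fun r => ENNReal.ofReal (r ^ (Module.finrank ℝ V - 1)) * f r)

theorem lintegral_Ioi_comp_div_sqrt {b : ℝ} (hb : 0 < b) (ψ : ℝ → ℝ≥0∞) :
    ∫⁻ t in Set.Ioi (0 : ℝ), ψ (b / Real.sqrt (t ^ 2 + b ^ 2)) =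
      ∫⁻ r in Set.Ioo (0 : ℝ) 1, ENNReal.ofReal (b / (r ^ 2 * Real.sqrt (1 - r ^ 2))) * ψ r := by
  have hinv : ∀ r ∈ Set.Ioo (0 : ℝ) 1,
      b / Real.sqrt ((b * (Real.sqrt (1 - r ^ 2) * r⁻¹)) ^ 2 + b ^ 2) = r := by
    intro r hr
    have h1 : 0 < 1 - r ^ 2 := by nlinarith [hr.1, hr.2]
    have h2 : (b * (Real.sqrt (1 - r ^ 2) * r⁻¹)) ^ 2 + b ^ 2 = (b / r) ^ 2 := by
      rw [mul_pow, mul_pow, Real.sq_sqrt h1.le]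
      have := hr.1.ne'
      field_simp
      ring
    rw [h2, Real.sqrt_sq (div_nonneg hb.le hr.1.le), div_div_cancel₀ hb.ne']
  have himg : (fun r : ℝ => b * (Real.sqrt (1 - r ^ 2) * r⁻¹)) '' Set.Ioo 0 1 = Set.Ioi 0 := by
    ext t
    constructor
    · rintro ⟨r, hr, rfl⟩
      have h1 : 0 < 1 - r ^ 2 := by nlinarith [hr.1, hr.2]
      exact mul_pos hb (mul_pos (Real.sqrt_pos.2 h1) (inv_pos.2 hr.1))
    · intro ht
      have ht' : 0 < t := ht
      have hpos : 0 < t ^ 2 + b ^ 2 := by positivity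
      have hsq := Real.sq_sqrt hpos.le
      have hs := Real.sqrt_pos.2 hpos
      refine ⟨b / Real.sqrt (t ^ 2 + b ^ 2), ⟨by positivity, ?_⟩, ?_⟩
      · rw [div_lt_one hs, Real.lt_sqrt hb.le]
        nlinarith
      · have e : 1 - (b / Real.sqrt (t ^ 2 + b ^ 2)) ^ 2 = (t / Real.sqrt (t ^ 2 + b ^ 2)) ^ 2 := by
          rw [div_pow, div_pow, hsq]
          field_simp
          ring
        simp only [e]
        rw [Real.sqrt_sq (by positivity)]
        field_simp
  have hderiv : ∀ r ∈ Set.Ioo (0 : ℝ) 1,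
      HasDerivWithinAt (fun r : ℝ => b * (Real.sqrt (1 - r ^ 2) * r⁻¹))
        (-(b / (r ^ 2 * Real.sqrt (1 - r ^ 2)))) (Set.Ioo 0 1) r := by
    intro r hr
    have h1 : 0 < 1 - r ^ 2 := by nlinarith [hr.1, hr.2]
    have hs := Real.sqrt_pos.2 h1
    have hr0 := hr.1.ne'
    have h2 : HasDerivAt (fun r : ℝ => 1 - r ^ 2) (-(2 * r)) r := by
      simpa using (hasDerivAt_pow 2 r).const_sub 1
    have h3 := ((h2.sqrt h1.ne').fun_mul (hasDerivAt_inv hr0)).const_mul b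
    refine (h3.congr_deriv ?_).hasDerivWithinAt
    have hsq := Real.sq_sqrt h1.le
    field_simp
    rw [hsq]
    ring
  rw [← himg, lintegral_image_eq_lintegral_abs_deriv_mul measurableSet_Ioo hderiv ?_]
  · refine setLIntegral_congr_fun measurableSet_Ioo fun r hr => ?_
    simp only [hinv r hr]
    rw [abs_neg, abs_of_nonneg (div_nonneg hb.le (mul_nonneg (sq_nonneg r) (Real.sqrt_nonneg _)))]
  · intro r hr r' hr' h
    simp only at h
    rw [← hinv r hr, h, hinv r' hr']

theorem exists_linearIsometryEquiv_prod {n : ℕ} {a : EuclideanSpace ℝ (Fin (n + 1))}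
    (ha : ‖a‖ = 1) :
    ∃ Φ : WithLp 2 (ℝ × EuclideanSpace ℝ (Fin n)) ≃ₗᵢ[ℝ] EuclideanSpace ℝ (Fin (n + 1)),
      Φ (WithLp.toLp 2 (1, 0)) = a := by
  have hfr : Module.finrank ℝ (WithLp 2 (ℝ × EuclideanSpace ℝ (Fin n))) = n + 1 := by
    rw [(WithLp.linearEquiv 2 ℝ (ℝ × EuclideanSpace ℝ (Fin n))).finrank_eq]
    simp [add_comm]
  let Ψ : WithLp 2 (ℝ × EuclideanSpace ℝ (Fin n)) ≃ₗᵢ[ℝ] EuclideanSpace ℝ (Fin (n + 1)) :=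
    ((stdOrthonormalBasis ℝ _).reindex (finCongr hfr)).repr
  have hn : ‖Ψ (WithLp.toLp 2 (1, 0))‖ = ‖a‖ := by
    rw [Ψ.norm_map, ha, WithLp.prod_norm_eq_of_L2]
    simp
  exact ⟨Ψ.trans ((Submodule.span ℝ {Ψ (WithLp.toLp 2 (1, 0)) - a})ᗮ.reflection),
    Submodule.reflection_sub hn⟩

theorem lintegral_eq_lintegral_prod {n : ℕ} {a : EuclideanSpace ℝ (Fin (n + 1))} (ha : ‖a‖ = 1)
    {F : ℝ → ℝ → ℝ≥0∞} (hF : Measurable (Function.uncurry F)) :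
    ∫⁻ x : EuclideanSpace ℝ (Fin (n + 1)), F ⟪x, a⟫ (‖x‖ ^ 2) =
      ∫⁻ y : EuclideanSpace ℝ (Fin n), ∫⁻ t : ℝ, F t (t ^ 2 + ‖y‖ ^ 2) := by
  obtain ⟨Φ, hΦ⟩ := exists_linearIsometryEquiv_prod ha
  have hm : Measurable fun x : EuclideanSpace ℝ (Fin (n + 1)) => F ⟪x, a⟫ (‖x‖ ^ 2) :=
    hF.comp (f := fun x : EuclideanSpace ℝ (Fin (n + 1)) => (⟪x, a⟫, ‖x‖ ^ 2)) (by fun_prop)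
  have hm2 : Measurable fun p : ℝ × EuclideanSpace ℝ (Fin n) => F p.1 (p.1 ^ 2 + ‖p.2‖ ^ 2) :=
    hF.comp (f := fun p : ℝ × EuclideanSpace ℝ (Fin n) => (p.1, p.1 ^ 2 + ‖p.2‖ ^ 2)) (by fun_prop)
  have hmΦ : Measurable fun w => F ⟪Φ w, a⟫ (‖Φ w‖ ^ 2) := hm.comp Φ.continuous.measurable
  rw [← Φ.measurePreserving.lintegral_comp hm,
    ← (WithLp.volume_preserving_toLp (U := ℝ) (V := EuclideanSpace ℝ (Fin n))).lintegral_comp hmΦ]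
  have e : ∀ p : ℝ × EuclideanSpace ℝ (Fin n),
      F ⟪Φ (WithLp.toLp 2 p), a⟫ (‖Φ (WithLp.toLp 2 p)‖ ^ 2) = F p.1 (p.1 ^ 2 + ‖p.2‖ ^ 2) := by
    intro p
    rw [← hΦ, Φ.inner_map_map, Φ.norm_map, WithLp.prod_norm_sq_eq_of_L2, WithLp.prod_inner_apply]
    simp
  simp only [e]
  exact lintegral_prod_symm' _ hm2

theorem lintegral_coneMeasure_hemisphere {n : ℕ} {a : EuclideanSpace ℝ (Fin (n + 1))}
    {φ : ℝ → ℝ≥0∞} (hφ : Measurable φ) :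
    ∫⁻ z in {z | 0 < ⟪z, a⟫}, φ (Real.sqrt (1 - ⟪z, a⟫ ^ 2)) ∂coneMeasure n =
      ∫⁻ x : EuclideanSpace ℝ (Fin (n + 1)), {p : ℝ × ℝ | 0 < p.1 ∧ p.2 < 1}.indicator
        (fun p => φ (Real.sqrt (1 - p.1 ^ 2 / p.2))) (⟪x, a⟫, ‖x‖ ^ 2) := by
  have hS : MeasurableSet {z : EuclideanSpace ℝ (Fin (n + 1)) | 0 < ⟪z, a⟫} :=
    (isOpen_setOf_lt_inner a 0).measurableSet
  have hm : Measurable fun z : EuclideanSpace ℝ (Fin (n + 1)) => φ (Real.sqrt (1 - ⟪z, a⟫ ^ 2)) :=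
    hφ.comp (f := fun z : EuclideanSpace ℝ (Fin (n + 1)) => Real.sqrt (1 - ⟪z, a⟫ ^ 2)) (by fun_prop)
  rw [← lintegral_indicator hS, coneMeasure, lintegral_map (hm.indicator hS) measurable_norm_inv_smul,
    ← lintegral_indicator measurableSet_ball]
  refine lintegral_congr fun x => ?_
  by_cases hx : x = 0
  · subst hx; simp [Set.indicator]
  have hx0 : 0 < ‖x‖ := norm_pos_iff.2 hx
  have h1 : (‖x‖ ^ 2 < 1) ↔ ‖x‖ < 1 := by
    rw [sq_lt_one_iff_abs_lt_one, abs_of_pos hx0]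
  have h2 : (0 < ⟪‖x‖⁻¹ • x, a⟫) ↔ 0 < ⟪x, a⟫ := by
    rw [real_inner_smul_left, mul_pos_iff_of_pos_left (inv_pos.2 hx0)]
  have h3 : ⟪‖x‖⁻¹ • x, a⟫ ^ 2 = ⟪x, a⟫ ^ 2 / ‖x‖ ^ 2 := by
    rw [real_inner_smul_left, mul_pow, inv_pow]; ring
  simp only [Set.indicator, Metric.mem_ball, dist_zero_right, Set.mem_ofPred_eq, h1, h2, h3]
  by_cases ha : 0 < ⟪x, a⟫ <;> by_cases hb : ‖x‖ < 1 <;> simp [ha, hb]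

theorem exists_lintegral_coneMeasure_eq {n : ℕ} (hn : 1 ≤ n) {a : EuclideanSpace ℝ (Fin (n + 1))}
    (ha : ‖a‖ = 1) :
    ∃ K : ℝ≥0∞, K ≠ 0 ∧ K ≠ ∞ ∧ ∀ φ : ℝ → ℝ≥0∞, Measurable φ →
      ∫⁻ z in {z | 0 < ⟪z, a⟫}, φ (Real.sqrt (1 - ⟪z, a⟫ ^ 2)) ∂coneMeasure n =
        K * ∫⁻ r in Set.Ioo (0 : ℝ) 1, ENNReal.ofReal (r ^ (n - 1) / Real.sqrt (1 - r ^ 2)) * φ r := by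
  have hnt : Nontrivial (EuclideanSpace ℝ (Fin n)) := by
    rw [← Module.finrank_pos_iff (R := ℝ), finrank_euclideanSpace_fin]
    exact hn
  have hc0 : (volume : Measure (EuclideanSpace ℝ (Fin n))).toSphere Set.univ ≠ 0 := by
    rw [Ne, Measure.measure_univ_eq_zero]
    exact Measure.toSphere_ne_zero _
  have hn1 : (0 : ℝ) < 1 / (n + 1) := by positivity
  refine ⟨(volume : Measure (EuclideanSpace ℝ (Fin n))).toSphere Set.univ *
    ENNReal.ofReal (1 / (n + 1)), mul_ne_zero hc0 (by simpa using hn1),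
    ENNReal.mul_ne_top (measure_ne_top _ _) ENNReal.ofReal_ne_top, fun φ hφ => ?_⟩
  have hU : MeasurableSet {p : ℝ × ℝ | 0 < p.1 ∧ p.2 < 1} :=
    (measurableSet_lt measurable_const measurable_fst).inter
      (measurableSet_lt measurable_snd measurable_const)
  let F : ℝ × ℝ → ℝ≥0∞ := {p : ℝ × ℝ | 0 < p.1 ∧ p.2 < 1}.indicator
        (fun p => φ (Real.sqrt (1 - p.1 ^ 2 / p.2)))
  have hF : Measurable F :=
    (hφ.comp (f := fun p : ℝ × ℝ => Real.sqrt (1 - p.1 ^ 2 / p.2)) (by fun_prop)).indicator hU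
  rw [lintegral_coneMeasure_hemisphere hφ]
  have h1 := lintegral_eq_lintegral_prod (n := n) ha (F := fun t q => F (t, q)) hF
  refine h1.trans ?_
  have hf : Measurable fun b : ℝ => ∫⁻ t : ℝ, F (t, t ^ 2 + b ^ 2) :=
    Measurable.lintegral_prod_right' (f := fun p : ℝ × ℝ => F (p.2, p.2 ^ 2 + p.1 ^ 2))
      (hF.comp (f := fun p : ℝ × ℝ => (p.2, p.2 ^ 2 + p.1 ^ 2)) (by fun_prop))
  rw [lintegral_fun_norm volume hf, finrank_euclideanSpace_fin, mul_assoc]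
  congr 1
  have h2 : ∀ b ∈ Set.Ioi (0 : ℝ), ENNReal.ofReal (b ^ (n - 1)) * ∫⁻ t : ℝ, F (t, t ^ 2 + b ^ 2) =
      ∫⁻ r in Set.Ioo (0 : ℝ) 1, ENNReal.ofReal (1 / (r ^ 2 * Real.sqrt (1 - r ^ 2))) * φ r *
        (Set.Ioo 0 r).indicator (fun b => ENNReal.ofReal (b ^ n)) b := by
    intro b hb
    have hb' : 0 < b := hb
    have h3 : ∫⁻ t : ℝ, F (t, t ^ 2 + b ^ 2) =
        ∫⁻ t in Set.Ioi (0 : ℝ), (Set.Ioi b).indicator φ (b / Real.sqrt (t ^ 2 + b ^ 2)) := by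
      rw [← lintegral_indicator measurableSet_Ioi]
      refine lintegral_congr fun t => ?_
      by_cases ht : 0 < t
      · rw [Set.indicator_of_mem (Set.mem_Ioi.2 ht)]
        have hq : 0 < t ^ 2 + b ^ 2 := by positivity
        have hs := Real.sqrt_pos.2 hq
        have e1 : Real.sqrt (1 - t ^ 2 / (t ^ 2 + b ^ 2)) = b / Real.sqrt (t ^ 2 + b ^ 2) := by
          have : 1 - t ^ 2 / (t ^ 2 + b ^ 2) = b ^ 2 / (t ^ 2 + b ^ 2) := by
            field_simp
            ring
          rw [this, Real.sqrt_div (sq_nonneg b), Real.sqrt_sq hb'.le]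
        have e2 : b < b / Real.sqrt (t ^ 2 + b ^ 2) ↔ t ^ 2 + b ^ 2 < 1 := by
          rw [lt_div_iff₀ hs, mul_lt_iff_lt_one_right hb', Real.sqrt_lt' one_pos, one_pow]
        simp only [F, Set.indicator, Set.mem_ofPred_eq, Set.mem_Ioi, e1, e2, ht, true_and]
      · rw [Set.indicator_of_notMem (by simpa using ht)]
        simp [F, ht]
    rw [h3, lintegral_Ioi_comp_div_sqrt hb', ← lintegral_const_mul' _ _ ENNReal.ofReal_ne_top]
    refine setLIntegral_congr_fun measurableSet_Ioo fun r hr => ?_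
    by_cases hbr : b < r
    · simp only [Set.indicator, Set.mem_Ioi, hbr, Set.mem_Ioo, hb', and_self, if_true]
      have e : b ^ n = b ^ (n - 1) * b := by rw [← pow_succ, Nat.sub_add_cancel hn]
      rw [e, ENNReal.ofReal_mul (by positivity), div_eq_mul_one_div, ENNReal.ofReal_mul hb'.le]
      ring
    · simp [Set.indicator, hbr]
  rw [setLIntegral_congr_fun measurableSet_Ioi h2, lintegral_lintegral_swap, ←
    lintegral_const_mul' _ _ ENNReal.ofReal_ne_top]
  · refine setLIntegral_congr_fun measurableSet_Ioo fun r hr => ?_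
    have hr0 : 0 < r := hr.1
    have h4 : ∫⁻ b in Set.Ioi (0 : ℝ), (Set.Ioo 0 r).indicator (fun b => ENNReal.ofReal (b ^ n)) b =
        ENNReal.ofReal (1 / (n + 1)) * ENNReal.ofReal (r ^ (n + 1)) := by
      rw [setLIntegral_indicator measurableSet_Ioo, Set.inter_eq_left.2 Set.Ioo_subset_Ioi_self,
        ← Measure.restrict_congr_set Ioo_ae_eq_Ioc.symm]
      rw [← ofReal_integral_eq_lintegral_ofReal, ← intervalIntegral.integral_of_le hr0.le,
        integral_pow, ← ENNReal.ofReal_mul hn1.le]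
      · congr 1
        simp
        ring
      · exact ((continuous_pow n).integrableOn_Icc).mono_set Set.Ioc_subset_Icc_self
      · filter_upwards [ae_restrict_mem measurableSet_Ioc] with b hb using pow_nonneg hb.1.le n
    rw [lintegral_const_mul _ (by measurability), h4]
    have e : r ^ (n - 1) / Real.sqrt (1 - r ^ 2) =
        1 / (r ^ 2 * Real.sqrt (1 - r ^ 2)) * r ^ (n + 1) := by
      have : r ^ (n + 1) = r ^ (n - 1) * r ^ 2 := by rw [← pow_add]; congr 1; omega
      rw [this]
      field_simp
    rw [e, ENNReal.ofReal_mul (by positivity)]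
    ring
  · refine Measurable.aemeasurable ?_
    have hI : MeasurableSet {p : ℝ × ℝ | p.1 ∈ Set.Ioo 0 p.2} :=
      (measurableSet_lt measurable_const measurable_fst).inter
        (measurableSet_lt measurable_fst measurable_snd)
    have hg : Measurable ({p : ℝ × ℝ | p.1 ∈ Set.Ioo 0 p.2}.indicator
        fun p : ℝ × ℝ => ENNReal.ofReal (p.1 ^ n)) :=
      Measurable.indicator (by fun_prop) hI
    refine Measurable.mul ?_ hg
    exact Measurable.mul (by fun_prop) (hφ.comp measurable_snd)

theorem sqrt_one_sub_lt_iff {x ρ : ℝ} (hρ : 0 < ρ) :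
    Real.sqrt (1 - ρ ^ 2) < x ↔ 0 < x ∧ Real.sqrt (1 - x ^ 2) < ρ := by
  constructor
  · intro h
    have hx := (Real.sqrt_nonneg _).trans_lt h
    refine ⟨hx, ?_⟩
    rw [Real.sqrt_lt' hx] at h
    rw [Real.sqrt_lt' hρ]
    linarith
  · rintro ⟨hx, h⟩
    rw [Real.sqrt_lt' hρ] at h
    rw [Real.sqrt_lt' hx]
    linarith

/-- Law of the distance to the axis under the cone measure on caps. -/
theorem exists_lintegral_coneMeasure_cap {n : ℕ} (hn : 1 ≤ n)
    {a : EuclideanSpace ℝ (Fin (n + 1))} (ha : ‖a‖ = 1) :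
    ∃ K : ℝ≥0∞, K ≠ 0 ∧ K ≠ ∞ ∧ ∀ ρ ∈ Set.Ioc (0 : ℝ) 1, ∀ φ : ℝ → ℝ≥0∞, Measurable φ →
      ∫⁻ z in cap n a ρ, φ (Real.sqrt (1 - ⟪z, a⟫ ^ 2)) ∂coneMeasure n =
        K * ∫⁻ r in Set.Ioo (0 : ℝ) ρ, ENNReal.ofReal (r ^ (n - 1) / Real.sqrt (1 - r ^ 2)) * φ r := by
  obtain ⟨K, hK0, hKt, hK⟩ := exists_lintegral_coneMeasure_eq hn ha
  refine ⟨K, hK0, hKt, fun ρ hρ φ hφ => ?_⟩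
  have h := hK ((Set.Iio ρ).indicator φ) (hφ.indicator measurableSet_Iio)
  have hS : MeasurableSet {z : EuclideanSpace ℝ (Fin (n + 1)) | 0 < ⟪z, a⟫} :=
    (isOpen_setOf_lt_inner a 0).measurableSet
  have e1 : ∫⁻ z in cap n a ρ, φ (Real.sqrt (1 - ⟪z, a⟫ ^ 2)) ∂coneMeasure n =
      ∫⁻ z in {z | 0 < ⟪z, a⟫}, (Set.Iio ρ).indicator φ (Real.sqrt (1 - ⟪z, a⟫ ^ 2))
        ∂coneMeasure n := by
    rw [← lintegral_indicator (measurableSet_cap n a ρ), ← lintegral_indicator hS]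
    refine lintegral_congr_ae ?_
    filter_upwards [ae_coneMeasure_mem_sphere n] with z hz
    simp only [Set.indicator, cap, Set.mem_ofPred_eq, sqrt_one_sub_lt_iff hρ.1, Set.mem_Iio, hz,
      true_and, ite_and]
  have e2 : ∫⁻ r in Set.Ioo (0 : ℝ) ρ, ENNReal.ofReal (r ^ (n - 1) / Real.sqrt (1 - r ^ 2)) * φ r =
      ∫⁻ r in Set.Ioo (0 : ℝ) 1, ENNReal.ofReal (r ^ (n - 1) / Real.sqrt (1 - r ^ 2)) *
        (Set.Iio ρ).indicator φ r := by
    rw [← lintegral_indicator measurableSet_Ioo, ← lintegral_indicator measurableSet_Ioo]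
    refine lintegral_congr fun r => ?_
    by_cases h0 : 0 < r <;> by_cases h1 : r < ρ
    · simp [Set.indicator, h0, h1, h1.trans_le hρ.2]
    all_goals simp [Set.indicator, h0, h1]
  rw [e1, h, e2]

/-- Constant in the tube bound `volume_tube_le_tubeConst`. -/
noncomputable def tubeConst (n : ℕ) : ℝ :=
  if n = 1 then (3 / 2 + Real.sqrt (Real.pi / 2)) * Real.exp 1 * Real.sqrt (2 / Real.pi) * 2
  else if n = 2 then
    (2 + 7 / 3 * Real.sqrt (2 / Real.pi)) * Real.exp 1 * Real.sqrt (2 / Real.pi) * 3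
  else Real.exp (1 / 2) * (1 + 1 / n) ^ (((n : ℝ) + 1) / 2) * Real.exp 1 *
    Real.sqrt (2 * n / Real.pi) * (n + 1)

theorem volume_tube_le_tubeConst {n : ℕ} (hn : 1 ≤ n) {P : MvPolynomial (Fin (n + 1)) ℝ}
    (hP : P ≠ 0) {k d : ℕ} (hhom : P.IsHomogeneous k) (hk : k ≤ d)
    {S : Set (EuclideanSpace ℝ (Fin (n + 1)))}
    (hSP : ∀ x ∈ S, MvPolynomial.eval (fun i => x i) P = 0) {s : ℝ} (hs : 0 < s)
    {A : Set (EuclideanSpace ℝ (Fin (n + 1)))} (hA : Convex ℝ A) (hAo : IsOpen A)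
    (hAb : Bornology.IsBounded A) {q : EuclideanSpace ℝ (Fin (n + 1))} {r : ℝ} (hr : 0 < r)
    (hball : Metric.ball q r ⊆ A) :
    volume {z ∈ A | ∃ x ∈ S, dist z x < s} ≤
      ENNReal.ofReal (tubeConst n * (d * s / r)) * volume A := by
  unfold tubeConst
  split_ifs with h1 h2
  · subst h1
    exact volume_tube_le_two hP hhom hk hSP hs hA hAo hAb hr hball
  · subst h2
    exact volume_tube_le_three hP hhom hk hSP hs hA hAo hAb hr hball
  · exact volume_tube_le hn hP hhom hk hSP hs hA hAo hAb hr hball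

theorem ball_half_subset_cone {E : Type*} [NormedAddCommGroup E] [InnerProductSpace ℝ E] {a : E}
    (ha : ‖a‖ = 1) {σ : ℝ} (hσ : 0 < σ) (hσ1 : σ ≤ 1) :
    Metric.ball ((1 / 2 : ℝ) • a) (σ / 2) ⊆
      {z | ‖z‖ < 1 ∧ Real.sqrt (1 - σ ^ 2) * ‖z‖ < ⟪z, a⟫} := by
  intro z hz
  rw [Metric.mem_ball, dist_eq_norm] at hz
  have hq : Real.sqrt (1 - σ ^ 2) ^ 2 = 1 - σ ^ 2 := Real.sq_sqrt (by nlinarith)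
  refine ⟨?_, ?_⟩
  · have h1 := norm_add_le (z - (1 / 2 : ℝ) • a) ((1 / 2 : ℝ) • a)
    rw [sub_add_cancel, norm_smul, ha] at h1
    norm_num at h1
    linarith
  · by_contra hcon
    push Not at hcon
    have h2 : ‖z - (1 / 2 : ℝ) • a‖ ^ 2 = ‖z‖ ^ 2 - ⟪z, a⟫ + 1 / 4 := by
      rw [norm_sub_sq_real, real_inner_smul_right, norm_smul, ha]
      norm_num
      ring
    have h3 : ‖z - (1 / 2 : ℝ) • a‖ ^ 2 < (σ / 2) ^ 2 := by
      gcongr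
    nlinarith [sq_nonneg (‖z‖ - Real.sqrt (1 - σ ^ 2) / 2)]

theorem coneMeasure_tube_le {n : ℕ} (hn : 1 ≤ n) {P : MvPolynomial (Fin (n + 1)) ℝ}
    (hP : P ≠ 0) {k d : ℕ} (hhom : P.IsHomogeneous k) (hk : k ≤ d)
    {S : Set (EuclideanSpace ℝ (Fin (n + 1)))} (hSne : S.Nonempty)
    (hScone : ∀ x ∈ S, ∀ lam : ℝ, lam • x ∈ S)
    (hSP : ∀ x ∈ S, MvPolynomial.eval (fun i => x i) P = 0) {s : ℝ} (hs : 0 < s)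
    {a : EuclideanSpace ℝ (Fin (n + 1))} (ha : ‖a‖ = 1) {σ : ℝ} (hσ : 0 < σ) (hσ1 : σ ≤ 1) :
    coneMeasure n ({z | Metric.infDist z S < s} ∩ cap n a σ) ≤
      ENNReal.ofReal (2 * tubeConst n * (d * s / σ)) * coneMeasure n (cap n a σ) := by
  let A : Set (EuclideanSpace ℝ (Fin (n + 1))) :=
    {z | ‖z‖ < 1 ∧ Real.sqrt (1 - σ ^ 2) * ‖z‖ < ⟪z, a⟫}
  have hAc : Convex ℝ A := by
    have hc : ConvexOn ℝ Set.univ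
        (fun z : EuclideanSpace ℝ (Fin (n + 1)) => Real.sqrt (1 - σ ^ 2) * ‖z‖ - ⟪z, a⟫) := by
      refine ConvexOn.sub ((convexOn_univ_norm).smul (Real.sqrt_nonneg _)) ?_
      refine ⟨convex_univ, fun x _ y _ p q _ _ _ => ?_⟩
      simp [inner_add_left, real_inner_smul_left]
    have h1 := hc.convex_lt 0
    have h2 : A = Metric.ball 0 1 ∩ {x ∈ Set.univ | Real.sqrt (1 - σ ^ 2) * ‖x‖ - ⟪x, a⟫ < 0} := by
      ext z; simp [A]
    rw [h2]
    exact (convex_ball _ _).inter h1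
  have hAo : IsOpen A := by
    have h0 : IsOpen {z : EuclideanSpace ℝ (Fin (n + 1)) | ‖z‖ < 1} :=
      isOpen_lt continuous_norm continuous_const
    have h1 : IsOpen {z : EuclideanSpace ℝ (Fin (n + 1)) |
        Real.sqrt (1 - σ ^ 2) * ‖z‖ < ⟪z, a⟫} := isOpen_lt (by fun_prop) (by fun_prop)
    exact h0.inter h1
  have hAb : Bornology.IsBounded A :=
    (Metric.isBounded_ball (x := 0) (r := 1)).subset fun z hz => by simpa using hz.1
  have hmem : ∀ x : EuclideanSpace ℝ (Fin (n + 1)),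
      ‖x‖⁻¹ • x ∈ cap n a σ ∧ ‖x‖ < 1 ↔ x ∈ A := by
    intro x
    by_cases hx : x = 0
    · subst hx; simp [cap, A]
    have hx0 : 0 < ‖x‖ := norm_pos_iff.2 hx
    have : Real.sqrt (1 - σ ^ 2) < ⟪‖x‖⁻¹ • x, a⟫ ↔ Real.sqrt (1 - σ ^ 2) * ‖x‖ < ⟪x, a⟫ := by
      rw [real_inner_smul_left, inv_mul_eq_div, lt_div_iff₀ hx0]
    simp [cap, A, norm_smul, hx, this, and_comm]
  have hcap : coneMeasure n (cap n a σ) = volume A := by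
    rw [coneMeasure_apply (measurableSet_cap n a σ)]
    congr 1
    ext x
    exact hmem x
  have hB : MeasurableSet ({z | Metric.infDist z S < s} ∩ cap n a σ) :=
    (isOpen_lt (Metric.continuous_infDist_pt S) continuous_const).measurableSet.inter
      (measurableSet_cap n a σ)
  have h := volume_tube_le_tubeConst hn hP hhom hk hSP hs hAc hAo hAb (half_pos hσ)
    (ball_half_subset_cone ha hσ hσ1)
  rw [hcap, coneMeasure_apply hB]
  have e : tubeConst n * (d * s / (σ / 2)) = 2 * tubeConst n * (d * s / σ) := by
    field_simp
  rw [← e]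
  refine (measure_mono ?_).trans h
  rintro x ⟨⟨hx1, hx2⟩, hx3⟩
  refine ⟨(hmem x).1 ⟨hx2, hx3⟩, ?_⟩
  obtain ⟨y, hy, hyd⟩ := (Metric.infDist_lt_iff hSne).1 hx1
  refine ⟨‖x‖ • y, hScone y hy _, ?_⟩
  have hx0 : ‖x‖ ≠ 0 := by
    intro h0
    rw [norm_eq_zero.1 h0] at hx2
    simp [cap] at hx2
  have e2 : x = ‖x‖ • (‖x‖⁻¹ • x) := by rw [smul_smul, mul_inv_cancel₀ hx0, one_smul]
  calc dist x (‖x‖ • y) = dist (‖x‖ • (‖x‖⁻¹ • x)) (‖x‖ • y) := by rw [← e2]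
    _ = ‖x‖ * dist (‖x‖⁻¹ • x) y := by rw [dist_smul₀, norm_norm]
    _ ≤ 1 * dist (‖x‖⁻¹ • x) y := by gcongr
    _ < s := by rwa [one_mul]

theorem intervalIntegrable_Ifun {m : ℝ} (hm : 0 < m) :
    IntervalIntegrable (fun r : ℝ => r ^ (m - 1) / Real.sqrt (1 - r ^ 2)) volume 0 1 := by
  have h1 : IntervalIntegrable (fun r : ℝ => r ^ (m - 1) / Real.sqrt (1 - r ^ 2)) volume 0
      (1 / 2) := by
    have h0 : IntervalIntegrable (fun r : ℝ => r ^ (m - 1)) volume 0 (1 / 2) :=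
      intervalIntegral.intervalIntegrable_rpow' (by linarith)
    refine (h0.mul_continuousOn (g := fun r => (Real.sqrt (1 - r ^ 2))⁻¹) ?_)
    refine ContinuousOn.inv₀ (by fun_prop) fun r hr => ?_
    rw [Set.uIcc_of_le (by norm_num)] at hr
    exact (Real.sqrt_pos.2 (by nlinarith [hr.1, hr.2])).ne'
  have h2 : IntervalIntegrable (fun r : ℝ => r ^ (m - 1) / Real.sqrt (1 - r ^ 2)) volume
      (1 / 2) 1 := by
    have h0 : IntervalIntegrable (fun r : ℝ => (1 - r) ^ (-(1 / 2) : ℝ)) volume (1 / 2) 1 := by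
      have := (intervalIntegral.intervalIntegrable_rpow' (a := 1 / 2) (b := 0)
        (r := -(1 / 2)) (by norm_num)).comp_sub_left 1
      norm_num at this ⊢
      exact this
    have h3 := h0.mul_continuousOn
      (g := fun r => r ^ (m - 1) * (1 + r) ^ (-(1 / 2) : ℝ)) (by
        refine ContinuousOn.mul ?_ ?_
        · refine ContinuousOn.rpow_const (by fun_prop) fun r hr => Or.inl ?_
          rw [Set.uIcc_of_le (by norm_num)] at hr
          linarith [hr.1]
        · refine ContinuousOn.rpow_const (by fun_prop) fun r hr => Or.inl ?_
          rw [Set.uIcc_of_le (by norm_num)] at hr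
          linarith [hr.1])
    refine h3.congr fun r hr => ?_
    rw [Set.uIoc_of_le (by norm_num)] at hr
    have e : 1 - r ^ 2 = (1 - r) * (1 + r) := by ring
    have hr2 := hr.2
    have hr1 : 0 ≤ 1 + r := by linarith [hr.1]
    rw [e, Real.sqrt_mul (by linarith), Real.sqrt_eq_rpow, Real.sqrt_eq_rpow,
      Real.rpow_neg (by linarith), Real.rpow_neg hr1]
    simp only [div_eq_mul_inv, mul_inv]
    ring
  exact h1.trans h2

theorem intervalIntegrable_Ifun_of_mem {m : ℝ} (hm : 0 < m) {x y : ℝ}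
    (hx : x ∈ Set.Icc (0 : ℝ) 1) (hy : y ∈ Set.Icc (0 : ℝ) 1) :
    IntervalIntegrable (fun r : ℝ => r ^ (m - 1) / Real.sqrt (1 - r ^ 2)) volume x y := by
  refine (intervalIntegrable_Ifun hm).mono_set ?_
  rw [Set.uIcc_of_le (zero_le_one' ℝ)]
  exact Set.uIcc_subset_Icc hx hy

theorem Ifun_zero (m : ℝ) : Ifun m 0 = 0 := by simp [Ifun]

theorem Ifun_pos {m ρ : ℝ} (hm : 0 < m) (hρ : ρ ∈ Set.Ioc (0 : ℝ) 1) : 0 < Ifun m ρ := by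
  refine intervalIntegral.intervalIntegral_pos_of_pos_on
    (intervalIntegrable_Ifun_of_mem hm (by simp) ⟨hρ.1.le, hρ.2⟩) (fun x hx => ?_) hρ.1
  have hx1 : x < 1 := hx.2.trans_le hρ.2
  have : 0 < 1 - x ^ 2 := by nlinarith [hx.1]
  exact div_pos (Real.rpow_pos_of_pos hx.1 _) (Real.sqrt_pos.2 this)

theorem continuousOn_Ifun {m : ℝ} (hm : 0 < m) : ContinuousOn (Ifun m) (Set.Icc 0 1) := by
  have := intervalIntegral.continuousOn_primitive_interval' (intervalIntegrable_Ifun hm)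
    (a := 0) (by simp)
  rwa [Set.uIcc_of_le (zero_le_one' ℝ)] at this

theorem hasDerivAt_Ifun {m r : ℝ} (hm : 0 < m) (hr : r ∈ Set.Ioo (0 : ℝ) 1) :
    HasDerivAt (Ifun m) (r ^ (m - 1) / Real.sqrt (1 - r ^ 2)) r := by
  have hc : ∀ x ∈ Set.Ioo (0 : ℝ) 1,
      ContinuousAt (fun r : ℝ => r ^ (m - 1) / Real.sqrt (1 - r ^ 2)) x := by
    intro x hx
    refine ContinuousAt.div (Real.continuousAt_rpow_const _ _ (Or.inl hx.1.ne')) (by fun_prop) ?_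
    exact (Real.sqrt_pos.2 (by nlinarith [hx.1, hx.2])).ne'
  refine intervalIntegral.integral_hasDerivAt_right
    (intervalIntegrable_Ifun_of_mem hm (by simp) ⟨hr.1.le, hr.2.le⟩) ?_ (hc r hr)
  exact ContinuousOn.stronglyMeasurableAtFilter isOpen_Ioo
    (fun x hx => (hc x hx).continuousWithinAt) r hr

theorem lintegral_eq_Ifun {m ρ : ℝ} (hm : 0 < m) (hρ : ρ ∈ Set.Ioc (0 : ℝ) 1) :
    ∫⁻ r in Set.Ioo (0 : ℝ) ρ, ENNReal.ofReal (r ^ (m - 1) / Real.sqrt (1 - r ^ 2)) =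
      ENNReal.ofReal (Ifun m ρ) := by
  have hi := intervalIntegrable_Ifun_of_mem hm (x := 0) (y := ρ) (by simp) ⟨hρ.1.le, hρ.2⟩
  rw [intervalIntegrable_iff_integrableOn_Ioo_of_le hρ.1.le] at hi
  rw [Ifun, intervalIntegral.integral_of_le hρ.1.le, integral_Ioc_eq_integral_Ioo,
    ofReal_integral_eq_lintegral_ofReal hi]
  refine (ae_restrict_iff' measurableSet_Ioo).2 (ae_of_all _ fun x hx => ?_)
  exact div_nonneg (Real.rpow_nonneg hx.1.le _) (Real.sqrt_nonneg _)

theorem Ifun_le_rpow_mul {n ρ σ : ℝ} (hn : 0 < n) (hρ : 0 < ρ) (hρσ : ρ ≤ σ) (hσ : σ ≤ 1) :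
    Ifun n ρ ≤ (ρ / σ) ^ n * Ifun n σ := by
  have hσ0 : 0 < σ := hρ.trans_le hρσ
  have hc : 0 < ρ / σ := div_pos hρ hσ0
  have hc1 : ρ / σ ≤ 1 := (div_le_one hσ0).2 hρσ
  have e := intervalIntegral.mul_integral_comp_mul_left (a := 0) (b := σ) (ρ / σ)
    (f := fun r : ℝ => r ^ (n - 1) / Real.sqrt (1 - r ^ 2))
  rw [mul_zero, div_mul_cancel₀ _ hσ0.ne'] at e
  have hi := intervalIntegrable_Ifun_of_mem hn (x := 0) (y := ρ) (by simp)
    ⟨hρ.le, hρσ.trans hσ⟩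
  have hi2 := hi.comp_mul_left (c := ρ / σ)
  rw [zero_div, div_div_cancel₀ hρ.ne'] at hi2
  have hiσ := intervalIntegrable_Ifun_of_mem hn (x := 0) (y := σ) (by simp) ⟨hσ0.le, hσ⟩
  have hle : ∫ x in (0 : ℝ)..σ, (ρ / σ * x) ^ (n - 1) / Real.sqrt (1 - (ρ / σ * x) ^ 2) ≤
      ∫ x in (0 : ℝ)..σ, (ρ / σ) ^ (n - 1) * (x ^ (n - 1) / Real.sqrt (1 - x ^ 2)) := by
    refine intervalIntegral.integral_mono_on_of_le_Ioo hσ0.le hi2 (hiσ.const_mul _) fun x hx => ?_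
    have hx1 : x < 1 := hx.2.trans_le hσ
    rw [Real.mul_rpow hc.le hx.1.le, mul_div_assoc]
    have h0 : 0 < 1 - x ^ 2 := by nlinarith [hx.1]
    have h1 := Real.sqrt_pos.2 h0
    have h2 := Real.rpow_pos_of_pos hx.1 (n - 1)
    have h3 := Real.rpow_pos_of_pos hc (n - 1)
    gcongr
    · exact mul_nonneg hc.le hx.1.le
    · exact mul_le_of_le_one_left hx.1.le hc1
  rw [intervalIntegral.integral_const_mul] at hle
  calc Ifun n ρ = _ := e.symm
    _ ≤ ρ / σ * ((ρ / σ) ^ (n - 1) * Ifun n σ) := by gcongr; exact hle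
    _ = (ρ / σ) ^ n * Ifun n σ := by
      rw [← mul_assoc, Real.rpow_sub_one hc.ne', mul_div_cancel₀ _ hc.ne']

theorem mul_Ifun_le_mul_Ifun {m n r : ℝ} (hm : 0 < m) (hmn : m ≤ n) (hr : r ∈ Set.Ioc (0 : ℝ) 1) :
    m / r ^ m * Ifun m r ≤ n / r ^ n * Ifun n r := by
  rcases hmn.eq_or_lt with rfl | hmn
  · rfl
  have hn : 0 < n := hm.trans hmn
  have hr0 := hr.1
  have hrm := Real.rpow_pos_of_pos hr0 m
  have hrn := Real.rpow_pos_of_pos hr0 n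
  -- the sign of the difference of the two densities changes at `c`
  let c : ℝ := r * (m / n) ^ (1 / (n - m))
  have hnm : 0 < n - m := sub_pos.2 hmn
  have hq : 0 < (m / n) ^ (1 / (n - m)) := Real.rpow_pos_of_pos (div_pos hm hn) _
  have hq1 : (m / n) ^ (1 / (n - m)) < 1 :=
    Real.rpow_lt_one (div_pos hm hn).le ((div_lt_one hn).2 hmn) (by positivity)
  have hc0 : 0 < c := mul_pos hr0 hq
  have hc1 : c < 1 := by
    calc c < r * 1 := mul_lt_mul_of_pos_left hq1 hr0
      _ ≤ 1 := by linarith [hr.2]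
  have hcpow : c ^ (n - m) = r ^ (n - m) * (m / n) := by
    rw [Real.mul_rpow hr0.le hq.le, ← Real.rpow_mul (div_pos hm hn).le,
      one_div_mul_cancel hnm.ne', Real.rpow_one]
  have hw : 0 < Real.sqrt (1 - c ^ 2) := Real.sqrt_pos.2 (by nlinarith)
  have hrI : r ∈ Set.Icc (0 : ℝ) 1 := ⟨hr0.le, hr.2⟩
  have him := (intervalIntegrable_Ifun_of_mem hm (x := 0) (y := r) (by simp) hrI).const_mul
    (m / r ^ m)
  have hin := (intervalIntegrable_Ifun_of_mem hn (x := 0) (y := r) (by simp) hrI).const_mul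
    (n / r ^ n)
  have hpm : IntervalIntegrable (fun x : ℝ => m / r ^ m * x ^ (m - 1)) volume 0 r :=
    (intervalIntegral.intervalIntegrable_rpow' (by linarith)).const_mul _
  have hpn : IntervalIntegrable (fun x : ℝ => n / r ^ n * x ^ (n - 1)) volume 0 r :=
    (intervalIntegral.intervalIntegrable_rpow' (by linarith)).const_mul _
  have hone : ∀ p : ℝ, 0 < p → ∫ x in (0 : ℝ)..r, p / r ^ p * x ^ (p - 1) = 1 := by
    intro p hp
    have := Real.rpow_pos_of_pos hr0 p
    rw [intervalIntegral.integral_const_mul, integral_rpow (Or.inl (by linarith))]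
    rw [sub_add_cancel, Real.zero_rpow hp.ne']
    field_simp
    ring
  have key : ∀ x ∈ Set.Ioo 0 r,
      (n / r ^ n * x ^ (n - 1) - m / r ^ m * x ^ (m - 1)) * (Real.sqrt (1 - c ^ 2))⁻¹ ≤
      n / r ^ n * (x ^ (n - 1) / Real.sqrt (1 - x ^ 2)) -
        m / r ^ m * (x ^ (m - 1) / Real.sqrt (1 - x ^ 2)) := by
    intro x hx
    have hx1 : x < 1 := hx.2.trans_le hr.2
    have hx0 := hx.1
    have hxw : 0 < Real.sqrt (1 - x ^ 2) := Real.sqrt_pos.2 (by nlinarith)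
    have e1 : n / r ^ n * x ^ (n - 1) - m / r ^ m * x ^ (m - 1) =
        n / r ^ n * x ^ (m - 1) * (x ^ (n - m) - c ^ (n - m)) := by
      have ex : x ^ (n - 1) = x ^ (m - 1) * x ^ (n - m) := by
        rw [← Real.rpow_add hx0]; ring_nf
      have er : r ^ n = r ^ m * r ^ (n - m) := by
        rw [← Real.rpow_add hr0]; ring_nf
      have hrnm := Real.rpow_pos_of_pos hr0 (n - m)
      rw [hcpow, ex, er]
      field_simp
    have e2 : n / r ^ n * (x ^ (n - 1) / Real.sqrt (1 - x ^ 2)) -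
        m / r ^ m * (x ^ (m - 1) / Real.sqrt (1 - x ^ 2)) =
        (n / r ^ n * x ^ (n - 1) - m / r ^ m * x ^ (m - 1)) * (Real.sqrt (1 - x ^ 2))⁻¹ := by
      ring
    rw [e2, e1]
    have hpos : 0 < n / r ^ n * x ^ (m - 1) :=
      mul_pos (div_pos hn hrn) (Real.rpow_pos_of_pos hx0 _)
    rcases le_total x c with hxc | hxc
    · refine mul_le_mul_of_nonpos_left ?_ ?_
      · gcongr
      · refine mul_nonpos_of_nonneg_of_nonpos hpos.le (sub_nonpos.2 ?_)
        gcongr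
    · refine mul_le_mul_of_nonneg_left ?_ ?_
      · gcongr
      · refine mul_nonneg hpos.le (sub_nonneg.2 ?_)
        gcongr
  have hint := intervalIntegral.integral_mono_on_of_le_Ioo hr0.le
    ((hpn.sub hpm).mul_const _) (hin.sub him) key
  rw [intervalIntegral.integral_mul_const, intervalIntegral.integral_sub hpn hpm, hone n hn,
    hone m hm, sub_self, zero_mul, intervalIntegral.integral_sub hin him,
    intervalIntegral.integral_const_mul, intervalIntegral.integral_const_mul] at hint
  exact sub_nonneg.1 hint

theorem Ifun_div_le_rpow {m n ρ σ : ℝ} (hm : 0 < m) (hmn : m ≤ n) (hρ : 0 < ρ) (hρσ : ρ ≤ σ)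
    (hσ : σ ≤ 1) : Ifun m ρ / Ifun m σ ≤ (Ifun n ρ / Ifun n σ) ^ (m / n) := by
  have hn : 0 < n := hm.trans_le hmn
  have hmem : ∀ x ∈ Set.Icc ρ σ, x ∈ Set.Ioc (0 : ℝ) 1 :=
    fun x hx => ⟨hρ.trans_le hx.1, hx.2.trans hσ⟩
  have hsub : Set.Icc ρ σ ⊆ Set.Icc (0 : ℝ) 1 := Set.Icc_subset_Icc hρ.le hσ
  have hmonoL : MonotoneOn (fun r => Real.log (Ifun m r) - m / n * Real.log (Ifun n r))
      (Set.Icc ρ σ) := by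
    have hd : ∀ x ∈ Set.Ioo ρ σ, HasDerivAt
        (fun r => Real.log (Ifun m r) - m / n * Real.log (Ifun n r))
        (x ^ (m - 1) / Real.sqrt (1 - x ^ 2) / Ifun m x -
          m / n * (x ^ (n - 1) / Real.sqrt (1 - x ^ 2) / Ifun n x)) x := by
      intro x hx
      have hx01 : x ∈ Set.Ioo (0 : ℝ) 1 := ⟨hρ.trans hx.1, hx.2.trans_le hσ⟩
      have hx' : x ∈ Set.Ioc (0 : ℝ) 1 := ⟨hx01.1, hx01.2.le⟩
      exact ((hasDerivAt_Ifun hm hx01).log (Ifun_pos hm hx').ne').sub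
        (((hasDerivAt_Ifun hn hx01).log (Ifun_pos hn hx').ne').const_mul _)
    refine monotoneOn_of_deriv_nonneg (convex_Icc ρ σ) ?_ ?_ ?_
    · exact (((continuousOn_Ifun hm).mono hsub).log fun x hx => (Ifun_pos hm (hmem x hx)).ne').sub
        ((((continuousOn_Ifun hn).mono hsub).log
          fun x hx => (Ifun_pos hn (hmem x hx)).ne').const_smul (m / n))
    · rw [interior_Icc]
      exact fun x hx => (hd x hx).differentiableAt.differentiableWithinAt
    · rw [interior_Icc]
      intro x hx
      rw [(hd x hx).deriv]
      have hx' := hmem x ⟨hx.1.le, hx.2.le⟩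
      have hx0 := hx'.1
      have h1 := mul_Ifun_le_mul_Ifun hm hmn hx'
      have hIm := Ifun_pos hm hx'
      have hIn := Ifun_pos hn hx'
      have hxm := Real.rpow_pos_of_pos hx0 m
      have hxn := Real.rpow_pos_of_pos hx0 n
      have hw := Real.sqrt_nonneg (1 - x ^ 2)
      rw [Real.rpow_sub_one hx0.ne', Real.rpow_sub_one hx0.ne']
      have e : x ^ m / x / Real.sqrt (1 - x ^ 2) / Ifun m x -
          m / n * (x ^ n / x / Real.sqrt (1 - x ^ 2) / Ifun n x) =
          x ^ m * x ^ n / (x * Real.sqrt (1 - x ^ 2) * Ifun m x * n * Ifun n x) *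
            (n / x ^ n * Ifun n x - m / x ^ m * Ifun m x) := by
        field_simp
      rw [e]
      exact mul_nonneg (by positivity) (sub_nonneg.2 h1)
  have h := hmonoL (Set.left_mem_Icc.2 hρσ) (Set.right_mem_Icc.2 hρσ) hρσ
  have hmρ := Ifun_pos hm (hmem ρ (Set.left_mem_Icc.2 hρσ))
  have hnρ := Ifun_pos hn (hmem ρ (Set.left_mem_Icc.2 hρσ))
  have hmσ := Ifun_pos hm (hmem σ (Set.right_mem_Icc.2 hρσ))
  have hnσ := Ifun_pos hn (hmem σ (Set.right_mem_Icc.2 hρσ))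
  simp only at h
  rw [← Real.log_le_log_iff (by positivity) (by positivity), Real.log_rpow (by positivity),
    Real.log_div hmρ.ne' hmσ.ne', Real.log_div hnρ.ne' hnσ.ne']
  linarith

theorem setLIntegral_le_of_measure_le {α : Type*} [MeasurableSpace α] {κ : Measure α} {A D : Set α}
    (hA : MeasurableSet A) (hD : MeasurableSet D) (hAD : κ A ≤ κ D) (hfin : κ A ≠ ∞)
    {F : α → ℝ≥0∞} {G : ℝ≥0∞} (h1 : ∀ z ∈ A \ D, F z ≤ G) (h2 : ∀ z ∈ D \ A, G ≤ F z) :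
    ∫⁻ z in A, F z ∂κ ≤ ∫⁻ z in D, F z ∂κ := by
  have hdiff : κ (A \ D) ≤ κ (D \ A) := by
    rw [← measure_inter_add_sdiff A hD, ← measure_inter_add_sdiff D hA, Set.inter_comm D A] at hAD
    exact (ENNReal.add_le_add_iff_left
      (ne_top_of_le_ne_top hfin (measure_mono Set.inter_subset_left))).1 hAD
  rw [← lintegral_inter_add_sdiff F A hD, ← lintegral_inter_add_sdiff F D hA, Set.inter_comm D A]
  gcongr 1
  calc ∫⁻ z in A \ D, F z ∂κ ≤ ∫⁻ _ in A \ D, G ∂κ := setLIntegral_mono' (hA.diff hD) h1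
    _ = G * κ (A \ D) := setLIntegral_const _ _
    _ ≤ G * κ (D \ A) := by gcongr
    _ = ∫⁻ _ in D \ A, G ∂κ := (setLIntegral_const _ _).symm
    _ ≤ ∫⁻ z in D \ A, F z ∂κ := setLIntegral_mono' (hD.diff hA) h2

theorem cap_subset_cap {n : ℕ} (a : EuclideanSpace ℝ (Fin (n + 1))) {ρ σ : ℝ} (hρ : 0 < ρ)
    (hρσ : ρ ≤ σ) : cap n a ρ ⊆ cap n a σ := by
  rintro z ⟨hz, h⟩
  refine ⟨hz, lt_of_le_of_lt (Real.sqrt_le_sqrt ?_) h⟩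
  nlinarith

/-- Antitone extension to `ℝ` of an antitone function on `(0, σ]`. -/
theorem exists_antitone_extension {σ : ℝ} {g : ℝ → ℝ} (hg : AntitoneOn g (Set.Ioc 0 σ)) :
    ∃ φ : ℝ → ℝ≥0∞, Antitone φ ∧ φ 0 = ∞ ∧ ∀ r ∈ Set.Ioc 0 σ, φ r = ENNReal.ofReal (g r) := by
  refine ⟨fun r => if r ≤ 0 then ∞ else if r ≤ σ then ENNReal.ofReal (g r) else 0, ?_, by simp,
    fun r hr => by simp [hr.2, hr.1]⟩
  intro x y hxy
  simp only
  by_cases hx : x ≤ 0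
  · simp [hx]
  have hy : ¬ y ≤ 0 := fun hy => hx (hxy.trans hy)
  by_cases hyσ : y ≤ σ
  · have hxσ := hxy.trans hyσ
    simp only [hx, hy, hyσ, hxσ, if_true, if_false]
    exact ENNReal.ofReal_le_ofReal (hg ⟨not_le.1 hx, hxσ⟩ ⟨not_le.1 hy, hyσ⟩ hxy)
  · simp [hy, hyσ]

theorem advMeasure_le {n : ℕ} (hn : 1 ≤ n) {a : EuclideanSpace ℝ (Fin (n + 1))} (ha : ‖a‖ = 1)
    {β σ ρ : ℝ} (hβn : β < n) (hσ : σ ∈ Set.Ioc (0 : ℝ) 1) (hρ : ρ ∈ Set.Ioc 0 σ) {h : ℝ → ℝ}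
    (hmono : AntitoneOn (gFun n σ β h) (Set.Ioc 0 σ)) {H : ℝ} (hH0 : 0 ≤ H)
    (hH : ∀ r ∈ Set.Icc 0 σ, h r ≤ H)
    {B : Set (EuclideanSpace ℝ (Fin (n + 1)))} (hB : MeasurableSet B)
    (hBle : coneMeasure n (B ∩ cap n a σ) ≤
      ENNReal.ofReal (Ifun n ρ / Ifun n σ) * coneMeasure n (cap n a σ)) :
    advMeasure n a σ β h B ≤
      ENNReal.ofReal (H * (Ifun (n - β) ρ / Ifun (n - β) σ)) := by
  have hnr : (0 : ℝ) < n := by exact_mod_cast hn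
  have hm : 0 < (n : ℝ) - β := sub_pos.2 hβn
  have hρ1 : ρ ∈ Set.Ioc (0 : ℝ) 1 := ⟨hρ.1, hρ.2.trans hσ.2⟩
  have hInσ := Ifun_pos hnr hσ
  have hInρ := Ifun_pos hnr hρ1
  have hImσ := Ifun_pos hm hσ
  rw [advMeasure, withDensity_apply _ hB]
  rcases nuMeasure_eq_zero_or ha hσ.1 with h0 | h0
  · simp [h0]
  obtain ⟨K, hK0, hKt, hK⟩ := exists_lintegral_coneMeasure_cap hn ha
  have hw : ∀ r : ℝ, r ^ (n - 1) = r ^ ((n : ℝ) - 1) := by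
    intro r
    rw [← Nat.cast_pred (by lia), Real.rpow_natCast]
  have hcap : ∀ τ ∈ Set.Ioc (0 : ℝ) 1,
      coneMeasure n (cap n a τ) = K * ENNReal.ofReal (Ifun n τ) := by
    intro τ hτ
    have := hK τ hτ (fun _ => 1) measurable_const
    simp only [mul_one, setLIntegral_const, one_mul, hw] at this
    rw [this, lintegral_eq_Ifun hnr hτ]
  obtain ⟨φ, hφ, hφ0, hφg⟩ := exists_antitone_extension hmono
  have hle : coneMeasure n (B ∩ cap n a σ) ≤ coneMeasure n (cap n a ρ) := by
    refine hBle.trans_eq ?_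
    rw [hcap σ hσ, hcap ρ hρ1, mul_left_comm, ← ENNReal.ofReal_mul (by positivity),
      div_mul_cancel₀ _ hInσ.ne']
  have hmem : ∀ z ∈ cap n a σ, 0 < ⟪z, a⟫ ∧ Real.sqrt (1 - ⟪z, a⟫ ^ 2) < σ :=
    fun z hz => (sqrt_one_sub_lt_iff hσ.1).1 hz.2
  have hsub := cap_subset_cap a hρ.1 hρ.2
  have h1 : ∫⁻ z in B ∩ cap n a σ,
      ENNReal.ofReal (gFun n σ β h (Real.sqrt (1 - ⟪z, a⟫ ^ 2))) ∂coneMeasure n ≤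
      ∫⁻ z in cap n a ρ, φ (Real.sqrt (1 - ⟪z, a⟫ ^ 2)) ∂coneMeasure n := by
    refine (setLIntegral_mono' (hB.inter (measurableSet_cap n a σ)) fun z hz => ?_).trans
      (setLIntegral_le_of_measure_le (hB.inter (measurableSet_cap n a σ)) (measurableSet_cap n a ρ)
        hle (measure_ne_top _ _) (G := φ ρ) ?_ ?_)
    · rcases (Real.sqrt_nonneg (1 - ⟪z, a⟫ ^ 2)).eq_or_lt with h2 | h2
      · rw [← h2, hφ0]; exact le_top
      · rw [hφg _ ⟨h2, (hmem z hz.2).2.le⟩]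
    · rintro z ⟨hz1, hz2⟩
      refine hφ (le_of_not_gt fun hlt => hz2 ⟨hz1.2.1, ?_⟩)
      exact (sqrt_one_sub_lt_iff hρ.1).2 ⟨(hmem z hz1.2).1, hlt⟩
    · rintro z ⟨hz1, -⟩
      exact hφ ((sqrt_one_sub_lt_iff hρ.1).1 hz1.2).2.le
  have h2 : ∫⁻ r in Set.Ioo (0 : ℝ) ρ, ENNReal.ofReal (r ^ (n - 1) / Real.sqrt (1 - r ^ 2)) * φ r ≤
      ENNReal.ofReal (Ifun n σ / Ifun (n - β) σ * H * Ifun (n - β) ρ) := by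
    rw [ENNReal.ofReal_mul (by positivity), ← lintegral_eq_Ifun hm hρ1,
      ← lintegral_const_mul' _ _ ENNReal.ofReal_ne_top]
    refine setLIntegral_mono' measurableSet_Ioo fun r hr => ?_
    rw [hφg r ⟨hr.1, hr.2.le.trans hρ.2⟩, gFun, hw, ← ENNReal.ofReal_mul
      (div_nonneg (Real.rpow_nonneg hr.1.le _) (Real.sqrt_nonneg _)),
      ← ENNReal.ofReal_mul (by positivity)]
    refine ENNReal.ofReal_le_ofReal ?_
    have e : r ^ ((n : ℝ) - β - 1) = r ^ ((n : ℝ) - 1) * r ^ (-β) := by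
      rw [← Real.rpow_add hr.1]; ring_nf
    have hr1 := Real.rpow_nonneg hr.1.le ((n : ℝ) - 1)
    have hr2 := Real.rpow_nonneg hr.1.le (-β)
    have hh := hH r ⟨hr.1.le, hr.2.le.trans hρ.2⟩
    calc r ^ ((n : ℝ) - 1) / Real.sqrt (1 - r ^ 2) *
          (Ifun n σ / Ifun (n - β) σ * r ^ (-β) * h r)
        ≤ r ^ ((n : ℝ) - 1) / Real.sqrt (1 - r ^ 2) *
          (Ifun n σ / Ifun (n - β) σ * r ^ (-β) * H) := by gcongr
      _ = _ := by rw [e]; ring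
  rw [h0, Measure.restrict_smul, lintegral_smul_measure, Measure.restrict_restrict hB, smul_eq_mul,
    hcap σ hσ]
  refine (mul_le_mul_right (h1.trans ((hK ρ hρ1 φ hφ.measurable).trans_le
    (mul_le_mul_right h2 K))) _).trans_eq ?_
  have e : Ifun n σ / Ifun (n - β) σ * H * Ifun (n - β) ρ =
      Ifun n σ * (H * (Ifun (n - β) ρ / Ifun (n - β) σ)) := by ring
  rw [e, ENNReal.ofReal_mul hInσ.le, ← mul_assoc, ← mul_assoc]
  have hne : K * ENNReal.ofReal (Ifun n σ) ≠ 0 := by simp [hK0, hInσ]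
  rw [mul_assoc _ K, ENNReal.inv_mul_cancel hne (ENNReal.mul_ne_top hKt ENNReal.ofReal_ne_top),
    one_mul]

/-- A weight function on `[0, σ]` with mean `1` has supremum at least `1`. -/
theorem one_le_of_integral_mul_eq {m σ : ℝ} (hm : 0 < m) (hσ : σ ∈ Set.Ioc (0 : ℝ) 1) {h : ℝ → ℝ}
    (hcont : ContinuousOn h (Set.Icc 0 σ))
    (hint : (∫ r in (0 : ℝ)..σ, h r * (r ^ (m - 1) / Real.sqrt (1 - r ^ 2))) = Ifun m σ) {H : ℝ}
    (hH : ∀ r ∈ Set.Icc 0 σ, h r ≤ H) : 1 ≤ H := by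
  have hi := intervalIntegrable_Ifun_of_mem hm (x := 0) (y := σ) (by simp) ⟨hσ.1.le, hσ.2⟩
  have hle : ∫ r in (0 : ℝ)..σ, h r * (r ^ (m - 1) / Real.sqrt (1 - r ^ 2)) ≤
      ∫ r in (0 : ℝ)..σ, H * (r ^ (m - 1) / Real.sqrt (1 - r ^ 2)) := by
    refine intervalIntegral.integral_mono_on hσ.1.le
      (hi.continuousOn_mul (by rwa [Set.uIcc_of_le hσ.1.le])) (hi.const_mul _) fun r hr => ?_
    exact mul_le_mul_of_nonneg_right (hH r hr)
      (div_nonneg (Real.rpow_nonneg hr.1 _) (Real.sqrt_nonneg _))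
  rw [hint, intervalIntegral.integral_const_mul] at hle
  exact le_of_mul_le_mul_right (by rw [one_mul]; exact hle) (Ifun_pos hm hσ)

theorem exists_Ifun_eq {n σ y : ℝ} (hn : 0 < n) (hσ : σ ∈ Set.Ioc (0 : ℝ) 1) (hy : 0 < y)
    (hy1 : y ≤ 1) : ∃ ρ ∈ Set.Ioc 0 σ, Ifun n ρ / Ifun n σ = y := by
  have hI := Ifun_pos hn hσ
  have hc := (continuousOn_Ifun hn).mono (Set.Icc_subset_Icc_right hσ.2)
  obtain ⟨ρ, hρ, hρy⟩ := intermediate_value_Icc hσ.1.le hc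
    (show y * Ifun n σ ∈ Set.Icc (Ifun n 0) (Ifun n σ) by
      rw [Ifun_zero]
      exact ⟨by positivity, mul_le_of_le_one_left hI.le hy1⟩)
  refine ⟨ρ, ⟨hρ.1.lt_of_ne ?_, hρ.2⟩, by rw [hρy, mul_div_cancel_right₀ _ hI.ne']⟩
  rintro rfl
  rw [Ifun_zero] at hρy
  exact (mul_pos hy hI).ne hρy

/-- Tail bound for the adversarial measure at scales below `δε`, for any normalising constant `M`
dominating the constant in the tube bound. -/
theorem advMeasure_tube_le {n : ℕ} (hn : 1 ≤ n) {P : MvPolynomial (Fin (n + 1)) ℝ}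
    (hP : P ≠ 0) {k d : ℕ} (hhom : P.IsHomogeneous k) (hk : k ≤ d)
    {S : Set (EuclideanSpace ℝ (Fin (n + 1)))} (hSne : S.Nonempty)
    (hScone : ∀ x ∈ S, ∀ lam : ℝ, lam • x ∈ S)
    (hSP : ∀ x ∈ S, MvPolynomial.eval (fun i => x i) P = 0) {s : ℝ} (hs : 0 < s)
    {a : EuclideanSpace ℝ (Fin (n + 1))} (ha : ‖a‖ = 1) {β σ : ℝ} (hσ : σ ∈ Set.Ioc (0 : ℝ) 1)
    (hβ0 : 0 ≤ β) (hβn : β < n) {h : ℝ → ℝ}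
    (hmono : AntitoneOn (gFun n σ β h) (Set.Ioc 0 σ)) {H : ℝ} (hH0 : 0 ≤ H)
    (hH : ∀ r ∈ Set.Icc 0 σ, h r ≤ H) {y : ℝ} (hy : 0 < y) (hy1 : y ≤ 1)
    (hty : 2 * tubeConst n * (d * s / σ) ≤ y) :
    advMeasure n a σ β h {z | Metric.infDist z S < s} ≤
      ENNReal.ofReal (H * y ^ (1 - β / n)) := by
  have hnr : (0 : ℝ) < n := by exact_mod_cast hn
  obtain ⟨ρ, hρ, hρy⟩ := exists_Ifun_eq hnr hσ hy hy1
  have hB : MeasurableSet {z : EuclideanSpace ℝ (Fin (n + 1)) | Metric.infDist z S < s} :=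
    (isOpen_lt (Metric.continuous_infDist_pt S) continuous_const).measurableSet
  refine (advMeasure_le hn ha hβn hσ hρ hmono hH0 hH hB ?_).trans (ENNReal.ofReal_le_ofReal ?_)
  · refine (coneMeasure_tube_le hn hP hhom hk hSne hScone hSP hs ha hσ.1 hσ.2).trans ?_
    rw [hρy]
    gcongr
  · have h1 := Ifun_div_le_rpow (m := n - β) (n := n) (sub_pos.2 hβn) (by linarith) hρ.1 hρ.2 hσ.2
    rw [hρy, sub_div, div_self hnr.ne'] at h1
    gcongr

theorem rescaled_bound {w q H ε δ : ℝ} (hw : 0 < w) (hw1 : w ≤ 1) (hq : 0 < q) (hq1 : q ≤ 1)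
    (hH : 1 ≤ H) (hε : 0 < ε) (hε2 : ε ≤ 1 / 2) (hδ : 0 < δ)
    (hle : δ ≤ (w / H) ^ (1 / ε) * Real.sqrt q) :
    δ / (w * q ^ (1 / 4 : ℝ)) ≤ 1 ∧ H * (δ / (w * q ^ (1 / 4 : ℝ))) ^ (2 * ε) ≤ δ ^ ε := by
  have hH0 : 0 < H := by linarith
  have hwH : 0 < w / H := by positivity
  have hwH1 : w / H ≤ w := div_le_self hw.le hH
  have hq4 : 0 < q ^ (1 / 4 : ℝ) := by positivity
  constructor
  · rw [div_le_one (by positivity)]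
    refine hle.trans (mul_le_mul ?_ ?_ (Real.sqrt_nonneg _) hw.le)
    · calc (w / H) ^ (1 / ε) ≤ (w / H) ^ (1 : ℝ) :=
            Real.rpow_le_rpow_of_exponent_ge hwH (hwH1.trans hw1)
              (by rw [le_div_iff₀ hε]; linarith)
        _ ≤ w := by rw [Real.rpow_one]; exact hwH1
    · rw [Real.sqrt_eq_rpow]
      exact Real.rpow_le_rpow_of_exponent_ge hq hq1 (by norm_num)
  · have h1 : δ ^ ε ≤ w / H * q ^ (ε / 2) := by
      calc δ ^ ε ≤ ((w / H) ^ (1 / ε) * Real.sqrt q) ^ ε := by gcongr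
        _ = w / H * q ^ (ε / 2) := by
          rw [Real.mul_rpow (by positivity) (by positivity), ← Real.rpow_mul hwH.le,
            one_div_mul_cancel hε.ne', Real.rpow_one, Real.sqrt_eq_rpow, ← Real.rpow_mul hq.le]
          ring_nf
    have h2 : w ≤ w ^ (2 * ε) := by
      conv_lhs => rw [← Real.rpow_one w]
      exact Real.rpow_le_rpow_of_exponent_ge hw hw1 (by linarith)
    have e1 : δ ^ (2 * ε) = δ ^ ε * δ ^ ε := by
      rw [← Real.rpow_add hδ]; ring_nf
    have e2 : (q ^ (1 / 4 : ℝ)) ^ (2 * ε) = q ^ (ε / 2) := by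
      rw [← Real.rpow_mul hq.le]; ring_nf
    have hw2 : 0 < w ^ (2 * ε) := by positivity
    have hq2 : 0 < q ^ (ε / 2) := by positivity
    have hδε : 0 < δ ^ ε := by positivity
    rw [Real.div_rpow hδ.le (by positivity), Real.mul_rpow hw.le hq4.le, e1, e2, mul_div_assoc',
      div_le_iff₀ (by positivity)]
    calc H * (δ ^ ε * δ ^ ε) ≤ H * (δ ^ ε * (w / H * q ^ (ε / 2))) := by gcongr
      _ = δ ^ ε * (w * q ^ (ε / 2)) := by field_simp
      _ ≤ δ ^ ε * (w ^ (2 * ε) * q ^ (ε / 2)) := by gcongr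

/-- The tail bound for `advMeasure`, given the numerical bound on `tubeConst`. -/
theorem advMeasure_tail_le_of_tubeConst_le (n d : ℕ) (hn : 1 ≤ n) (hd : 1 ≤ d)
    (hnum : 2 * tubeConst n * (Real.sqrt (1 - (2 / (Real.pi * n)) ^ (1 / n : ℝ)) *
      (2 / (Real.pi * n)) ^ (1 / 4 : ℝ)) ≤ 13 * n)
    (S : Set (EuclideanSpace ℝ (Fin (n + 1)))) (hSne : S.Nonempty)
    (hScone : ∀ x ∈ S, ∀ lam : ℝ, lam • x ∈ S)
    (P : MvPolynomial (Fin (n + 1)) ℝ) (hP : P ≠ 0)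
    (k : ℕ) (hk : k ≤ d) (hhom : P.IsHomogeneous k)
    (hSP : ∀ x ∈ S, MvPolynomial.eval (fun i => x i) P = 0)
    (σ : ℝ) (hσ : σ ∈ Set.Ioc (0:ℝ) 1)
    (a : EuclideanSpace ℝ (Fin (n + 1)))
    (ha : a ∈ Metric.sphere (0 : EuclideanSpace ℝ (Fin (n + 1))) 1)
    (β : ℝ) (hβ0 : 0 ≤ β) (hβn : β < n)
    (h : ℝ → ℝ) (hcont : ContinuousOn h (Set.Icc 0 σ))
    (hint : (∫ r in (0:ℝ)..σ, h r * (r ^ ((n : ℝ) - β - 1) / Real.sqrt (1 - r ^ 2)))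
      = Ifun ((n : ℝ) - β) σ)
    (hmono : AntitoneOn (gFun n σ β h) (Set.Ioc 0 σ))
    (H : ℝ) (hH : H = sSup (h '' Set.Icc 0 σ))
    (ε : ℝ) (hε : ε = (1 / 2) * (1 - β / n))
    (ρε : ℝ) (hρε : ρε = σ *
      ((1 / H) * Real.sqrt (1 - (2 / (Real.pi * n)) ^ ((1 - β / n - ε) / (n * ε))))
        ^ (1 / (ε * n)) *
      (Real.sqrt (2 / (Real.pi * n))) ^ ((1 - β / n - ε) / (ε * n)))
    (δε : ℝ) (hδε : δε = Ifun n ρε / Ifun n σ)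
    (tε : ℝ) (htε : tε = Real.log (13 * d * n / (σ * δε)))
    (t : ℝ) (ht : tε ≤ t) :
    advMeasure n a σ β h {z | Metric.infDist z S < Real.exp (-t)} ≤
      ENNReal.ofReal ((13 * d * n / σ * Real.exp (-t)) ^ ((1 / 2) * (1 - β / n))) := by
  have hnr : (1 : ℝ) ≤ n := by exact_mod_cast hn
  have hn0 : (0 : ℝ) < n := by linarith
  have hdr : (0 : ℝ) < d := by exact_mod_cast hd
  have hσ0 := hσ.1
  have hβn1 : β / n < 1 := (div_lt_one hn0).2 hβn
  have hβn0 : 0 ≤ β / n := by positivity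
  have hε0 : 0 < ε := by rw [hε]; linarith
  have hε2 : ε ≤ 1 / 2 := by rw [hε]; linarith
  have eε : 1 - β / n = 2 * ε := by rw [hε]; ring
  have hbdd : ∀ r ∈ Set.Icc 0 σ, h r ≤ H := by
    intro r hr
    rw [hH]
    exact le_csSup (isCompact_Icc.image_of_continuousOn hcont).bddAbove ⟨r, hr, rfl⟩
  have hH1 : 1 ≤ H := one_le_of_integral_mul_eq (sub_pos.2 hβn) hσ hcont hint hbdd
  have hH0 : 0 < H := by linarith
  have ex1 : (1 - β / n - ε) / (n * ε) = 1 / n := by rw [eε]; field_simp; ring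
  have ex2 : (1 - β / n - ε) / (ε * n) = 1 / n := by rw [eε]; field_simp; ring
  rw [ex1, ex2] at hρε
  generalize hqdef : 2 / (Real.pi * n) = q at *
  have hq0 : 0 < q := by rw [← hqdef]; positivity
  have hq1 : q < 1 := by
    rw [← hqdef, div_lt_one (by positivity)]
    nlinarith [Real.pi_gt_three]
  generalize hwdef : Real.sqrt (1 - q ^ (1 / n : ℝ)) = w at *
  have hqn : q ^ (1 / n : ℝ) < 1 := Real.rpow_lt_one hq0.le hq1 (by positivity)
  have hqn0 : 0 < q ^ (1 / n : ℝ) := by positivity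
  have hw0 : 0 < w := by rw [← hwdef]; exact Real.sqrt_pos.2 (by linarith)
  have hw1 : w ≤ 1 := by
    rw [← hwdef]
    exact Real.sqrt_le_one.2 (by linarith)
  have hρσ : ρε / σ = (w / H) ^ (1 / (ε * n)) * Real.sqrt q ^ (1 / n : ℝ) := by
    rw [hρε, one_div_mul_eq_div]; field_simp
  have hρ0 : 0 < ρε := by
    rw [hρε]; positivity
  have hρle : ρε ≤ σ := by
    rw [← div_le_one hσ0, hρσ]
    refine mul_le_one₀ (Real.rpow_le_one (by positivity) ?_ (by positivity)) (by positivity)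
      (Real.rpow_le_one (by positivity) ?_ (by positivity))
    · exact (div_le_one hH0).2 (by linarith)
    · exact Real.sqrt_le_one.2 hq1.le
  have hIσ := Ifun_pos hn0 hσ
  have hIρ := Ifun_pos hn0 (show ρε ∈ Set.Ioc (0 : ℝ) 1 from ⟨hρ0, hρle.trans hσ.2⟩)
  have hδ0 : 0 < δε := by rw [hδε]; positivity
  have hδle : δε ≤ (w / H) ^ (1 / ε) * Real.sqrt q := by
    have h1 := Ifun_le_rpow_mul hn0 hρ0 hρle hσ.2
    rw [← div_le_iff₀ hIσ, ← hδε, hρσ, Real.mul_rpow (by positivity) (by positivity),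
      ← Real.rpow_mul (by positivity), ← Real.rpow_mul (by positivity),
      one_div_mul_cancel hn0.ne', Real.rpow_one] at h1
    have e : 1 / (ε * n) * n = 1 / ε := by field_simp
    rwa [e] at h1
  have hδ : 13 * d * n / σ * Real.exp (-t) ≤ δε := by
    rw [htε] at ht
    have h1 := (Real.log_le_iff_le_exp (by positivity)).1 ht
    rw [Real.exp_neg, ← div_eq_mul_inv, div_le_iff₀ (Real.exp_pos t)]
    rw [← div_div, div_le_iff₀ hδ0] at h1
    linarith
  have hδpos : 0 < 13 * d * n / σ * Real.exp (-t) := by positivity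
  obtain ⟨hy1, hy2⟩ := rescaled_bound hw0 hw1 hq0 hq1.le hH1 hε0 hε2 hδpos (hδ.trans hδle)
  have hwq : 0 < w * q ^ (1 / 4 : ℝ) := by positivity
  refine (advMeasure_tube_le hn hP hhom hk hSne hScone hSP (Real.exp_pos (-t)) (by simpa using ha)
    hσ hβ0 hβn hmono hH0.le hbdd (div_pos hδpos hwq) hy1 ?_).trans (ENNReal.ofReal_le_ofReal ?_)
  · rw [le_div_iff₀ hwq]
    have h0 : 0 ≤ d * Real.exp (-t) / σ := by positivity
    calc 2 * tubeConst n * (d * Real.exp (-t) / σ) * (w * q ^ (1 / 4 : ℝ))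
        = 2 * tubeConst n * (w * q ^ (1 / 4 : ℝ)) * (d * Real.exp (-t) / σ) := by ring
      _ ≤ 13 * n * (d * Real.exp (-t) / σ) := by gcongr
      _ = 13 * d * n / σ * Real.exp (-t) := by ring
  · rw [← hε, eε]
    exact hy2

theorem mul_sqrt_mul_rpow_le_of_sq {n : ℕ} {C q : ℝ} (hq0 : 0 < q)
    (hq1 : q ^ (1 / n : ℝ) ≤ 1)
    (h : 4 * C ^ 2 * (1 - q ^ (1 / n : ℝ)) * Real.sqrt q ≤ 169 * n ^ 2) :
    2 * C * (Real.sqrt (1 - q ^ (1 / n : ℝ)) * q ^ (1 / 4 : ℝ)) ≤ 13 * n := by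
  refine (abs_le_of_sq_le_sq' ?_ (by positivity)).2
  have e1 : (q ^ (1 / 4 : ℝ)) ^ 2 = Real.sqrt q := by
    rw [Real.sqrt_eq_rpow, ← Real.rpow_natCast, ← Real.rpow_mul hq0.le]
    norm_num
  rw [mul_pow, mul_pow, mul_pow, e1, Real.sq_sqrt (by linarith)]
  linarith

theorem sqrt_two_div_pi_bounds :
    (0.79788 : ℝ) < Real.sqrt (2 / Real.pi) ∧ Real.sqrt (2 / Real.pi) < 0.79789 := by
  have hpi := Real.pi_pos
  have h1 := Real.pi_gt_d6
  have h2 := Real.pi_lt_d6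
  constructor
  · rw [Real.lt_sqrt (by norm_num), lt_div_iff₀ hpi]
    nlinarith
  · rw [Real.sqrt_lt' (by norm_num), div_lt_iff₀ hpi]
    nlinarith

theorem exp_one_sq_lt : Real.exp 1 ^ 2 < 7.38906 := by
  have h := Real.exp_one_lt_d9
  have h0 := Real.exp_pos 1
  nlinarith

theorem exp_one_cube_lt : Real.exp 1 ^ 3 < 20.0856 := by
  have h := Real.exp_one_lt_d9
  have h0 := Real.exp_pos 1
  have h2 := exp_one_sq_lt
  nlinarith

theorem tubeConst_one_bound :
    2 * tubeConst 1 * (Real.sqrt (1 - (2 / (Real.pi * (1 : ℕ))) ^ (1 / (1 : ℕ) : ℝ)) *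
      (2 / (Real.pi * (1 : ℕ))) ^ (1 / 4 : ℝ)) ≤ 13 * (1 : ℕ) := by
  have hpi := Real.pi_pos
  obtain ⟨h1, h2⟩ := sqrt_two_div_pi_bounds
  have hu2 : Real.sqrt (2 / Real.pi) ^ 2 = 2 / Real.pi := Real.sq_sqrt (by positivity)
  have huv : Real.sqrt (Real.pi / 2) * Real.sqrt (2 / Real.pi) = 1 := by
    rw [← Real.sqrt_mul (by positivity), div_mul_div_comm, mul_comm, div_self (by positivity),
      Real.sqrt_one]
  have hC : tubeConst 1 = Real.exp 1 * (3 * Real.sqrt (2 / Real.pi) + 2) := by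
    rw [tubeConst, if_pos rfl]
    linear_combination 2 * Real.exp 1 * huv
  have e1 : (2 / Real.pi) ^ (1 / ((1 : ℕ) : ℝ)) = Real.sqrt (2 / Real.pi) ^ 2 := by
    rw [hu2]; norm_num
  have e0 : Real.pi * ((1 : ℕ) : ℝ) = Real.pi := by simp
  rw [e0]
  refine mul_sqrt_mul_rpow_le_of_sq (by positivity) ?_ ?_
  · rw [e1]; nlinarith
  · rw [e1, hC]
    generalize Real.sqrt (2 / Real.pi) = u at *
    have he := exp_one_sq_lt
    have hA : (3 * u + 2) ^ 2 * u ≤ (3 * 0.79789 + 2) ^ 2 * 0.79789 := by gcongr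
    have hB : 1 - u ^ 2 ≤ 1 - 0.79788 ^ 2 := by gcongr
    calc 4 * (Real.exp 1 * (3 * u + 2)) ^ 2 * (1 - u ^ 2) * u
        = 4 * (Real.exp 1 ^ 2 * (((3 * u + 2) ^ 2 * u) * (1 - u ^ 2))) := by ring
      _ ≤ 4 * (7.38906 * (((3 * 0.79789 + 2) ^ 2 * 0.79789) * (1 - 0.79788 ^ 2))) := by
        have : 0 ≤ 1 - u ^ 2 := by nlinarith
        have : 0 ≤ (3 * u + 2) ^ 2 * u := by positivity
        gcongr
      _ ≤ 169 * ((1 : ℕ) : ℝ) ^ 2 := by norm_num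

theorem tubeConst_two_bound :
    2 * tubeConst 2 * (Real.sqrt (1 - (2 / (Real.pi * (2 : ℕ))) ^ (1 / (2 : ℕ) : ℝ)) *
      (2 / (Real.pi * (2 : ℕ))) ^ (1 / 4 : ℝ)) ≤ 13 * (2 : ℕ) := by
  have hpi := Real.pi_pos
  obtain ⟨h1, h2⟩ := sqrt_two_div_pi_bounds
  have hq0 : 0 < 2 / (Real.pi * ((2 : ℕ) : ℝ)) := by positivity
  have e1 : (2 / (Real.pi * ((2 : ℕ) : ℝ))) ^ (1 / ((2 : ℕ) : ℝ)) =
      Real.sqrt (2 / (Real.pi * ((2 : ℕ) : ℝ))) := by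
    rw [Real.sqrt_eq_rpow]; norm_num
  have hv1 : 0.564 < Real.sqrt (2 / (Real.pi * ((2 : ℕ) : ℝ))) := by
    rw [Real.lt_sqrt (by norm_num), lt_div_iff₀ (by positivity)]
    have := Real.pi_lt_d6
    push_cast
    nlinarith
  have hv2 : Real.sqrt (2 / (Real.pi * ((2 : ℕ) : ℝ))) < 0.565 := by
    rw [Real.sqrt_lt' (by norm_num), div_lt_iff₀ (by positivity)]
    have := Real.pi_gt_d6
    push_cast
    nlinarith
  have hC : tubeConst 2 = Real.exp 1 * (6 * Real.sqrt (2 / Real.pi) +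
      7 * Real.sqrt (2 / Real.pi) ^ 2) := by
    rw [tubeConst, if_neg (by norm_num), if_pos rfl]
    ring
  refine mul_sqrt_mul_rpow_le_of_sq hq0 ?_ ?_
  · rw [e1]; linarith
  · rw [e1, hC]
    generalize Real.sqrt (2 / (Real.pi * ((2 : ℕ) : ℝ))) = v at *
    generalize Real.sqrt (2 / Real.pi) = u at *
    have he := exp_one_sq_lt
    have hA : (6 * u + 7 * u ^ 2) ^ 2 ≤ (6 * 0.79789 + 7 * 0.79789 ^ 2) ^ 2 := by gcongr
    calc 4 * (Real.exp 1 * (6 * u + 7 * u ^ 2)) ^ 2 * (1 - v) * v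
        = 4 * (Real.exp 1 ^ 2 * ((6 * u + 7 * u ^ 2) ^ 2 * ((1 - v) * v))) := by ring
      _ ≤ 4 * (7.38906 * ((6 * 0.79789 + 7 * 0.79789 ^ 2) ^ 2 * ((1 - 0.564) * 0.565))) := by
        have : 0 ≤ 1 - v := by linarith
        have : 0 ≤ v := by linarith
        gcongr
      _ ≤ 169 * ((2 : ℕ) : ℝ) ^ 2 := by norm_num

theorem tubeConst_sq {n : ℕ} (hn : 3 ≤ n) :
    tubeConst n ^ 2 = Real.exp 1 ^ 3 * (1 + 1 / n) ^ (n + 1) * (2 * n / Real.pi) * (n + 1) ^ 2 := by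
  have hn0 : (0 : ℝ) < n := by exact_mod_cast (by lia : 0 < n)
  have e1 : Real.exp (1 / 2) ^ 2 = Real.exp 1 := by
    rw [← Real.exp_nat_mul]; norm_num
  have e2 : ((1 + 1 / n : ℝ) ^ (((n : ℝ) + 1) / 2)) ^ 2 = (1 + 1 / n) ^ (n + 1) := by
    rw [← Real.rpow_natCast, ← Real.rpow_mul (by positivity), ← Real.rpow_natCast]
    push_cast
    congr 1
    ring
  rw [tubeConst, if_neg (by lia), if_neg (by lia), mul_pow, mul_pow, mul_pow, mul_pow, e1, e2,
    Real.sq_sqrt (by positivity)]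
  ring

theorem tubeConst_bound_of_rational {n : ℕ} (hn : 3 ≤ n) {x z : ℝ} (hx : 0 ≤ x) (hz : 0 ≤ z)
    (hx1 : x ≤ 1) (hxq : x ^ n * (3.1416 * n) ≤ 2) (hzq : 2 ≤ z ^ 2 * (3.1415 * n))
    (hnum : 4 * (20.0856 * (1 + 1 / n) ^ (n + 1) * (2 * n / 3.1415) * (n + 1) ^ 2) * (1 - x) * z ≤
      169 * n ^ 2) :
    2 * tubeConst n * (Real.sqrt (1 - (2 / (Real.pi * n)) ^ (1 / n : ℝ)) *
      (2 / (Real.pi * n)) ^ (1 / 4 : ℝ)) ≤ 13 * n := by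
  have hpi := Real.pi_pos
  have hpi1 := Real.pi_gt_d4
  have hpi2 := Real.pi_lt_d4
  have hn3 : (3 : ℝ) ≤ n := by exact_mod_cast hn
  have hn0 : (0 : ℝ) < n := by linarith
  have hq0 : 0 < 2 / (Real.pi * n) := by positivity
  have hq1 : 2 / (Real.pi * n) ≤ 1 := by
    rw [div_le_one (by positivity)]; nlinarith
  have hqn : (2 / (Real.pi * n)) ^ (1 / n : ℝ) ≤ 1 := Real.rpow_le_one hq0.le hq1 (by positivity)
  have hxle : x ≤ (2 / (Real.pi * n)) ^ (1 / n : ℝ) := by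
    rw [one_div, Real.le_rpow_inv_iff_of_pos hx hq0.le hn0, Real.rpow_natCast,
      le_div_iff₀ (by positivity)]
    refine le_trans ?_ hxq
    gcongr
  have hzle : Real.sqrt (2 / (Real.pi * n)) ≤ z := by
    rw [Real.sqrt_le_left hz, div_le_iff₀ (by positivity)]
    refine hzq.trans ?_
    gcongr
  refine mul_sqrt_mul_rpow_le_of_sq hq0 hqn ?_
  rw [tubeConst_sq hn]
  refine le_trans ?_ hnum
  have he := exp_one_cube_lt
  have h1 : 0 ≤ 1 - x := by linarith
  gcongr

theorem tubeConst_bound_of_six_le {n : ℕ} (hn : 6 ≤ n) :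
    2 * tubeConst n * (Real.sqrt (1 - (2 / (Real.pi * n)) ^ (1 / n : ℝ)) *
      (2 / (Real.pi * n)) ^ (1 / 4 : ℝ)) ≤ 13 * n := by
  have hpi := Real.pi_pos
  have hpi1 := Real.pi_gt_d4
  have hn6 : (6 : ℝ) ≤ n := by exact_mod_cast hn
  have hn0 : (0 : ℝ) < n := by linarith
  have hq0 : 0 < 2 / (Real.pi * n) := by positivity
  have hq1 : 2 / (Real.pi * n) ≤ 1 := by
    rw [div_le_one (by positivity)]; nlinarith
  have hqn : (2 / (Real.pi * n)) ^ (1 / n : ℝ) ≤ 1 := Real.rpow_le_one hq0.le hq1 (by positivity)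
  refine mul_sqrt_mul_rpow_le_of_sq hq0 hqn ?_
  have key : (1 - (2 / (Real.pi * n)) ^ (1 / n : ℝ)) * Real.sqrt (2 / (Real.pi * n)) ≤
      2 / (Real.exp 1 * n) := by
    generalize 2 / (Real.pi * n) = q at *
    have hs := Real.sqrt_pos.2 hq0
    have h1 : 1 - q ^ (1 / n : ℝ) ≤ -(Real.log q / n) := by
      rw [Real.rpow_def_of_pos hq0]
      have := Real.add_one_le_exp (Real.log q * (1 / n))
      have e : Real.log q * (1 / n) = Real.log q / n := by ring
      rw [e] at this ⊢
      linarith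
    have h2 : -Real.log q ≤ 2 / (Real.exp 1 * Real.sqrt q) := by
      have := Real.log_le_sub_one_of_pos
        (show 0 < 1 / (Real.exp 1 * Real.sqrt q) by positivity)
      rw [one_div, Real.log_inv, Real.log_mul (Real.exp_pos 1).ne' hs.ne', Real.log_exp,
        Real.log_sqrt hq0.le] at this
      rw [div_eq_mul_inv]
      linarith
    calc (1 - q ^ (1 / n : ℝ)) * Real.sqrt q ≤ -(Real.log q / n) * Real.sqrt q := by gcongr
      _ = -Real.log q * (Real.sqrt q / n) := by ring
      _ ≤ 2 / (Real.exp 1 * Real.sqrt q) * (Real.sqrt q / n) := by gcongr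
      _ = 2 / (Real.exp 1 * n) := by field_simp
  have hpow : (1 + 1 / n : ℝ) ^ n ≤ Real.exp 1 := by
    calc (1 + 1 / n : ℝ) ^ n ≤ Real.exp (1 / n) ^ n := by
          gcongr
          linarith [Real.add_one_le_exp (1 / n : ℝ)]
      _ = Real.exp 1 := by rw [← Real.exp_nat_mul, mul_one_div_cancel hn0.ne']
  have he := exp_one_cube_lt
  have he0 := Real.exp_pos 1
  rw [tubeConst_sq (by lia), mul_assoc]
  calc 4 * (Real.exp 1 ^ 3 * (1 + 1 / n : ℝ) ^ (n + 1) * (2 * n / Real.pi) * (n + 1) ^ 2) *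
        ((1 - (2 / (Real.pi * n)) ^ (1 / n : ℝ)) * Real.sqrt (2 / (Real.pi * n)))
      ≤ 4 * (Real.exp 1 ^ 3 * (1 + 1 / n : ℝ) ^ (n + 1) * (2 * n / Real.pi) * (n + 1) ^ 2) *
        (2 / (Real.exp 1 * n)) := by gcongr
    _ = 16 * Real.exp 1 ^ 2 * (1 + 1 / n : ℝ) ^ n * (n + 1) ^ 3 / n / Real.pi := by
      rw [pow_succ (1 + 1 / n : ℝ) n]
      field_simp
      ring
    _ ≤ 16 * Real.exp 1 ^ 2 * Real.exp 1 * (7 / 6 * n) ^ 3 / n / 3.1415 := by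
      gcongr
      linarith
    _ = 16 * (7 / 6) ^ 3 / 3.1415 * Real.exp 1 ^ 3 * n ^ 2 := by
      field_simp
    _ ≤ 16 * (7 / 6) ^ 3 / 3.1415 * 20.0856 * n ^ 2 := by gcongr
    _ ≤ 169 * n ^ 2 := by
      gcongr
      norm_num

theorem tubeConst_bound {n : ℕ} (hn : 1 ≤ n) :
    2 * tubeConst n * (Real.sqrt (1 - (2 / (Real.pi * n)) ^ (1 / n : ℝ)) *
      (2 / (Real.pi * n)) ^ (1 / 4 : ℝ)) ≤ 13 * n := by
  rcases le_or_gt 6 n with h6 | h6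
  · exact tubeConst_bound_of_six_le h6
  interval_cases n
  · exact tubeConst_one_bound
  · exact tubeConst_two_bound
  · exact tubeConst_bound_of_rational (x := 0.596) (z := 0.4607) (by norm_num) (by norm_num)
      (by norm_num) (by norm_num) (by norm_num) (by norm_num) (by norm_num)
  · exact tubeConst_bound_of_rational (x := 0.63) (z := 0.4) (by norm_num) (by norm_num)
      (by norm_num) (by norm_num) (by norm_num) (by norm_num) (by norm_num)
  · exact tubeConst_bound_of_rational (x := 0.66) (z := 0.358) (by norm_num) (by norm_num)
      (by norm_num) (by norm_num) (by norm_num) (by norm_num) (by norm_num)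

/-- For `ε = (1/2)(1-β/n)` and `t_ε = ln(13dn/(σδ_ε))`: for all `t ≥ t_ε`, the
event `ln C(z) > t` (i.e. `dist(z,S) < e^{-t}`, also covering `dist(z,S) = 0`)
has probability at most `((13dn/σ)·e^{-t})^{(1/2)(1-β/n)}` under the adversarial
measure `μ`. -/
theorem stmt18 (n d : ℕ) (hn : 1 ≤ n) (hd : 1 ≤ d)
    (S : Set (EuclideanSpace ℝ (Fin (n + 1)))) (hSne : S.Nonempty) (hScl : IsClosed S)
    (hScone : ∀ x ∈ S, ∀ lam : ℝ, lam • x ∈ S)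
    (P : MvPolynomial (Fin (n + 1)) ℝ) (hP : P ≠ 0)
    (k : ℕ) (hk : k ≤ d) (hhom : P.IsHomogeneous k)
    (hSP : ∀ x ∈ S, MvPolynomial.eval (fun i => x i) P = 0)
    (σ : ℝ) (hσ : σ ∈ Set.Ioc (0:ℝ) 1)
    (a : EuclideanSpace ℝ (Fin (n + 1)))
    (ha : a ∈ Metric.sphere (0 : EuclideanSpace ℝ (Fin (n + 1))) 1)
    (β : ℝ) (hβ0 : 0 ≤ β) (hβn : β < n)
    (h : ℝ → ℝ) (hcont : ContinuousOn h (Set.Icc 0 σ))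
    (hpos : ∀ r ∈ Set.Icc (0:ℝ) σ, 0 < h r)
    (hint : (∫ r in (0:ℝ)..σ, h r * (r ^ ((n : ℝ) - β - 1) / Real.sqrt (1 - r ^ 2)))
      = Ifun ((n : ℝ) - β) σ)
    (hmono : AntitoneOn (gFun n σ β h) (Set.Ioc 0 σ))
    (H : ℝ) (hH : H = sSup (h '' Set.Icc 0 σ))
    (ε : ℝ) (hε : ε = (1 / 2) * (1 - β / n))
    (ρε : ℝ) (hρε : ρε = σ *
      ((1 / H) * Real.sqrt (1 - (2 / (Real.pi * n)) ^ ((1 - β / n - ε) / (n * ε))))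
        ^ (1 / (ε * n)) *
      (Real.sqrt (2 / (Real.pi * n))) ^ ((1 - β / n - ε) / (ε * n)))
    (δε : ℝ) (hδε : δε = Ifun n ρε / Ifun n σ)
    (tε : ℝ) (htε : tε = Real.log (13 * d * n / (σ * δε)))
    (t : ℝ) (ht : tε ≤ t) :
    advMeasure n a σ β h {z | Metric.infDist z S < Real.exp (-t)} ≤
      ENNReal.ofReal ((13 * d * n / σ * Real.exp (-t)) ^ ((1 / 2) * (1 - β / n))) :=
  advMeasure_tail_le_of_tubeConst_le n d hn hd (tubeConst_bound hn) S hSne hScone P hP k hk hhom hSP σ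
    hσ a ha β hβ0 hβn h hcont hint hmono H hH ε hε ρε hρε δε hδε tε htε t ht
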